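/- arXiv:2208.02603 — 2 statements merged into one kernel-verified Lean document; each statement's English description precedes it below -/
import Mathlib

section
/- For every dimension d ≥ 1 there exists a constant C_d > 0 with the following property: if Λ₁, …, Λ_N ⊆ ℝ^d are lattices of volume 1 such that Λ_i ∩ Λ_j = {0} for all i ≠ j, and f ∈ L¹(ℝ^d) with ∫ f ≠ 0 tiles with every Λ_i, then diam(supp f) ≥ C_d · N^{1/d}. -/
open MeasureTheory Convolution

noncomputable section

/-- The lattice `A·ℤ^d` in `ℝ^d`. -/
def latticeOf {d : ℕ} (A : Matrix (Fin d) (Fin d) ℝ) :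
    Set (EuclideanSpace ℝ (Fin d)) :=
  {x | ∃ m : Fin d → ℤ, x = A.mulVec (fun i => (m i : ℝ))}

/-- `f` tiles with the set `Λ` at level `c`: for a.e. `x` the series
`∑_{λ∈Λ} f(x-λ)` converges (absolutely, as summability in `ℝ` is absolute) to `c`. -/
def TilesAt {d : ℕ} (f : EuclideanSpace ℝ (Fin d) → ℝ)
    (Λ : Set (EuclideanSpace ℝ (Fin d))) (c : ℝ) : Prop :=
  ∀ᵐ x : EuclideanSpace ℝ (Fin d),
    (Summable fun l : Λ => f (x - (l : EuclideanSpace ℝ (Fin d)))) ∧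
    ∑' l : Λ, f (x - (l : EuclideanSpace ℝ (Fin d))) = c

/-- The essential support of `f`: the smallest closed set outside of which `f` vanishes a.e. -/
def essSupp {α E : Type*} [TopologicalSpace α] [MeasureSpace α] [Zero E]
    (f : α → E) : Set α :=
  ⋂₀ {S : Set α | IsClosed S ∧ ∀ᵐ x, x ∉ S → f x = 0}

/-- Iterated convolution `f₁ * f₂ * ⋯ * f_N` of a list of functions. -/
def convList {d : ℕ} :
    List (EuclideanSpace ℝ (Fin d) → ℝ) → (EuclideanSpace ℝ (Fin d) → ℝ)
  | [] => fun _ => 0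
  | [g] => g
  | g :: gs => g ⋆[ContinuousLinearMap.lsmul ℝ ℝ] convList gs

section
open Filter Topology
/-- uniform probability measure on `(a, b]` -/
def unif (a b : ℝ) : Measure ℝ := ENNReal.ofReal (b - a)⁻¹ • volume.restrict (Set.Ioc a b)

lemma unif_prob {a b : ℝ} (h : a < b) : IsProbabilityMeasure (unif a b) := by
  constructor
  simp only [unif, Measure.smul_apply, Measure.restrict_apply_univ, Real.volume_Ioc, smul_eq_mul]
  rw [← ENNReal.ofReal_mul (by simp; linarith), inv_mul_cancel₀ (by linarith), ENNReal.ofReal_one]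

instance unif_sf (a b : ℝ) : IsFiniteMeasure (unif a b) := by
  unfold unif
  constructor
  simp only [Measure.smul_apply, Measure.restrict_apply_univ, Real.volume_Ioc, smul_eq_mul]
  exact ENNReal.mul_lt_top (by simp) (by simp)

def cubeAvg (ι : Type*) [Fintype ι] (a b : ℝ) : Measure (ι → ℝ) := Measure.pi fun _ => unif a b

lemma cubeAvg_prob (ι : Type*) [Fintype ι] {a b : ℝ} (h : a < b) :
    IsProbabilityMeasure (cubeAvg ι a b) := by
  have := unif_prob h
  unfold cubeAvg; infer_instance

instance cubeAvg_fin (ι : Type*) [Fintype ι] (a b : ℝ) : IsFiniteMeasure (cubeAvg ι a b) := by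
  unfold cubeAvg; infer_instance

lemma integral_unif (a b : ℝ) (h : a < b) (g : ℝ → ℂ) :
    ∫ t, g t ∂(unif a b) = ((b - a)⁻¹ : ℝ) * ∫ t in a..b, g t := by
  unfold unif
  rw [integral_smul_measure, intervalIntegral.integral_of_le h.le, ENNReal.toReal_ofReal
    (by simp; linarith)]
  simp

lemma unif_exp_tendsto (ω : ℝ) (hω : ω ≠ 0) :
    Tendsto (fun T : ℝ => ∫ t, Complex.exp (2 * Real.pi * Complex.I * ω * t) ∂(unif (-T) T)) atTop (𝓝 0) := by
  have hc : (2 * Real.pi * Complex.I * ω : ℂ) ≠ 0 := by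
    simp [hω, Real.pi_ne_zero]
  rw [tendsto_zero_iff_norm_tendsto_zero]
  have h1 : Tendsto (fun T : ℝ => T⁻¹ * ‖(2 * Real.pi * Complex.I * ω : ℂ)‖⁻¹) atTop (𝓝 0) := by
    simpa using (tendsto_inv_atTop_zero.mul_const (‖(2 * Real.pi * Complex.I * ω : ℂ)‖⁻¹))
  refine squeeze_zero' (Eventually.of_forall fun _ => norm_nonneg _) ?_ h1
  filter_upwards [eventually_gt_atTop 0] with T hT
  rw [integral_unif _ _ (by linarith), integral_exp_mul_complex hc, norm_mul, norm_div]
  have e1 : ∀ s : ℝ, ‖Complex.exp (2 * Real.pi * Complex.I * ω * s)‖ = 1 := by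
    intro s
    rw [Complex.norm_exp]; simp
  have e2 := norm_sub_le (Complex.exp (2 * Real.pi * Complex.I * ω * T)) (Complex.exp (2 * Real.pi * Complex.I * ω * ((-T : ℝ) : ℂ)))
  rw [e1, e1] at e2
  have e3 : ‖(((T - -T)⁻¹ : ℝ) : ℂ)‖ = (2 * T)⁻¹ := by
    rw [Complex.norm_real, Real.norm_of_nonneg (by rw [inv_nonneg]; linarith)]; ring_nf
  rw [e3, div_eq_mul_inv]
  calc _ ≤ (2 * T)⁻¹ * (2 * ‖(2 * Real.pi * Complex.I * ω : ℂ)‖⁻¹) := by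
        gcongr; linarith
    _ = _ := by field_simp

lemma cubeAvg_exp_tendsto {d : ℕ} (ω : Fin d → ℝ) (hω : ω ≠ 0) :
    Tendsto (fun T : ℝ => ∫ ξ, ∏ k, Complex.exp (2 * Real.pi * Complex.I * ω k * (ξ k : ℝ)) ∂(cubeAvg (Fin d) (-T) T))
      atTop (𝓝 0) := by
  obtain ⟨k, hk⟩ : ∃ k, ω k ≠ 0 := by
    by_contra h; push Not at h; exact hω (funext h)
  rw [tendsto_zero_iff_norm_tendsto_zero]
  have h1 := (tendsto_zero_iff_norm_tendsto_zero.1 (unif_exp_tendsto (ω k) hk))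
  refine squeeze_zero' (Eventually.of_forall fun _ => norm_nonneg _) ?_ h1
  filter_upwards [eventually_gt_atTop 0] with T hT
  have := unif_prob (a := -T) (b := T) (by linarith)
  unfold cubeAvg
  rw [integral_fintype_prod_eq_prod (fun k (t : ℝ) => Complex.exp (2 * Real.pi * Complex.I * ω k * t)),
    ← Finset.mul_prod_erase _ _ (Finset.mem_univ k), norm_mul]
  refine mul_le_of_le_one_right (norm_nonneg _) ?_
  rw [norm_prod]
  refine Finset.prod_le_one (fun _ _ => norm_nonneg _) fun i _ => ?_
  refine (norm_integral_le_of_norm_le_const (C := 1) (Eventually.of_forall fun t => ?_)).trans (by simp)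
  rw [Complex.norm_exp]; simp

/-- projection to the torus -/
def tor {ι : Type*} (w : ι → ℝ) : UnitAddTorus ι := fun i => (w i : UnitAddCircle)

lemma continuous_tor {ι : Type*} : Continuous (tor : (ι → ℝ) → UnitAddTorus ι) := by
  unfold tor
  exact continuous_pi fun i => (AddCircle.continuous_mk' 1).comp (continuous_apply i)

def torMean {ι : Type*} [Fintype ι] (u : UnitAddTorus ι → ℂ) : ℂ := ∫ w, u (tor w) ∂(cubeAvg ι 0 1)

lemma torMean_mFourier {ι : Type*} [Fintype ι] (m : ι → ℤ) (hm : m ≠ 0) :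
    torMean (UnitAddTorus.mFourier m) = 0 := by
  obtain ⟨k, hk⟩ : ∃ k, m k ≠ 0 := by
    by_contra h; push Not at h; exact hm (funext h)
  unfold torMean cubeAvg tor UnitAddTorus.mFourier
  simp only [ContinuousMap.coe_mk]
  rw [integral_fintype_prod_eq_prod (fun k (t : ℝ) => fourier (m k) (t : UnitAddCircle))]
  refine Finset.prod_eq_zero (Finset.mem_univ k) ?_
  rw [integral_unif _ _ one_pos]
  simp only [fourier_coe_apply]
  have hc : (2 * Real.pi * Complex.I * m k : ℂ) ≠ 0 := by
    simp [hk, Real.pi_ne_zero]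
  have : ∀ t : ℝ, Complex.exp (2 * Real.pi * Complex.I * m k * t / (1 : ℝ)) =
    Complex.exp (2 * Real.pi * Complex.I * m k * t) := fun t => by simp
  simp only [this]
  rw [integral_exp_mul_complex hc]
  have h2 := Complex.exp_int_mul_two_pi_mul_I (m k)
  have : (2 * Real.pi * Complex.I * m k * (1 : ℝ) : ℂ) = m k * (2 * Real.pi * Complex.I) := by
    push_cast; ring
  rw [this, h2]; simp

lemma mFourier_tor {d : ℕ} {ι : Type*} [Fintype ι] (B : Matrix ι (Fin d) ℝ) (m : ι → ℤ) (ξ : Fin d → ℝ) :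
    UnitAddTorus.mFourier m (tor (B.mulVec ξ)) =
      ∏ k, Complex.exp (2 * Real.pi * Complex.I * (B.transpose.mulVec (fun i => (m i : ℝ))) k * (ξ k : ℝ)) := by
  unfold tor UnitAddTorus.mFourier
  simp only [ContinuousMap.coe_mk, fourier_coe_apply]
  rw [← Complex.exp_sum, ← Complex.exp_sum]
  congr 1
  simp only [Matrix.mulVec, dotProduct, Matrix.transpose_apply]
  push_cast
  simp only [Finset.mul_sum, Finset.sum_mul, Finset.sum_div]
  rw [Finset.sum_comm]
  refine Finset.sum_congr rfl fun k _ => Finset.sum_congr rfl fun i _ => ?_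
  simp; ring

lemma integrable_tor {d : ℕ} {ι : Type*} [Fintype ι] (μ : Measure (Fin d → ℝ)) [IsFiniteMeasure μ]
    (B : Matrix ι (Fin d) ℝ) (u : C(UnitAddTorus ι, ℂ)) :
    Integrable (fun ξ => u (tor (B.mulVec ξ))) μ := by
  have hc : Continuous (fun ξ => u (tor (B.mulVec ξ))) :=
    u.continuous.comp (continuous_tor.comp (by fun_prop))
  exact Integrable.of_bound hc.aestronglyMeasurable ‖u‖ (Eventually.of_forall fun x => u.norm_coe_le_norm _)

lemma integrable_tor' {ι : Type*} [Fintype ι] (μ : Measure (ι → ℝ)) [IsFiniteMeasure μ]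
    (u : C(UnitAddTorus ι, ℂ)) :
    Integrable (fun ξ => u (tor ξ)) μ := by
  have hc : Continuous (fun ξ => u (tor ξ)) :=
    u.continuous.comp continuous_tor
  exact Integrable.of_bound hc.aestronglyMeasurable ‖u‖ (Eventually.of_forall fun x => u.norm_coe_le_norm _)

/-- Weyl equidistribution -/
lemma weyl {d : ℕ} {ι : Type*} [Fintype ι] (B : Matrix ι (Fin d) ℝ)
    (hB : ∀ m : ι → ℤ, m ≠ 0 → B.transpose.mulVec (fun i => (m i : ℝ)) ≠ 0)
    (u : C(UnitAddTorus ι, ℂ)) :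
    Tendsto (fun T : ℝ => ∫ ξ, u (tor (B.mulVec ξ)) ∂(cubeAvg (Fin d) (-T) T)) atTop
      (𝓝 (torMean u)) := by
  have p01 := cubeAvg_prob ι (a := 0) (b := 1) one_pos
  have hspan : ∀ p ∈ Submodule.span ℂ (Set.range (UnitAddTorus.mFourier (d := ι))),
      Tendsto (fun T : ℝ => ∫ ξ, p (tor (B.mulVec ξ)) ∂(cubeAvg (Fin d) (-T) T)) atTop
      (𝓝 (torMean p)) := by
    intro p hp
    induction hp using Submodule.span_induction with
    | mem x h =>
      obtain ⟨m, rfl⟩ := h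
      by_cases hm : m = 0
      · subst hm
        simp only [UnitAddTorus.mFourier_zero, torMean, ContinuousMap.one_apply]
        refine tendsto_const_nhds.congr' ?_
        filter_upwards [eventually_gt_atTop 0] with T hT
        have := cubeAvg_prob (Fin d) (a := -T) (b := T) (by linarith)
        simp
      · rw [torMean_mFourier m hm]
        simp only [mFourier_tor]
        exact cubeAvg_exp_tendsto _ (hB m hm)
    | zero => simp [torMean]
    | add x y _ _ hx hy =>
      have e : torMean (x + y : C(UnitAddTorus ι, ℂ)) = torMean x + torMean y := by
        simp only [torMean, ContinuousMap.add_apply]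
        exact integral_add (integrable_tor' _ _) (integrable_tor' _ _)
      rw [e]
      refine (hx.add hy).congr fun T => ?_
      simp only [ContinuousMap.add_apply]
      exact (integral_add (integrable_tor _ _ _) (integrable_tor _ _ _)).symm
    | smul a x _ hx =>
      have e : torMean (a • x : C(UnitAddTorus ι, ℂ)) = a * torMean x := by
        simp only [torMean, ContinuousMap.smul_apply, smul_eq_mul]
        exact integral_const_mul _ _
      rw [e]
      refine (hx.const_mul a).congr fun T => ?_
      simp only [ContinuousMap.smul_apply, smul_eq_mul]
      exact (integral_const_mul _ _).symm
  rw [Metric.tendsto_atTop]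
  intro ε hε
  have hu : u ∈ (Submodule.span ℂ (Set.range (UnitAddTorus.mFourier (d := ι)))).topologicalClosure := by
    rw [UnitAddTorus.span_mFourier_closure_eq_top]; trivial
  have hu' : u ∈ closure ((Submodule.span ℂ (Set.range (UnitAddTorus.mFourier (d := ι)))) : Set C(UnitAddTorus ι, ℂ)) := hu
  obtain ⟨p, hp, hup⟩ := Metric.mem_closure_iff.1 hu' (ε / 4) (by linarith)
  obtain ⟨T0, hT0⟩ := Metric.tendsto_atTop.1 (hspan p hp) (ε / 4) (by linarith)
  have hpt : ∀ x, ‖u x - p x‖ ≤ ε / 4 := by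
    intro x
    rw [dist_eq_norm] at hup
    exact ((u - p).norm_coe_le_norm x).trans hup.le
  refine ⟨max T0 1, fun T hT => ?_⟩
  have hT1 : (1 : ℝ) ≤ T := le_trans (le_max_right _ _) hT
  have pT := cubeAvg_prob (Fin d) (a := -T) (b := T) (by linarith)
  have h2 := hT0 T (le_trans (le_max_left _ _) hT)
  have h1 : ‖∫ ξ, u (tor (B.mulVec ξ)) ∂(cubeAvg (Fin d) (-T) T) - ∫ ξ, p (tor (B.mulVec ξ)) ∂(cubeAvg (Fin d) (-T) T)‖ ≤ ε / 4 := by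
    rw [← integral_sub (integrable_tor _ _ _) (integrable_tor _ _ _)]
    refine (norm_integral_le_of_norm_le_const (C := ε / 4) (Eventually.of_forall fun t => hpt _)).trans (by simp)
  have h3 : ‖torMean p - torMean u‖ ≤ ε / 4 := by
    unfold torMean
    rw [← integral_sub (integrable_tor' _ _) (integrable_tor' _ _)]
    refine (norm_integral_le_of_norm_le_const (C := ε / 4) (Eventually.of_forall fun t => ?_)).trans (by simp)
    rw [norm_sub_rev]; exact hpt _
  rw [← dist_eq_norm] at h1 h3
  calc _ ≤ _ := dist_triangle4 _ _ _ _
    _ < ε := by linarith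


def torMeanR {ι : Type*} [Fintype ι] (u : UnitAddTorus ι → ℝ) : ℝ := ∫ w, u (tor w) ∂(cubeAvg ι 0 1)

lemma weylR {d : ℕ} {ι : Type*} [Fintype ι] (B : Matrix ι (Fin d) ℝ)
    (hB : ∀ m : ι → ℤ, m ≠ 0 → B.transpose.mulVec (fun i => (m i : ℝ)) ≠ 0)
    (u : C(UnitAddTorus ι, ℝ)) :
    Tendsto (fun T : ℝ => ∫ ξ, u (tor (B.mulVec ξ)) ∂(cubeAvg (Fin d) (-T) T)) atTop
      (𝓝 (torMeanR u)) := by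
  have h := weyl B hB ⟨fun x => (u x : ℂ), by fun_prop⟩
  simp only [ContinuousMap.coe_mk, torMean] at h
  have h2 := (Complex.continuous_re.tendsto _).comp h
  simp only [integral_complex_ofReal, Complex.ofReal_re] at h2
  refine h2.congr fun T => ?_
  simp only [Function.comp, integral_complex_ofReal, Complex.ofReal_re]

lemma torMeanR_mul {ι κ : Type*} [Fintype ι] [Fintype κ] (u : UnitAddTorus ι → ℝ) (v : UnitAddTorus κ → ℝ) :
    torMeanR (ι := ι ⊕ κ) (fun τ => u (fun i => τ (Sum.inl i)) * v (fun i => τ (Sum.inr i))) =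
      torMeanR u * torMeanR v := by
  unfold torMeanR cubeAvg
  rw [← integral_prod_mul]
  have := (measurePreserving_sumPiEquivProdPi (ι := ι) (ι' := κ) (X := fun _ => ℝ) (fun _ => unif 0 1))
  rw [← this.integral_comp']
  rfl

lemma integrable_torR {d : ℕ} {ι : Type*} [Fintype ι] (μ : Measure (Fin d → ℝ)) [IsFiniteMeasure μ]
    (B : Matrix ι (Fin d) ℝ) (u : C(UnitAddTorus ι, ℝ)) :
    Integrable (fun ξ => u (tor (B.mulVec ξ))) μ := by
  have hc : Continuous (fun ξ => u (tor (B.mulVec ξ))) :=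
    u.continuous.comp (continuous_tor.comp (by fun_prop))
  exact Integrable.of_bound hc.aestronglyMeasurable ‖u‖ (Eventually.of_forall fun x => u.norm_coe_le_norm _)

lemma integrable_torR' {ι : Type*} [Fintype ι] (μ : Measure (ι → ℝ)) [IsFiniteMeasure μ]
    (u : C(UnitAddTorus ι, ℝ)) :
    Integrable (fun ξ => u (tor ξ)) μ := by
  have hc : Continuous (fun ξ => u (tor ξ)) :=
    u.continuous.comp continuous_tor
  exact Integrable.of_bound hc.aestronglyMeasurable ‖u‖ (Eventually.of_forall fun x => u.norm_coe_le_norm _)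

lemma second_moment {d N : ℕ} (A : Fin N → Matrix (Fin d) (Fin d) ℝ)
    (h1 : ∀ i, ∀ m : Fin d → ℤ, (A i).mulVec (fun k => (m k : ℝ)) = 0 → m = 0)
    (h2 : ∀ i j, i ≠ j → ∀ m m' : Fin d → ℤ,
      (A i).mulVec (fun k => (m k : ℝ)) + (A j).mulVec (fun k => (m' k : ℝ)) = 0 → m = 0 ∧ m' = 0)
    (h : Fin N → C(UnitAddTorus (Fin d), ℝ)) (h01 : ∀ i x, 0 ≤ h i x ∧ h i x ≤ 1)
    (hpos : 0 < ∑ i, torMeanR (h i)) :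
    ∀ᶠ T : ℝ in atTop, (cubeAvg (Fin d) (-T) T).real {ξ | ∀ i, h i (tor ((A i).transpose.mulVec ξ)) = 0} ≤
      2 / ∑ i, torMeanR (h i) := by
  have p01 := cubeAvg_prob (Fin d) (a := 0) (b := 1) one_pos
  set μ : Fin N → ℝ := fun i => torMeanR (h i) with hμ
  set M := ∑ i, μ i with hM
  let φ : Fin N → C(UnitAddTorus (Fin d), ℝ) := fun i => h i - ContinuousMap.const _ (μ i)
  have hφ0 : ∀ i, torMeanR (φ i) = 0 := by
    intro i
    simp only [torMeanR, φ, ContinuousMap.sub_apply, ContinuousMap.const_apply]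
    rw [integral_sub (integrable_torR' _ _) (integrable_const _)]
    simp [hμ, torMeanR]
  have hφ2 : ∀ i, torMeanR (φ i * φ i : C(UnitAddTorus (Fin d), ℝ)) ≤ μ i := by
    intro i
    have e : ∀ w, (φ i * φ i : C(UnitAddTorus (Fin d), ℝ)) (tor w) ≤
        h i (tor w) - (2 * μ i) * h i (tor w) + (μ i) ^ 2 := by
      intro w
      have := h01 i (tor w)
      simp only [φ, ContinuousMap.sub_apply, ContinuousMap.const_apply, ContinuousMap.mul_apply]
      nlinarith
    have i1 := integrable_torR' (cubeAvg (Fin d) 0 1) (h i)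
    have i2 : Integrable (fun w => h i (tor w) - (2 * μ i) * h i (tor w)) (cubeAvg (Fin d) 0 1) :=
      i1.sub (i1.const_mul _)
    calc torMeanR (φ i * φ i : C(UnitAddTorus (Fin d), ℝ)) ≤ ∫ w, (h i (tor w) - (2 * μ i) * h i (tor w) + (μ i) ^ 2) ∂(cubeAvg (Fin d) 0 1) :=
          integral_mono (integrable_torR' _ _) ((i1.sub (i1.const_mul _)).add (integrable_const _)) e
      _ = μ i - (2 * μ i) * μ i + (μ i)^2 := by
          rw [integral_add i2 (integrable_const _), integral_sub i1 (i1.const_mul _),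
            integral_const_mul]
          simp [hμ, torMeanR]
      _ ≤ μ i := by nlinarith [sq_nonneg (μ i)]
  let Φ : Fin N → Fin N → (Fin d → ℝ) → ℝ := fun i j ξ =>
    φ i (tor ((A i).transpose.mulVec ξ)) * φ j (tor ((A j).transpose.mulVec ξ))
  have hlim : ∀ i j, Tendsto (fun T : ℝ => ∫ ξ, Φ i j ξ ∂(cubeAvg (Fin d) (-T) T)) atTop
      (𝓝 (if i = j then torMeanR (φ i * φ i : C(UnitAddTorus (Fin d), ℝ)) else 0)) := by
    intro i j
    split_ifs with hij
    · subst hij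
      refine weylR (A i).transpose (fun m hm h0 => hm (h1 i m ?_)) (φ i * φ i)
      simpa using h0
    · have := weylR (Matrix.fromRows (A i).transpose (A j).transpose) (fun m hm h0 => ?_)
        (⟨fun τ => φ i (fun k => τ (Sum.inl k)) * φ j (fun k => τ (Sum.inr k)), by fun_prop⟩ : C(UnitAddTorus (Fin d ⊕ Fin d), ℝ))
      · simp only [ContinuousMap.coe_mk] at this
        rw [torMeanR_mul, hφ0, zero_mul] at this
        exact this
      · rw [Matrix.transpose_fromRows, Matrix.transpose_transpose, Matrix.transpose_transpose] at h0
        have e : (fun i => ((m i : ℤ) : ℝ)) = Sum.elim (fun k => ((m (Sum.inl k) : ℤ) : ℝ)) (fun k => ((m (Sum.inr k) : ℤ) : ℝ)) := by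
          ext (k | k) <;> rfl
        rw [e, Matrix.fromCols_mulVec_sumElim] at h0
        have := h2 i j hij (fun k => m (Sum.inl k)) (fun k => m (Sum.inr k)) h0
        apply hm
        ext (k | k)
        · exact congrFun this.1 k
        · exact congrFun this.2 k
  have hintg : ∀ i j T, Integrable (Φ i j) (cubeAvg (Fin d) (-T) T) := by
    intro i j T
    exact (integrable_torR _ _ (φ i)).mul_bdd (c := ‖φ j‖) ((φ j).continuous.comp (continuous_tor.comp (by fun_prop))).aestronglyMeasurable (Eventually.of_forall fun x => (φ j).norm_coe_le_norm _)
  have hS : Tendsto (fun T : ℝ => ∫ ξ, (∑ i, φ i (tor ((A i).transpose.mulVec ξ))) ^ 2 ∂(cubeAvg (Fin d) (-T) T)) atTop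
      (𝓝 (∑ i, torMeanR (φ i * φ i : C(UnitAddTorus (Fin d), ℝ)))) := by
    have := tendsto_finsetSum Finset.univ fun i _ => tendsto_finsetSum Finset.univ fun j _ => hlim i j
    simp only [Finset.sum_ite_eq, Finset.mem_univ, if_true] at this
    refine this.congr fun T => ?_
    have e : ∀ ξ, (∑ i, φ i (tor ((A i).transpose.mulVec ξ))) ^ 2 = ∑ i, ∑ j, Φ i j ξ := by
      intro ξ
      rw [sq, Finset.sum_mul_sum]
    simp only [e]
    rw [integral_finsetSum _ fun i _ => integrable_finsetSum _ fun j _ => hintg i j T]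
    refine Finset.sum_congr rfl fun i _ => ?_
    rw [integral_finsetSum _ fun j _ => hintg i j T]
  have hlt : ∑ i, torMeanR (φ i * φ i : C(UnitAddTorus (Fin d), ℝ)) < 2 * M := by
    calc _ ≤ M := Finset.sum_le_sum fun i _ => hφ2 i
      _ < _ := by linarith
  filter_upwards [hS.eventually_lt_const hlt] with T hT
  have hc : Continuous fun ξ : Fin d → ℝ => (∑ i, φ i (tor ((A i).transpose.mulVec ξ))) ^ 2 := by
    refine (continuous_finsetSum _ fun i _ => ?_).pow 2
    exact (φ i).continuous.comp (continuous_tor.comp (by fun_prop))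
  have hi : Integrable (fun ξ : Fin d → ℝ => (∑ i, φ i (tor ((A i).transpose.mulVec ξ))) ^ 2) (cubeAvg (Fin d) (-T) T) := by
    have e : (fun ξ : Fin d → ℝ => (∑ i, φ i (tor ((A i).transpose.mulVec ξ))) ^ 2) = fun ξ => ∑ i, ∑ j, Φ i j ξ := by
      ext ξ
      rw [sq, Finset.sum_mul_sum]
    rw [e]
    exact integrable_finsetSum _ fun i _ => integrable_finsetSum _ fun j _ => hintg i j T
  have hmk := mul_meas_ge_le_integral_of_nonneg (μ := cubeAvg (Fin d) (-T) T)
    (f := fun ξ : Fin d → ℝ => (∑ i, φ i (tor ((A i).transpose.mulVec ξ))) ^ 2)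
    (Eventually.of_forall fun x => sq_nonneg _) hi (M ^ 2)
  have hsub : {ξ : Fin d → ℝ | ∀ i, h i (tor ((A i).transpose.mulVec ξ)) = 0} ⊆
      {ξ | M ^ 2 ≤ (∑ i, φ i (tor ((A i).transpose.mulVec ξ))) ^ 2} := by
    intro ξ hξ
    simp only [Set.mem_ofPred_eq] at hξ ⊢
    have : ∑ i, φ i (tor ((A i).transpose.mulVec ξ)) = - M := by
      simp only [φ, ContinuousMap.sub_apply, ContinuousMap.const_apply, hξ]
      simp [hM]
    rw [this]; simp
  have h3 := measureReal_mono (μ := cubeAvg (Fin d) (-T) T) hsub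
  rw [le_div_iff₀ hpos]
  have h4 : M ^ 2 * (cubeAvg (Fin d) (-T) T).real {ξ : Fin d → ℝ | ∀ i, h i (tor ((A i).transpose.mulVec ξ)) = 0} ≤ 2 * M := by
    calc _ ≤ M ^ 2 * (cubeAvg (Fin d) (-T) T).real {ξ | M ^ 2 ≤ (∑ i, φ i (tor ((A i).transpose.mulVec ξ))) ^ 2} := by gcongr
      _ ≤ _ := hmk
      _ ≤ _ := hT.le
  nlinarith
end

section
open Filter Topology
lemma prod_absdiff (n i : ℕ) (hi : i ≤ n) :
    ∏ k ∈ (Finset.range (n+1)).erase i, |(i:ℝ) - k| = (i.factorial : ℝ) * ((n - i).factorial : ℝ) := by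
  have h : (Finset.range (n+1)).erase i = Finset.range i ∪ (Finset.range (n-i)).image (fun k => i + 1 + k) := by
    ext k
    simp only [Finset.mem_erase, Finset.mem_range, Finset.mem_union, Finset.mem_image]
    constructor
    · rintro ⟨h1, h2⟩
      rcases lt_or_gt_of_ne h1 with h | h
      · exact Or.inl h
      · exact Or.inr ⟨k - i - 1, by omega, by omega⟩
    · rintro (h | ⟨a, h1, h2⟩) <;> omega
  rw [h, Finset.prod_union, Finset.prod_image (by intro a _ b _; simp)]
  · congr 1
    · rw [← Finset.prod_range_reflect, ← Finset.prod_range_add_one_eq_factorial]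
      push_cast
      refine Finset.prod_congr rfl fun k hk => ?_
      have := Finset.mem_range.1 hk
      rw [show i - 1 - k = i - (1 + k) by omega, Nat.cast_sub (by omega)]
      push_cast
      rw [show (i:ℝ) - (i - (1 + k)) = k + 1 by ring, abs_of_nonneg (by positivity)]
    · rw [← Finset.prod_range_add_one_eq_factorial]
      push_cast
      refine Finset.prod_congr rfl fun k hk => ?_
      rw [show (i:ℝ) - (i + 1 + k) = - (k + 1) by ring, abs_neg, abs_of_nonneg (by positivity)]
  · rw [Finset.disjoint_left]
    simp only [Finset.mem_range, Finset.mem_image, not_exists]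
    rintro a ha x ⟨_, h⟩
    omega

lemma prod_sub_lower (q : ℕ) (s : Finset ℕ) (hs : s ⊆ Finset.range (2*q+1)) (hc : s.card = q + 1)
    (i : ℕ) (hi : i ∈ s) :
    ((2*q : ℕ) : ℝ)^q ≤ 32 ^ q * ∏ k ∈ s.erase i, |(i:ℝ) - k| := by
  have hi2 : i ≤ 2*q := by have := Finset.mem_range.1 (hs hi); omega
  have h1 := prod_absdiff (2*q) i hi2
  have hsub : s.erase i ⊆ (Finset.range (2*q+1)).erase i := Finset.erase_subset_erase _ hs
  rw [← Finset.prod_sdiff hsub] at h1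
  have hcard : ((Finset.range (2*q+1)).erase i \ s.erase i).card = q := by
    rw [Finset.card_sdiff_of_subset hsub, Finset.card_erase_of_mem (hs hi), Finset.card_erase_of_mem hi, hc]
    simp; omega
  have h2 : ∏ k ∈ (Finset.range (2*q+1)).erase i \ s.erase i, |(i:ℝ) - k| ≤ ((2*q:ℕ):ℝ)^q := by
    calc _ ≤ ∏ k ∈ (Finset.range (2*q+1)).erase i \ s.erase i, ((2*q:ℕ):ℝ) := by
          refine Finset.prod_le_prod (fun _ _ => abs_nonneg _) fun k hk => ?_
          have hk1 : k < 2*q+1 := by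
            have := (Finset.mem_sdiff.1 hk).1
            exact Finset.mem_range.1 (Finset.mem_of_mem_erase this)
          rw [abs_le]
          have a1 : (k:ℝ) ≤ (2*q:ℕ) := by exact_mod_cast (by omega : k ≤ 2*q)
          have a2 : (i:ℝ) ≤ (2*q:ℕ) := by exact_mod_cast hi2
          have a3 : (0:ℝ) ≤ k := by positivity
          have a4 : (0:ℝ) ≤ i := by positivity
          constructor <;> linarith
      _ = _ := by rw [Finset.prod_const, hcard]
  set P := ∏ k ∈ s.erase i, |(i:ℝ) - k| with hP
  have hP0 : 0 ≤ P := Finset.prod_nonneg fun _ _ => abs_nonneg _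
  have h3 : ((2*q).factorial : ℝ) ≤ 4^q * ((i.factorial : ℝ) * ((2*q - i).factorial : ℝ)) := by
    have := Nat.choose_mul_factorial_mul_factorial hi2
    have h4 : (2*q).choose i ≤ 4^q := by
      have := Nat.choose_le_two_pow (2*q) i
      rwa [pow_mul] at this
    rw [← this]
    push_cast
    rw [mul_assoc]
    gcongr
    exact_mod_cast h4
  have h5 : ((2*q:ℕ):ℝ)^(2*q) ≤ (2*q).factorial * 8 ^ q := by
    have := Real.pow_div_factorial_le_exp ((2*q:ℕ):ℝ) (by positivity) (2*q)
    rw [div_le_iff₀ (by positivity)] at this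
    have e : Real.exp ((2*q:ℕ):ℝ) ≤ 8 ^ q := by
      have e1 : Real.exp ((2*q:ℕ):ℝ) = (Real.exp 1 ^ 2) ^ q := by
        rw [← pow_mul, ← Real.exp_nat_mul, mul_one]
      rw [e1]
      refine pow_le_pow_left₀ (by positivity) ?_ q
      nlinarith [Real.exp_one_lt_d9, Real.exp_pos 1]
    calc _ ≤ _ := this
      _ ≤ _ := by rw [mul_comm]; gcongr
  rcases Nat.eq_zero_or_pos q with h0 | hq
  · subst h0
    simp only [pow_zero, one_mul]
    have : s = {i} := by
      obtain ⟨a, ha⟩ := Finset.card_eq_one.1 hc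
      rw [ha] at hi ⊢; rw [Finset.mem_singleton.1 hi]
    simp [hP, this]
  have hpos : (0:ℝ) < ((2*q:ℕ):ℝ)^q := by positivity
  have h6 : ((2*q:ℕ):ℝ)^q * ((2*q:ℕ):ℝ)^q ≤ ((2*q:ℕ):ℝ)^q * (32 ^ q * P) := by
    calc _ = ((2*q:ℕ):ℝ)^(2*q) := by rw [← pow_add]; congr 1; ring
      _ ≤ _ := h5
      _ ≤ (4^q * ((i.factorial : ℝ) * ((2*q - i).factorial : ℝ))) * 8^q := by gcongr
      _ ≤ (4^q * (((2*q:ℕ):ℝ)^q * P)) * 8^q := by rw [← h1]; gcongr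
      _ = _ := by rw [show (32:ℝ) = 4 * 8 by norm_num, mul_pow]; ring
  exact le_of_mul_le_mul_left h6 hpos

/-- among the `2 q + 1` equispaced nodes of `[0,1]`, at most `q` are bad for `p`. -/
lemma lagrange_bad (q : ℕ) (hq : 0 < q) (p : Polynomial ℂ) (hp : p.natDegree ≤ q) (t : ℝ) (ht : t ∈ Set.Icc (0:ℝ) 1)
    (s : Finset ℕ) (hs : s ⊆ Finset.range (2*q+1))
    (hb : ∀ j ∈ s, 64^q * ‖p.eval (((j:ℝ)/((2*q:ℕ):ℝ) : ℝ) : ℂ)‖ < ‖p.eval (t : ℂ)‖) : s.card ≤ q := by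
  by_contra! hlt
  obtain ⟨s', hs', hc⟩ := Finset.exists_subset_card_eq (show q + 1 ≤ s.card from hlt)
  set v : ℕ → ℂ := fun j => (((j:ℝ)/((2*q:ℕ):ℝ) : ℝ) : ℂ) with hv
  have hn : (0:ℝ) < ((2*q:ℕ):ℝ) := by positivity
  have hinj : Set.InjOn v s' := by
    intro a _ b _ h
    simp only [hv, Complex.ofReal_inj] at h
    rw [div_left_inj' hn.ne'] at h
    exact_mod_cast h
  have hdeg : p.degree < s'.card := by
    rw [hc]
    exact lt_of_le_of_lt Polynomial.degree_le_natDegree (by exact_mod_cast (by omega : p.natDegree < q + 1))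
  have h1 := Lagrange.eq_interpolate_of_eval_eq (s := s') (v := v) (r := fun j => p.eval (v j)) (f := p) hinj hdeg (fun _ _ => rfl)
  have h2 : ‖p.eval (t:ℂ)‖ ≤ ∑ j ∈ s', ‖p.eval (v j)‖ * 32^q := by
    conv_lhs => rw [h1]
    rw [Lagrange.interpolate_apply, Polynomial.eval_finsetSum]
    refine (norm_sum_le _ _).trans (Finset.sum_le_sum fun j hj => ?_)
    rw [Polynomial.eval_mul, Polynomial.eval_C, norm_mul]
    gcongr
    rw [Lagrange.basis, Polynomial.eval_prod, norm_prod]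
    have h3 := prod_sub_lower q s' (hs'.trans hs) hc j hj
    have hpp : 0 < ∏ k ∈ s'.erase j, |(j:ℝ) - k| := by
      refine Finset.prod_pos fun k hk => abs_pos.2 ?_
      rw [sub_ne_zero]
      exact_mod_cast (Finset.ne_of_mem_erase hk).symm
    calc _ ≤ ∏ k ∈ s'.erase j, (((2*q:ℕ):ℝ) / |(j:ℝ) - k|) := by
          refine Finset.prod_le_prod (fun _ _ => norm_nonneg _) fun k hk => ?_
          have hk1 : k ≤ 2*q := by
            have := Finset.mem_range.1 (hs (hs' (Finset.mem_of_mem_erase hk))); omega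
          have hkr : (k:ℝ) ≤ ((2*q:ℕ):ℝ) := by exact_mod_cast hk1
          have hjk : (0:ℝ) < |(j:ℝ) - k| := by
            refine abs_pos.2 ?_
            rw [sub_ne_zero]
            exact_mod_cast (Finset.ne_of_mem_erase hk).symm
          rw [Lagrange.basisDivisor]
          simp only [Polynomial.eval_mul, Polynomial.eval_C, Polynomial.eval_sub, Polynomial.eval_X, hv]
          rw [← Complex.ofReal_sub, ← Complex.ofReal_sub, ← Complex.ofReal_inv, ← Complex.ofReal_mul, Complex.norm_real,
            Real.norm_eq_abs, abs_mul, ← sub_div, inv_div, abs_div, abs_of_pos hn]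
          refine mul_le_of_le_one_right (by positivity) ?_
          have b1 : 0 ≤ (k:ℝ)/((2*q:ℕ):ℝ) := by positivity
          have b2 : (k:ℝ)/((2*q:ℕ):ℝ) ≤ 1 := by rw [div_le_one hn]; exact hkr
          rw [abs_le]; constructor <;> linarith [ht.1, ht.2]
      _ = ((2*q:ℕ):ℝ)^q / ∏ k ∈ s'.erase j, |(j:ℝ) - k| := by
          rw [Finset.prod_div_distrib, Finset.prod_const, Finset.card_erase_of_mem hj, hc]; rfl
      _ ≤ 32^q := by rw [div_le_iff₀ hpp]; exact h3
  have hne : s'.Nonempty := Finset.card_pos.1 (by omega)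
  have h4 : ∑ j ∈ s', 64^q * ‖p.eval (v j)‖ < ∑ j ∈ s', ‖p.eval (t:ℂ)‖ :=
    Finset.sum_lt_sum_of_nonempty hne fun j hj => hb j (hs' hj)
  rw [Finset.sum_const, hc, ← Finset.mul_sum] at h4
  rw [← Finset.sum_mul] at h2
  have h5 : ((q:ℝ)+1) ≤ 2^q := by
    have : q < 2^q := Nat.lt_two_pow_self
    exact_mod_cast this
  have h6 : (q+1) • ‖p.eval (t:ℂ)‖ ≤ 64^q * ∑ j ∈ s', ‖p.eval (v j)‖ := by
    rw [nsmul_eq_mul]; push_cast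
    calc _ ≤ 2^q * ((∑ j ∈ s', ‖p.eval (v j)‖) * 32^q) := by gcongr
      _ = _ := by rw [show (64:ℝ) = 2 * 32 by norm_num, mul_pow]; ring
  linarith

/-- two polynomials: a common good point in `[0,1]`. -/
lemma common_good (q : ℕ) (hq : 0 < q) (p₁ p₂ : Polynomial ℂ) (h₁ : p₁.natDegree ≤ q) (h₂ : p₂.natDegree ≤ q) :
    ∃ t ∈ Set.Icc (0:ℝ) 1, ‖p₁.eval 0‖ ≤ 64^q * ‖p₁.eval (t:ℂ)‖ ∧ ‖p₂.eval 1‖ ≤ 64^q * ‖p₂.eval (t:ℂ)‖ := by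
  classical
  by_contra! hcon
  set S := Finset.range (2*q+1)
  set v : ℕ → ℝ := fun j => (j:ℝ)/((2*q:ℕ):ℝ) with hv
  have a := lagrange_bad q hq p₁ h₁ 0 (by simp) (S.filter fun j => 64^q * ‖p₁.eval (v j : ℂ)‖ < ‖p₁.eval ((0:ℝ):ℂ)‖)
    (Finset.filter_subset _ _) (fun j hj => (Finset.mem_filter.1 hj).2)
  have b := lagrange_bad q hq p₂ h₂ 1 (by simp) (S.filter fun j => 64^q * ‖p₂.eval (v j : ℂ)‖ < ‖p₂.eval ((1:ℝ):ℂ)‖)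
    (Finset.filter_subset _ _) (fun j hj => (Finset.mem_filter.1 hj).2)
  have hun : S ⊆ (S.filter fun j => 64^q * ‖p₁.eval (v j : ℂ)‖ < ‖p₁.eval ((0:ℝ):ℂ)‖) ∪
      (S.filter fun j => 64^q * ‖p₂.eval (v j : ℂ)‖ < ‖p₂.eval ((1:ℝ):ℂ)‖) := by
    intro j hj
    rw [Finset.mem_union, Finset.mem_filter, Finset.mem_filter]
    by_cases h : 64^q * ‖p₁.eval (v j : ℂ)‖ < ‖p₁.eval ((0:ℝ):ℂ)‖
    · exact Or.inl ⟨hj, h⟩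
    · refine Or.inr ⟨hj, ?_⟩
      have hj' := Finset.mem_range.1 hj
      have hn : (0:ℝ) < ((2*q:ℕ):ℝ) := by positivity
      have := hcon (v j) ⟨by positivity, by
        rw [hv]; simp only; rw [div_le_one hn]; exact_mod_cast (by omega : j ≤ 2*q)⟩ (by simpa using h)
      simpa using this
  have := (Finset.card_le_card hun).trans (Finset.card_union_le _ _)
  have hS : S.card = 2 * q + 1 := Finset.card_range _
  omega
end

section
open Filter Topology
lemma cos_poly_bound (m : ℕ) (p : Polynomial ℂ) (hp : p.natDegree ≤ m) (M : ℝ)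
    (hM : ∀ x : ℝ, x ∈ Set.Icc (-1:ℝ) 1 → ‖p.eval (x:ℂ)‖ ≤ M) (ζ : ℂ) :
    ‖p.eval (Complex.cos ζ)‖ ≤ Real.exp (m * |ζ.im|) * M := by
  wlog h : 0 ≤ ζ.im generalizing ζ with H
  · have := H (-ζ) (by simp; linarith)
    simpa using this
  have hM0 : 0 ≤ M := (norm_nonneg _).trans (hM 0 (by simp))
  set q : ℂ → ℂ := fun z => ∑ k ∈ Finset.range (m+1), p.coeff k * (z^(m-k) * ((z^2+1)/2)^k) with hq
  have hqz : ∀ z : ℂ, z ≠ 0 → q z = z^m * p.eval ((z + z⁻¹)/2) := by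
    intro z hz
    rw [Polynomial.eval_eq_sum_range' (Nat.lt_succ_of_le hp), hq, Finset.mul_sum]
    refine Finset.sum_congr rfl fun k hk => ?_
    have hk' : k ≤ m := by have := Finset.mem_range.1 hk; omega
    have e : (z^2+1)/2 = z * ((z + z⁻¹)/2) := by field_simp
    rw [e, mul_pow]
    have : z^m = z^(m-k) * z^k := by rw [← pow_add]; congr 1; omega
    rw [this]; ring
  have hqd : Differentiable ℂ q := by
    intro z; simp only [hq]; fun_prop
  have hcirc : ∀ z : ℂ, ‖z‖ = 1 → ‖q z‖ ≤ M := by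
    intro z hz
    have hz0 : z ≠ 0 := by rintro rfl; simp at hz
    rw [hqz z hz0, norm_mul, norm_pow, hz, one_pow, one_mul]
    have : (z + z⁻¹)/2 = ((z.re : ℝ) : ℂ) := by
      rw [Complex.inv_eq_conj hz, Complex.add_conj]; push_cast; ring
    rw [this]
    apply hM
    have := Complex.abs_re_le_norm z
    rw [hz, abs_le] at this
    exact this
  have hdisk : ∀ z : ℂ, ‖z‖ ≤ 1 → ‖q z‖ ≤ M := by
    intro z hz
    refine Complex.norm_le_of_forall_mem_frontier_norm_le (U := Metric.ball 0 1) Metric.isBounded_ball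
      hqd.diffContOnCl ?_ ?_
    · intro w hw
      rw [frontier_ball _ one_ne_zero] at hw
      exact hcirc w (by simpa using hw)
    · rw [closure_ball _ one_ne_zero]; simpa using hz
  set z := Complex.exp (Complex.I * ζ) with hz
  have hzn : ‖z‖ = Real.exp (-ζ.im) := by
    rw [hz, Complex.norm_exp]; simp
  have hz0 : z ≠ 0 := Complex.exp_ne_zero _
  have hc : Complex.cos ζ = (z + z⁻¹)/2 := by
    rw [Complex.cos, hz, ← Complex.exp_neg]
    congr 3 <;> ring
  have h1 := hqz z hz0
  rw [← hc] at h1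
  have h2 := hdisk z (by rw [hzn]; simpa using h)
  rw [h1, norm_mul, norm_pow, hzn] at h2
  rw [abs_of_nonneg h]
  have h3 : Real.exp (m * ζ.im) * Real.exp (-ζ.im)^m = 1 := by
    rw [← Real.exp_nat_mul, ← Real.exp_add]; simp
  calc ‖p.eval (Complex.cos ζ)‖ = Real.exp (m * ζ.im) * (Real.exp (-ζ.im)^m * ‖p.eval (Complex.cos ζ)‖) := by
        rw [← mul_assoc, h3, one_mul]
    _ ≤ _ := by gcongr

lemma bernstein_cos (m : ℕ) (hm : 0 < m) (p : Polynomial ℂ) (hp : p.natDegree ≤ m) (M : ℝ)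
    (hM : ∀ x : ℝ, x ∈ Set.Icc (-1:ℝ) 1 → ‖p.eval (x:ℂ)‖ ≤ M) (θ θ' : ℝ) :
    ‖p.eval ((Real.cos θ : ℝ):ℂ) - p.eval ((Real.cos θ' : ℝ) : ℂ)‖ ≤ Real.exp 1 * m * M * |θ - θ'| := by
  have hM0 : 0 ≤ M := (norm_nonneg _).trans (hM 0 (by simp))
  set G : ℂ → ℂ := fun ζ => p.eval (Complex.cos ζ) with hG
  have hGd : Differentiable ℂ G := by
    intro z; exact (p.differentiable _).comp z Complex.differentiableAt_cos
  have hder : ∀ θ : ℝ, ‖deriv G θ‖ ≤ Real.exp 1 * m * M := by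
    intro θ
    have := Complex.norm_deriv_le_of_forall_mem_sphere_norm_le (c := (θ:ℂ)) (R := (m:ℝ)⁻¹) (C := Real.exp 1 * M) (f := G)
      (by positivity) hGd.diffContOnCl (by
        intro z hz
        refine (cos_poly_bound m p hp M hM z).trans ?_
        gcongr
        have h1 : |z.im| ≤ (m:ℝ)⁻¹ := by
          have := Complex.abs_im_le_norm (z - θ)
          simp only [Complex.sub_im, Complex.ofReal_im, sub_zero] at this
          rwa [mem_sphere_iff_norm.1 hz] at this
        calc (m:ℝ) * |z.im| ≤ m * (m:ℝ)⁻¹ := by gcongr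
          _ = 1 := mul_inv_cancel₀ (by positivity))
    refine this.trans (le_of_eq ?_)
    field_simp
  have := Convex.norm_image_sub_le_of_norm_hasDerivWithin_le (f := fun θ : ℝ => G θ) (f' := fun θ : ℝ => deriv G θ)
    (s := Set.univ) (C := Real.exp 1 * m * M) (x := θ') (y := θ)
    (fun x _ => ((hGd x).hasDerivAt.comp_ofReal).hasDerivWithinAt) (fun x _ => hder x) convex_univ trivial trivial
  simpa [hG] using this
end

section
open Filter Topology
/-- restriction to every line is a polynomial of degree at most `m` -/
def LinePoly {d : ℕ} (m : ℕ) (Q : (Fin d → ℝ) → ℂ) : Prop :=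
  ∀ x v : Fin d → ℝ, ∃ p : Polynomial ℂ, p.natDegree ≤ m ∧ ∀ t : ℝ, Q (x + t • v) = p.eval (t:ℂ)

lemma LinePoly.mul {d a b : ℕ} {P Q : (Fin d → ℝ) → ℂ} (hP : LinePoly a P) (hQ : LinePoly b Q) :
    LinePoly (a + b) (fun x => P x * Q x) := by
  intro x v
  obtain ⟨p, h1, h2⟩ := hP x v
  obtain ⟨q, h3, h4⟩ := hQ x v
  refine ⟨p * q, Polynomial.natDegree_mul_le.trans (by omega), fun t => ?_⟩
  rw [Polynomial.eval_mul, ← h2, ← h4]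

lemma LinePoly.sum {d a : ℕ} {ι : Type*} (s : Finset ι) {P : ι → (Fin d → ℝ) → ℂ} (hP : ∀ i ∈ s, LinePoly a (P i)) :
    LinePoly a (fun x => ∑ i ∈ s, P i x) := by
  classical
  intro x v
  have hP' : ∀ i, ∃ p : Polynomial ℂ, i ∈ s → p.natDegree ≤ a ∧ ∀ t : ℝ, P i (x + t • v) = p.eval (t:ℂ) := by
    intro i
    by_cases h : i ∈ s
    · obtain ⟨p, hp⟩ := hP i h x v
      exact ⟨p, fun _ => hp⟩
    · exact ⟨0, fun h' => absurd h' h⟩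
  choose p hp using hP'
  refine ⟨∑ i ∈ s, p i, Polynomial.natDegree_sum_le_of_forall_le _ _ fun i hi => (hp i hi).1, fun t => ?_⟩
  rw [Polynomial.eval_finsetSum]
  exact Finset.sum_congr rfl fun i hi => (hp i hi).2 t

lemma LinePoly.mono {d a b : ℕ} {P : (Fin d → ℝ) → ℂ} (hP : LinePoly a P) (h : a ≤ b) : LinePoly b P := by
  intro x v
  obtain ⟨p, h1, h2⟩ := hP x v
  exact ⟨p, h1.trans h, h2⟩

def cosv {d : ℕ} (θ : Fin d → ℝ) : Fin d → ℝ := fun k => Real.cos (θ k)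

lemma cosv_mem {d : ℕ} (θ : Fin d → ℝ) : cosv θ ∈ Set.Icc (-1 : Fin d → ℝ) 1 :=
  ⟨fun _ => Real.neg_one_le_cos _, fun _ => Real.cos_le_one _⟩

lemma linePoly_one {d q : ℕ} (hq : 0 < q) {Q : (Fin d → ℝ) → ℂ} (hQ : LinePoly q Q) (M : ℝ)
    (hM : ∀ y ∈ Set.Icc (-1 : Fin d → ℝ) 1, ‖Q y‖ ≤ M) (θ : Fin d → ℝ) (k : Fin d) (s : ℝ) :
    ‖Q (cosv (Function.update θ k s)) - Q (cosv θ)‖ ≤ Real.exp 1 * q * M * |s - θ k| := by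
  obtain ⟨p, h1, h2⟩ := hQ (Function.update (cosv θ) k 0) (Pi.single k 1)
  have h3 : ∀ t : ℝ, Function.update (cosv θ) k 0 + t • Pi.single k (1:ℝ) = Function.update (cosv θ) k t := by
    intro t; ext j
    rcases eq_or_ne j k with rfl | h
    · simp
    · simp [h]
  simp only [h3] at h2
  have h4 := bernstein_cos q hq p h1 M (by
    intro x hx
    rw [← h2]
    apply hM
    have := cosv_mem θ
    constructor
    · intro j
      rcases eq_or_ne j k with rfl | h
      · simpa using hx.1
      · simpa [h] using this.1 j
    · intro j
      rcases eq_or_ne j k with rfl | h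
      · simpa using hx.2
      · simpa [h] using this.2 j) s (θ k)
  rw [← h2, ← h2] at h4
  have e1 : Function.update (cosv θ) k (Real.cos s) = cosv (Function.update θ k s) := by
    ext j
    rcases eq_or_ne j k with rfl | h
    · simp [cosv]
    · simp [h, cosv]
  have e2 : Function.update (cosv θ) k (Real.cos (θ k)) = cosv θ := by
    exact Function.update_eq_self k (cosv θ)
  rwa [e1, e2] at h4

lemma linePoly_bern {d q : ℕ} (hq : 0 < q) {Q : (Fin d → ℝ) → ℂ} (hQ : LinePoly q Q) (M : ℝ)
    (hM : ∀ y ∈ Set.Icc (-1 : Fin d → ℝ) 1, ‖Q y‖ ≤ M) (θ θ' : Fin d → ℝ) (η : ℝ)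
    (hη : ∀ k, |θ' k - θ k| ≤ η) :
    ‖Q (cosv θ') - Q (cosv θ)‖ ≤ d * (Real.exp 1 * q * M * η) := by
  classical
  have hM0 : 0 ≤ M := (norm_nonneg _).trans (hM _ (cosv_mem θ))
  have key : ∀ s : Finset (Fin d), ‖Q (cosv (s.piecewise θ' θ)) - Q (cosv θ)‖ ≤ s.card * (Real.exp 1 * q * M * η) := by
    intro s
    induction s using Finset.induction_on with
    | empty => simp
    | insert a s ha ih =>
      rw [Finset.piecewise_insert, Finset.card_insert_of_notMem ha]
      have h1 := linePoly_one hq hQ M hM (s.piecewise θ' θ) a (θ' a)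
      have h2 : s.piecewise θ' θ a = θ a := Finset.piecewise_eq_of_notMem _ _ _ ha
      rw [h2] at h1
      have h3 : Real.exp 1 * q * M * |θ' a - θ a| ≤ Real.exp 1 * q * M * η := by
        gcongr; exact hη a
      calc _ ≤ _ := norm_sub_le_norm_sub_add_norm_sub _ (Q (cosv (s.piecewise θ' θ))) _
        _ ≤ Real.exp 1 * q * M * η + s.card * (Real.exp 1 * q * M * η) := add_le_add (h1.trans h3) ih
        _ = _ := by push_cast; ring
  have := key Finset.univ
  simpa using this

def thetaNode (n : ℕ) (j : ℕ) : ℝ := (j + 1/2) * Real.pi / n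

lemma thetaNode_cover (n : ℕ) (hn : 0 < n) (θ : ℝ) (h0 : 0 ≤ θ) (h1 : θ ≤ Real.pi) :
    ∃ j : Fin n, |θ - thetaNode n j| ≤ Real.pi / (2 * n) := by
  have hpi := Real.pi_pos
  have hn' : (0:ℝ) < n := by positivity
  set u := θ * n / Real.pi with hu
  have hθ : θ = u * Real.pi / n := by rw [hu]; field_simp
  have hu0 : 0 ≤ u := by positivity
  have hu1 : u ≤ n := by rw [hu, div_le_iff₀ hpi, mul_comm]; gcongr
  have key : ∀ j : ℕ, |u - (j + 1/2)| ≤ 1/2 → |θ - thetaNode n j| ≤ Real.pi / (2 * n) := by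
    intro j hj
    rw [hθ, thetaNode, ← sub_div, ← sub_mul, abs_div, abs_mul, abs_of_pos hpi, abs_of_pos hn']
    rw [div_le_div_iff₀ hn' (by positivity)]
    nlinarith [mul_pos hpi hn']
  rcases hu1.lt_or_eq with h | h
  · have hf : ⌊u⌋₊ < n := (Nat.floor_lt hu0).2 h
    refine ⟨⟨⌊u⌋₊, hf⟩, key _ ?_⟩
    have a := Nat.floor_le hu0
    have b := Nat.lt_floor_add_one u
    rw [abs_le]; constructor <;> linarith
  · refine ⟨⟨n - 1, by omega⟩, key _ ?_⟩
    simp only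
    rw [Nat.cast_sub (by omega), h]
    rw [abs_le]; push_cast; constructor <;> linarith

lemma cell_core {d m n : ℕ} (hd : 1 ≤ d) (hm : 1 ≤ m) (hn : 40 * d^2 * m ≤ n) (P R : (Fin d → ℝ) → ℂ)
    (hP : LinePoly m P) (hR : LinePoly (d * m) R) (hPc : Continuous P) (hRc : Continuous R)
    (hR0 : ∃ y ∈ Set.Icc (-1 : Fin d → ℝ) 1, R y ≠ 0) (δ : ℝ) (hδ : 0 ≤ δ)
    (hcell : ∀ J : Fin d → Fin n, R (cosv fun k => thetaNode n (J k)) = 0 ∨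
      ∃ z : Fin d → ℝ, (∀ k, |z k - thetaNode n (J k)| ≤ Real.pi / (2 * n)) ∧ ‖P (cosv z)‖ ≤ δ) :
    ‖P 0‖ ≤ 4096 ^ (d * m) * (2 * δ) := by
  have hn0 : 0 < n := lt_of_lt_of_le (by positivity) hn
  have hdm : 0 < d * m := by positivity
  have hK : IsCompact (Set.Icc (-1 : Fin d → ℝ) 1) := isCompact_Icc
  have hne : (Set.Icc (-1 : Fin d → ℝ) 1).Nonempty := ⟨0, by simp⟩
  obtain ⟨yR, hyR, hmaxR⟩ := hK.exists_isMaxOn hne hRc.norm.continuousOn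
  obtain ⟨yQ, hyQ, hmaxQ⟩ := hK.exists_isMaxOn hne (hPc.mul hRc).norm.continuousOn
  set Q : (Fin d → ℝ) → ℂ := fun y => P y * R y with hQ
  have hmaxR' : ∀ y ∈ Set.Icc (-1 : Fin d → ℝ) 1, ‖R y‖ ≤ ‖R yR‖ := fun y hy => hmaxR hy
  have hmaxQ' : ∀ y ∈ Set.Icc (-1 : Fin d → ℝ) 1, ‖Q y‖ ≤ ‖Q yQ‖ := fun y hy => hmaxQ hy
  have hRpos : 0 < ‖R yR‖ := by
    obtain ⟨y, hy, h⟩ := hR0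
    exact (norm_pos_iff.2 h).trans_le (hmaxR' y hy)
  have hQl : LinePoly (2 * (d * m)) Q := (hP.mul hR).mono (by nlinarith)
  -- upper bound
  have hup : ‖Q yQ‖ ≤ 2 * δ * ‖R yR‖ := by
    set θ : Fin d → ℝ := fun k => Real.arccos (yQ k) with hθ
    have hyθ : cosv θ = yQ := by
      ext k; exact Real.cos_arccos (hyQ.1 k) (hyQ.2 k)
    choose J hJ using fun k => thetaNode_cover n hn0 (θ k) (Real.arccos_nonneg _) (Real.arccos_le_pi _)
    have hsmall : (d:ℝ) * (Real.exp 1 * (2 * (d * m) : ℕ) * ‖Q yQ‖ * (Real.pi / n)) ≤ 1/2 * ‖Q yQ‖ := by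
      have hn' : (0:ℝ) < n := by positivity
      have hnr : (40:ℝ) * d^2 * m ≤ n := by exact_mod_cast hn
      have hc : (d:ℝ) * (Real.exp 1 * (2 * (d * m) : ℕ) * (Real.pi / n)) ≤ 1/2 := by
        rw [show (d:ℝ) * (Real.exp 1 * (2 * (d * m) : ℕ) * (Real.pi / n)) =
          (2 * (Real.exp 1 * Real.pi) * (d^2 * m)) / n by push_cast; ring, div_le_iff₀ hn']
        have : Real.exp 1 * Real.pi ≤ 10 := by
          nlinarith [Real.exp_one_lt_d9, Real.exp_pos 1, Real.pi_lt_d2, Real.pi_pos]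
        have h2 : (0:ℝ) ≤ d^2 * m := by positivity
        nlinarith
      calc _ = ((d:ℝ) * (Real.exp 1 * (2 * (d * m) : ℕ) * (Real.pi / n))) * ‖Q yQ‖ := by ring
        _ ≤ _ := by gcongr
    have hpi : 0 ≤ Real.pi / (2*n) := by positivity
    obtain ⟨z, hz, hQz⟩ : ∃ z : Fin d → ℝ, (∀ k, |z k - thetaNode n (J k)| ≤ Real.pi / (2 * n)) ∧ ‖Q (cosv z)‖ ≤ δ * ‖R yR‖ := by
      rcases hcell J with h | ⟨z, hz, h⟩
      · refine ⟨fun k => thetaNode n (J k), fun k => by simpa using hpi, ?_⟩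
        simp only [hQ, h, mul_zero, norm_zero]; positivity
      · refine ⟨z, hz, ?_⟩
        simp only [hQ, norm_mul]
        gcongr
        exact hmaxR' _ (cosv_mem z)
    have h1 := linePoly_bern (by positivity) hQl ‖Q yQ‖ hmaxQ' z θ (Real.pi / n) (fun k => by
      calc |θ k - z k| ≤ |θ k - thetaNode n (J k)| + |z k - thetaNode n (J k)| := by
            rw [abs_sub_comm (z k)]; exact abs_sub_le _ _ _
        _ ≤ Real.pi / (2*n) + Real.pi / (2*n) := add_le_add (hJ k) (hz k)
        _ = Real.pi / n := by field_simp; ring)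
    rw [hyθ] at h1
    have h2 : ‖Q yQ‖ ≤ ‖Q yQ - Q (cosv z)‖ + ‖Q (cosv z)‖ := by
      simpa using norm_add_le (Q yQ - Q (cosv z)) (Q (cosv z))
    linarith
  -- lower bound
  obtain ⟨p₁, a1, a2⟩ := hP 0 yR
  obtain ⟨p₂, b1, b2⟩ := hR 0 yR
  obtain ⟨t, ht, g1, g2⟩ := common_good (d * m) hdm p₁ p₂ (a1.trans (by nlinarith)) b1
  have e1 : p₁.eval 0 = P 0 := by have := a2 0; simpa using this.symm
  have e2 : p₂.eval 1 = R yR := by have := b2 1; simpa using this.symm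
  rw [e1, ← a2 t] at g1
  rw [e2, ← b2 t] at g2
  have hmem : (0 : Fin d → ℝ) + t • yR ∈ Set.Icc (-1 : Fin d → ℝ) 1 := by
    rw [zero_add]
    constructor
    · intro k; have := hyR.1 k; have := hyR.2 k
      simp only [Pi.neg_apply, Pi.one_apply, Pi.smul_apply, smul_eq_mul] at *
      nlinarith [ht.1, ht.2]
    · intro k; have := hyR.1 k; have := hyR.2 k
      simp only [Pi.neg_apply, Pi.one_apply, Pi.smul_apply, smul_eq_mul] at *
      nlinarith [ht.1, ht.2]
  have h3 : ‖P 0‖ * ‖R yR‖ ≤ 4096 ^ (d * m) * (2 * δ) * ‖R yR‖ := by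
    calc ‖P 0‖ * ‖R yR‖ ≤ (64 ^ (d * m) * ‖P (0 + t • yR)‖) * (64 ^ (d*m) * ‖R (0 + t • yR)‖) := by gcongr
      _ = 4096 ^ (d * m) * ‖Q (0 + t • yR)‖ := by
          simp only [hQ, norm_mul]; rw [show (4096:ℝ) = 64 * 64 by norm_num, mul_pow]; ring
      _ ≤ 4096 ^ (d * m) * (2 * δ * ‖R yR‖) := by gcongr; exact (hmaxQ' _ hmem).trans hup
      _ = _ := by ring
  exact le_of_mul_le_mul_right h3 hRpos

lemma exists_R {d m : ℕ} (hm : 1 ≤ m) (B : Finset (Fin d → ℝ)) (hB : B.card < (m+1)^d) :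
    ∃ R : (Fin d → ℝ) → ℂ, LinePoly (d * m) R ∧ Continuous R ∧ (∀ y ∈ B, R y = 0) ∧
      ∃ y ∈ Set.Icc (-1 : Fin d → ℝ) 1, R y ≠ 0 := by
  classical
  set v : Fin (m+1) → ℂ := fun i => (((i:ℕ):ℝ)/(m:ℝ) : ℝ) with hv
  have hm' : (0:ℝ) < m := by positivity
  have hinj : Function.Injective v := by
    intro a b h
    simp only [hv, Complex.ofReal_inj] at h
    rw [div_left_inj' hm'.ne'] at h
    exact Fin.ext (by exact_mod_cast h)
  set ℓ : Fin (m+1) → Polynomial ℂ := fun i => Lagrange.basis Finset.univ v i with hℓ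
  have hdeg : ∀ i, (ℓ i).natDegree ≤ m := by
    intro i
    rw [Polynomial.natDegree_le_iff_degree_le, hℓ]
    simp only
    rw [Lagrange.degree_basis hinj.injOn (Finset.mem_univ i)]
    simp
  have hself : ∀ i, (ℓ i).eval (v i) = 1 := fun i => Lagrange.eval_basis_self hinj.injOn (Finset.mem_univ i)
  have hother : ∀ i j, i ≠ j → (ℓ i).eval (v j) = 0 := fun i j h => Lagrange.eval_basis_of_ne h (Finset.mem_univ j)
  let E : (Fin d → Fin (m+1)) → (Fin d → ℝ) → ℂ := fun g y => ∏ k, (ℓ (g k)).eval ((y k : ℝ) : ℂ)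
  let T : ((Fin d → Fin (m+1)) → ℂ) →ₗ[ℂ] (B → ℂ) :=
    { toFun := fun a y => ∑ g, a g * E g y.1
      map_add' := by intro a b; ext y; simp [add_mul, Finset.sum_add_distrib]
      map_smul' := by intro c a; ext y; simp [Finset.mul_sum, mul_assoc] }
  have hker : LinearMap.ker T ≠ ⊥ := LinearMap.ker_ne_bot_of_finrank_lt (by simpa using hB)
  obtain ⟨a, ha, ha0⟩ := (Submodule.ne_bot_iff _).1 hker
  refine ⟨fun y => ∑ g, a g * E g y, ?_, ?_, ?_, ?_⟩
  · refine LinePoly.sum _ fun g _ => ?_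
    intro x w
    refine ⟨Polynomial.C (a g) * ∏ k, (ℓ (g k)).comp (Polynomial.C (x k : ℂ) + Polynomial.C (w k : ℂ) * Polynomial.X), ?_, ?_⟩
    · refine (Polynomial.natDegree_C_mul_le _ _).trans ((Polynomial.natDegree_prod_le _ _).trans ?_)
      calc _ ≤ ∑ k : Fin d, m := Finset.sum_le_sum fun k _ => by
            refine (Polynomial.natDegree_comp_le).trans ?_
            have : (Polynomial.C (x k : ℂ) + Polynomial.C (w k : ℂ) * Polynomial.X).natDegree ≤ 1 := by
              compute_degree
            calc _ ≤ m * 1 := Nat.mul_le_mul (hdeg _) this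
              _ = m := mul_one m
        _ = d * m := by simp
    · intro t
      simp only [Polynomial.eval_mul, Polynomial.eval_C, Polynomial.eval_prod, Polynomial.eval_comp, E,
        Polynomial.eval_add, Polynomial.eval_X]
      congr 1
      refine Finset.prod_congr rfl fun k _ => ?_
      congr 1
      simp [mul_comm]
  · refine continuous_finsetSum _ fun g _ => continuous_const.mul (continuous_finsetProd _ fun k _ => ?_)
    exact (ℓ (g k)).continuous.comp (Complex.continuous_ofReal.comp (continuous_apply k))
  · intro y hy
    have := congrFun (LinearMap.mem_ker.1 ha) ⟨y, hy⟩
    exact this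
  · obtain ⟨g, hg⟩ : ∃ g, a g ≠ 0 := by
      by_contra! h; exact ha0 (funext h)
    refine ⟨fun k => ((g k : ℕ):ℝ)/m, ⟨fun k => ?_, fun k => ?_⟩, ?_⟩
    · simp only [Pi.neg_apply, Pi.one_apply]
      have : (0:ℝ) ≤ ((g k : ℕ):ℝ)/m := by positivity
      linarith
    · simp only [Pi.one_apply]
      rw [div_le_one hm']
      exact_mod_cast (by omega : (g k : ℕ) ≤ m)
    · beta_reduce
      rw [Finset.sum_eq_single g]
      · have : E g (fun k => ((g k : ℕ):ℝ)/m) = 1 := Finset.prod_eq_one fun k _ => hself (g k)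
        rw [this, mul_one]; exact hg
      · intro g' _ hne
        obtain ⟨k, hk⟩ := Function.ne_iff.1 hne
        have : E g' (fun k => ((g k : ℕ):ℝ)/m) = 0 :=
          Finset.prod_eq_zero (Finset.mem_univ k) (hother _ _ hk)
        rw [this, mul_zero]
      · simp
end

section
open Filter Topology
lemma exp_tail (z : ℂ) (r : ℝ) (hr : ‖z‖ ≤ r) (m : ℕ) :
    ‖Complex.exp z - ∑ j ∈ Finset.range m, z^j / (j.factorial : ℂ)‖ ≤ r^m / m.factorial * Real.exp r := by
  have hr0 : 0 ≤ r := (norm_nonneg _).trans hr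
  have h1 := Complex.norm_exp_sub_sum_le_exp_norm_sub_sum z m
  have h2 : ∀ r : ℝ, 0 ≤ r → Real.exp r - ∑ j ∈ Finset.range m, r^j / (j.factorial : ℝ) ≤ r^m / m.factorial * Real.exp r := by
    intro r hr0
    have hs : Summable fun j : ℕ => r^j / (j.factorial : ℝ) := Real.summable_pow_div_factorial r
    have he : Real.exp r = ∑' j : ℕ, r^j / (j.factorial : ℝ) := by
      rw [Real.exp_eq_exp_ℝ, NormedSpace.exp_eq_tsum_div]
    rw [he, ← hs.sum_add_tsum_nat_add m, add_sub_cancel_left, hs.sum_add_tsum_nat_add m, ← tsum_mul_left]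
    refine Summable.tsum_le_tsum (fun j => ?_) ((summable_nat_add_iff m).2 hs) (hs.mul_left _)
    rw [div_mul_div_comm, ← pow_add, add_comm j m]
    have : ((m.factorial * j.factorial : ℕ) : ℝ) ≤ ((m + j).factorial : ℕ) := by
      exact_mod_cast Nat.le_of_dvd (Nat.factorial_pos _) (Nat.factorial_mul_factorial_dvd_factorial_add m j)
    push_cast at this
    gcongr
  refine (h1.trans (h2 _ (norm_nonneg _))).trans ?_
  gcongr

variable {d : ℕ}

/-- the phase -/
def phase (a : EuclideanSpace ℝ (Fin d)) (x : EuclideanSpace ℝ (Fin d)) (ξ : Fin d → ℝ) : ℂ :=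
  -(2 * Real.pi * Complex.I) * ((∑ k, (x k - a k) * ξ k : ℝ) : ℂ)

lemma phase_cont_left (a : EuclideanSpace ℝ (Fin d)) (ξ : Fin d → ℝ) : Continuous fun x => phase a x ξ := by
  unfold phase; fun_prop

lemma phase_cont_right (a x : EuclideanSpace ℝ (Fin d)) : Continuous fun ξ => phase a x ξ := by
  unfold phase; fun_prop

lemma phase_add (a x : EuclideanSpace ℝ (Fin d)) (ξ η : Fin d → ℝ) : phase a x (ξ + η) = phase a x ξ + phase a x η := by
  unfold phase
  simp only [Pi.add_apply, mul_add, Finset.sum_add_distrib]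
  push_cast; ring

lemma phase_smul (a x : EuclideanSpace ℝ (Fin d)) (t : ℝ) (ξ : Fin d → ℝ) : phase a x (t • ξ) = t * phase a x ξ := by
  unfold phase
  have : ∑ k, (x k - a k) * (t • ξ) k = t * ∑ k, (x k - a k) * ξ k := by
    rw [Finset.mul_sum]; refine Finset.sum_congr rfl fun k _ => ?_
    simp only [Pi.smul_apply, smul_eq_mul]; ring
  rw [this]; push_cast; ring

lemma sum_bound (a x : EuclideanSpace ℝ (Fin d)) (ξ : Fin d → ℝ) (s : ℝ) (hs : ∀ k, |ξ k| ≤ s) :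
    |∑ k, (x k - a k) * ξ k| ≤ d * (‖x - a‖ * s) := by
  refine (Finset.abs_sum_le_sum_abs _ _).trans ?_
  calc _ ≤ ∑ k : Fin d, ‖x - a‖ * s := Finset.sum_le_sum fun k _ => by
        rw [abs_mul]
        have : |x k - a k| ≤ ‖x - a‖ := by
          have := PiLp.norm_apply_le (x - a) k
          simpa using this
        gcongr
        exact hs k
    _ = _ := by simp

lemma phase_bound (a x : EuclideanSpace ℝ (Fin d)) (ξ : Fin d → ℝ) (s : ℝ) (hs : ∀ k, |ξ k| ≤ s) :
    ‖phase a x ξ‖ ≤ 2 * Real.pi * (d * (‖x - a‖ * s)) := by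
  unfold phase
  rw [norm_mul, Complex.norm_real]
  have : ‖-(2 * Real.pi * Complex.I)‖ = 2 * Real.pi := by
    simp [abs_of_pos Real.pi_pos]
  rw [this]
  gcongr
  exact sum_bound a x ξ s hs

def FT (f : EuclideanSpace ℝ (Fin d) → ℝ) (a : EuclideanSpace ℝ (Fin d)) (ξ : Fin d → ℝ) : ℂ :=
  ∫ x, (f x : ℂ) * Complex.exp (phase a x ξ)

lemma integrable_mul_cont {f : EuclideanSpace ℝ (Fin d) → ℝ} (hf : Integrable f) {a : EuclideanSpace ℝ (Fin d)} {D : ℝ}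
    (hD : ∀ᵐ x, f x ≠ 0 → ‖x - a‖ ≤ D) {g : EuclideanSpace ℝ (Fin d) → ℂ} (hg : Continuous g) :
    Integrable fun x => (f x : ℂ) * g x := by
  obtain ⟨C, hC⟩ := (isCompact_closedBall a D).exists_bound_of_continuousOn hg.continuousOn
  refine Integrable.mono' (hf.norm.mul_const C) (hf.ofReal.aestronglyMeasurable.mul hg.aestronglyMeasurable) ?_
  filter_upwards [hD] with x hx
  by_cases h : f x = 0
  · simp [h]
  · rw [norm_mul, Complex.norm_real]
    gcongr
    exact hC x (by simpa [dist_eq_norm] using hx h)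

def taylorP (f : EuclideanSpace ℝ (Fin d) → ℝ) (a : EuclideanSpace ℝ (Fin d)) (T : ℝ) (m : ℕ) (y : Fin d → ℝ) : ℂ :=
  ∫ x, (f x : ℂ) * ∑ j ∈ Finset.range m, (phase a x (T • y))^j / (j.factorial : ℂ)

lemma taylorP_linePoly {f : EuclideanSpace ℝ (Fin d) → ℝ} (hf : Integrable f) {a : EuclideanSpace ℝ (Fin d)} {D : ℝ}
    (hD : ∀ᵐ x, f x ≠ 0 → ‖x - a‖ ≤ D) (T : ℝ) (m : ℕ) : LinePoly m (taylorP f a T m) := by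
  have hintg : ∀ (j : ℕ) (y : Fin d → ℝ), Integrable fun x => (f x : ℂ) * ((phase a x y)^j / (j.factorial : ℂ)) := by
    intro j y
    exact integrable_mul_cont hf hD (((phase_cont_left a y).pow j).div_const _)
  have e : taylorP f a T m = fun y => ∑ j ∈ Finset.range m, ∫ x, (f x : ℂ) * ((phase a x (T • y))^j / (j.factorial : ℂ)) := by
    ext y
    unfold taylorP
    rw [← integral_finsetSum _ fun j _ => hintg j _]
    simp only [Finset.mul_sum]
  rw [e]
  refine LinePoly.sum _ fun j hj => ?_
  have hj' := Finset.mem_range.1 hj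
  intro x0 v
  refine ⟨∑ i ∈ Finset.range (j+1), Polynomial.C (∫ x, (f x : ℂ) * ((phase a x (T • v))^i * (phase a x (T • x0))^(j-i) * (j.choose i) / (j.factorial : ℂ))) * Polynomial.X ^ i, ?_, ?_⟩
  · refine Polynomial.natDegree_sum_le_of_forall_le _ _ fun i hi => ?_
    have := Finset.mem_range.1 hi
    exact (Polynomial.natDegree_C_mul_X_pow_le _ _).trans (by omega)
  · intro t
    simp only [Polynomial.eval_finsetSum, Polynomial.eval_mul, Polynomial.eval_C, Polynomial.eval_pow, Polynomial.eval_X]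
    simp only [← integral_mul_const]
    rw [← integral_finsetSum]
    · congr 1; ext x
      rw [smul_add, smul_comm T t v, phase_add, phase_smul a x t (T • v), add_comm, add_pow, Finset.sum_div, Finset.mul_sum]
      refine Finset.sum_congr rfl fun i _ => ?_
      rw [mul_pow]; ring
    · intro i _
      refine Integrable.mul_const ?_ _
      refine integrable_mul_cont hf hD ?_
      exact ((((phase_cont_left a _).pow _).mul ((phase_cont_left a _).pow _)).mul_const _).div_const _

lemma taylorP_continuous {f : EuclideanSpace ℝ (Fin d) → ℝ} (hf : Integrable f) {a : EuclideanSpace ℝ (Fin d)} {D : ℝ}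
    (hD : ∀ᵐ x, f x ≠ 0 → ‖x - a‖ ≤ D) (T : ℝ) (m : ℕ) : Continuous (taylorP f a T m) := by
  rw [continuous_iff_continuousAt]
  intro y0
  unfold taylorP
  set s := |T| * (‖y0‖ + 1) with hs
  have hs0 : 0 ≤ s := by positivity
  refine continuousAt_of_dominated (bound := fun x => ‖f x‖ * ∑ j ∈ Finset.range m, (2 * Real.pi * (d * (D * s)))^j / (j.factorial : ℝ)) ?_ ?_ ?_ ?_
  · refine Eventually.of_forall fun y => hf.ofReal.aestronglyMeasurable.mul ?_
    refine Continuous.aestronglyMeasurable ?_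
    exact continuous_finsetSum _ fun j _ => ((phase_cont_left a _).pow j).div_const _
  · filter_upwards [Metric.ball_mem_nhds y0 one_pos] with y hy
    filter_upwards [hD] with x hx
    by_cases h : f x = 0
    · simp [h]
    rw [norm_mul, Complex.norm_real]
    gcongr
    refine (norm_sum_le _ _).trans (Finset.sum_le_sum fun j _ => ?_)
    rw [norm_div, norm_pow, Complex.norm_natCast]
    gcongr
    refine (phase_bound a x (T • y) s fun k => ?_).trans ?_
    · rw [Pi.smul_apply, smul_eq_mul, abs_mul, hs]
      gcongr
      have h1 : ‖y k‖ ≤ ‖y‖ := norm_le_pi_norm y k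
      have h2 : ‖y‖ ≤ ‖y0‖ + ‖y - y0‖ := by simpa using norm_add_le y0 (y - y0)
      rw [Metric.mem_ball, dist_eq_norm] at hy
      rw [Real.norm_eq_abs] at h1
      linarith
    · have := hx h
      gcongr
  · exact hf.norm.mul_const _
  · refine Eventually.of_forall fun x => ContinuousAt.mul continuousAt_const ?_
    refine Continuous.continuousAt ?_
    refine continuous_finsetSum _ fun j _ => (Continuous.pow ?_ j).div_const _
    exact (phase_cont_right a x).comp (by fun_prop)

lemma taylorP_zero {f : EuclideanSpace ℝ (Fin d) → ℝ} (a : EuclideanSpace ℝ (Fin d)) (T : ℝ) (m : ℕ) (hm : 1 ≤ m) :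
    taylorP f a T m 0 = ((∫ x, f x : ℝ) : ℂ) := by
  unfold taylorP
  rw [← integral_complex_ofReal]
  congr 1; ext x
  have : phase a x (T • (0 : Fin d → ℝ)) = 0 := by simp [phase]
  rw [this]
  obtain ⟨k, rfl⟩ := Nat.exists_eq_add_of_le' hm
  rw [Finset.sum_range_succ']
  simp

lemma taylorP_bound {f : EuclideanSpace ℝ (Fin d) → ℝ} (hf : Integrable f) {a : EuclideanSpace ℝ (Fin d)} {D : ℝ}
    (hD : ∀ᵐ x, f x ≠ 0 → ‖x - a‖ ≤ D) (T : ℝ) (hT : 0 ≤ T) (m : ℕ) (b : ℝ) (hb : 0 ≤ b)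
    (hbm : 2 * Real.pi * (d * (D * T)) ≤ b * m) (y : Fin d → ℝ) (hy : ∀ k, |y k| ≤ 1) :
    ‖FT f a (T • y) - taylorP f a T m y‖ ≤ (∫ x, ‖f x‖) * (b * Real.exp (1 + b))^m := by
  unfold FT taylorP
  have i1 : Integrable fun x => (f x : ℂ) * Complex.exp (phase a x (T • y)) :=
    integrable_mul_cont hf hD (Complex.continuous_exp.comp (phase_cont_left a _))
  have i2 : Integrable fun x => (f x : ℂ) * ∑ j ∈ Finset.range m, (phase a x (T • y))^j / (j.factorial : ℂ) :=
    integrable_mul_cont hf hD (continuous_finsetSum _ fun j _ => ((phase_cont_left a _).pow j).div_const _)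
  rw [← integral_sub i1 i2, ← integral_mul_const]
  refine norm_integral_le_of_norm_le (hf.norm.mul_const _) ?_
  filter_upwards [hD] with x hx
  by_cases h : f x = 0
  · simp [h]
  rw [← mul_sub, norm_mul, Complex.norm_real]
  gcongr
  have hph : ‖phase a x (T • y)‖ ≤ b * m := by
    refine (phase_bound a x (T • y) T fun k => ?_).trans (le_trans ?_ hbm)
    · rw [Pi.smul_apply, smul_eq_mul, abs_mul, abs_of_nonneg hT]
      exact mul_le_of_le_one_right hT (hy k)
    · have := hx h
      gcongr
  refine (exp_tail _ _ hph m).trans ?_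
  have h1 := Real.pow_div_factorial_le_exp (m:ℝ) (by positivity) m
  calc (b * m)^m / m.factorial * Real.exp (b * m) = b^m * ((m:ℝ)^m / m.factorial) * Real.exp (b * m) := by
        rw [mul_pow]; ring
    _ ≤ b^m * Real.exp m * Real.exp (b * m) := by gcongr
    _ = _ := by
        rw [mul_pow, ← Real.exp_nat_mul, mul_assoc, ← Real.exp_add]; congr 2; ring

/-- the small constant -/
def bcst (d : ℕ) : ℝ := 1 / (16 * 4096 ^ d)

def Kcst (d : ℕ) : ℝ := 2 * Real.pi * d / bcst d

lemma E_main (hd : 1 ≤ d) {f : EuclideanSpace ℝ (Fin d) → ℝ} (hf : Integrable f) {a : EuclideanSpace ℝ (Fin d)} {D : ℝ}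
    (hD : ∀ᵐ x, f x ≠ 0 → ‖x - a‖ ≤ D) (hD0 : 0 < D) (hc : (∫ x, f x) ≠ 0) :
    ∃ m0 : ℕ, ∀ m, m0 ≤ m → 1 ≤ m → ∀ n, 40 * d^2 * m ≤ n → ∀ B : Finset (Fin d → Fin n), B.card ≤ m^d →
      (∀ J, J ∉ B → ∃ z : Fin d → ℝ, (∀ k, |z k - thetaNode n (J k)| ≤ Real.pi / (2 * n)) ∧
        FT f a ((m / (Kcst d * D)) • cosv z) = 0) → False := by
  classical
  set I := ∫ x, ‖f x‖ with hI
  have hI0 : 0 ≤ I := integral_nonneg fun _ => norm_nonneg _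
  have hb0 : 0 < bcst d := by unfold bcst; positivity
  have hK0 : 0 < Kcst d := by
    unfold Kcst; have := Real.pi_pos; positivity
  have hlim : Tendsto (fun m : ℕ => 2 * I * (1/2:ℝ)^m) atTop (𝓝 0) := by
    simpa using (tendsto_pow_atTop_nhds_zero_of_lt_one (by norm_num : (0:ℝ) ≤ 1/2) (by norm_num)).const_mul (2 * I)
  obtain ⟨m0, hm0⟩ := eventually_atTop.1 (hlim.eventually_lt_const (abs_pos.2 hc))
  refine ⟨m0, fun m hmm hm n hn B hB hJ => ?_⟩
  set T := (m:ℝ) / (Kcst d * D) with hT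
  have hT0 : 0 ≤ T := by positivity
  have hbm : 2 * Real.pi * (d * (D * T)) ≤ bcst d * m := by
    have hd' : (0:ℝ) < d := by positivity
    have := Real.pi_pos
    rw [hT, Kcst]
    apply le_of_eq
    field_simp
  have hbe : bcst d * Real.exp (1 + bcst d) ≤ 1/2 * (1 / 4096^d) := by
    have hb1 : bcst d ≤ 1 := by
      unfold bcst
      rw [div_le_one (by positivity)]
      have : (1:ℝ) ≤ 4096^d := one_le_pow₀ (by norm_num)
      linarith
    have h1 : Real.exp (1 + bcst d) ≤ 8 := by
      calc Real.exp (1 + bcst d) ≤ Real.exp (1 + 1) := by gcongr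
        _ = Real.exp 1 * Real.exp 1 := Real.exp_add _ _
        _ ≤ 8 := by nlinarith [Real.exp_one_lt_d9, Real.exp_pos 1]
    calc _ ≤ bcst d * 8 := by gcongr
      _ = _ := by unfold bcst; field_simp; norm_num
  set δ := I * (bcst d * Real.exp (1 + bcst d))^m with hδ
  have hδ0 : 0 ≤ δ := by positivity
  obtain ⟨R, hR1, hR2, hR3, hR4⟩ := exists_R (d := d) hm (B.image fun J => cosv fun k => thetaNode n (J k))
    (lt_of_le_of_lt (Finset.card_image_le.trans hB) (Nat.pow_lt_pow_left (Nat.lt_succ_self m) (by omega)))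
  have := cell_core hd hm hn (taylorP f a T m) R (taylorP_linePoly hf hD T m) hR1 (taylorP_continuous hf hD T m) hR2 hR4
    δ hδ0 (by
      intro J
      by_cases hJB : J ∈ B
      · exact Or.inl (hR3 _ (Finset.mem_image_of_mem _ hJB))
      · obtain ⟨z, hz, hF⟩ := hJ J hJB
        refine Or.inr ⟨z, hz, ?_⟩
        have := taylorP_bound hf hD T hT0 m (bcst d) hb0.le hbm (cosv z) (fun k => Real.abs_cos_le_one _)
        rw [hF, zero_sub, norm_neg] at this
        exact this)
  rw [taylorP_zero a T m hm, Complex.norm_real, Real.norm_eq_abs] at this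
  have h2 : 4096 ^ (d * m) * (2 * δ) ≤ 2 * I * (1/2:ℝ)^m := by
    calc _ ≤ 4096 ^ (d * m) * (2 * (I * (1/2 * (1 / 4096^d))^m)) := by rw [hδ]; gcongr
      _ = _ := by
        rw [pow_mul, mul_pow, div_pow 1 ((4096:ℝ)^d), one_pow]
        field_simp
  exact absurd (hm0 m hmm) (not_lt.2 (this.trans h2))
end

section
open Filter Topology
variable {d : ℕ}

lemma sin_lower (t n : ℕ) (hn : 0 < n) (u : ℝ) (h1 : (t:ℝ) * Real.pi / n ≤ u) (h2 : u ≤ Real.pi - t * Real.pi / n) :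
    2 * (t:ℝ) / n ≤ Real.sin u := by
  have hpi := Real.pi_pos
  have hn' : (0:ℝ) < n := by positivity
  have ht : 0 ≤ (t:ℝ) * Real.pi / n := by positivity
  have key : ∀ u : ℝ, (t:ℝ) * Real.pi / n ≤ u → u ≤ Real.pi / 2 → 2 * (t:ℝ) / n ≤ Real.sin u := by
    intro u h1 h2
    refine le_trans ?_ (Real.mul_le_sin (ht.trans h1) h2)
    calc 2 * (t:ℝ) / n = 2 / Real.pi * (t * Real.pi / n) := by field_simp
      _ ≤ _ := by gcongr
  rcases le_total u (Real.pi / 2) with h | h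
  · exact key u h1 h
  · rw [← Real.sin_pi_sub]
    exact key _ (by linarith) (by linarith)

lemma cell_1d (t n j : ℕ) (hn : 0 < n) (hj : t ≤ j) (hj' : j + t + 1 ≤ n) (w : ℝ)
    (hw : |w - Real.cos (thetaNode n j)| < 2 * t / n ^ 2) :
    w ∈ Set.Icc (-1:ℝ) 1 ∧ |Real.arccos w - thetaNode n j| < Real.pi / (2 * n) := by
  have hpi := Real.pi_pos
  have hn' : (0:ℝ) < n := by positivity
  have hjr : (t:ℝ) ≤ j := by exact_mod_cast hj
  have hjr' : (j:ℝ) + t + 1 ≤ n := by exact_mod_cast hj'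
  set θ := thetaNode n j with hθ
  set η := Real.pi / (2 * n) with hη
  have hη0 : 0 < η := by positivity
  have hθη : θ = (2 * j + 1) * η := by rw [hθ, hη, thetaNode]; field_simp
  have hpn : Real.pi = 2 * n * η := by rw [hη]; field_simp
  have htn : (t:ℝ) * Real.pi / n = 2 * t * η := by rw [hη]; field_simp
  have hs : 1 / (2 * (n:ℝ)) ≤ Real.sin (η / 2) := by
    refine le_trans ?_ (Real.mul_le_sin (by positivity) ?_)
    · rw [hη]; apply le_of_eq; field_simp
    · have : (1:ℝ) ≤ n := by exact_mod_cast hn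
      nlinarith
  have hprod : ∀ u : ℝ, 2 * t * η ≤ u → u ≤ Real.pi - 2 * t * η → 2 * t / (n:ℝ)^2 ≤ 2 * Real.sin u * Real.sin (η/2) := by
    intro u h1 h2
    have := sin_lower t n hn u (by rw [htn]; exact h1) (by rw [htn]; exact h2)
    have h0 : 0 ≤ Real.sin u := le_trans (by positivity) this
    calc 2 * t / (n:ℝ)^2 = 2 * (2 * t / n) * (1 / (2 * n)) := by field_simp
      _ ≤ _ := by gcongr
  have hA : 2 * t / (n:ℝ)^2 ≤ Real.cos (θ - η) - Real.cos θ := by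
    rw [Real.cos_sub_cos]
    have := hprod (θ - η / 2) (by rw [hθη]; nlinarith) (by rw [hθη, hpn]; nlinarith)
    rw [show (θ - η + θ)/2 = θ - η/2 by ring, show (θ - η - θ)/2 = -(η/2) by ring, Real.sin_neg]
    linarith
  have hB : 2 * t / (n:ℝ)^2 ≤ Real.cos θ - Real.cos (θ + η) := by
    rw [Real.cos_sub_cos]
    have := hprod (θ + η / 2) (by rw [hθη]; nlinarith) (by rw [hθη, hpn]; nlinarith)
    rw [show (θ + (θ + η))/2 = θ + η/2 by ring, show (θ - (θ + η))/2 = -(η/2) by ring, Real.sin_neg]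
    linarith
  rw [abs_lt] at hw
  have c1 : Real.cos (θ + η) < w := by linarith
  have c2 : w < Real.cos (θ - η) := by linarith
  have hw1 : -1 ≤ w := (Real.neg_one_le_cos _).trans c1.le
  have hw2 : w ≤ 1 := c2.le.trans (Real.cos_le_one _)
  have t0 : (0:ℝ) ≤ t := by positivity
  refine ⟨⟨hw1, hw2⟩, ?_⟩
  have d1 : Real.arccos w < θ + η := by
    have := Real.strictAntiOn_arccos ⟨Real.neg_one_le_cos _, Real.cos_le_one _⟩ ⟨hw1, hw2⟩ c1
    rwa [Real.arccos_cos (by rw [hθη]; nlinarith) (by rw [hθη, hpn]; nlinarith)] at this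
  have d2 : θ - η < Real.arccos w := by
    have := Real.strictAntiOn_arccos ⟨hw1, hw2⟩ ⟨Real.neg_one_le_cos _, Real.cos_le_one _⟩ c2
    rwa [Real.arccos_cos (by rw [hθη]; nlinarith) (by rw [hθη, hpn]; nlinarith)] at this
  rw [abs_lt]; constructor <;> linarith

lemma cell_inj (t n j j' : ℕ) (hn : 0 < n) (hj : t ≤ j) (hj1 : j + t + 1 ≤ n) (hj2 : t ≤ j') (hj3 : j' + t + 1 ≤ n) (w : ℝ)
    (hw : |w - Real.cos (thetaNode n j)| < 2 * t / n ^ 2) (hw' : |w - Real.cos (thetaNode n j')| < 2 * t / n ^ 2) : j = j' := by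
  have h1 := (cell_1d t n j hn hj hj1 w hw).2
  have h2 := (cell_1d t n j' hn hj2 hj3 w hw').2
  have hpi := Real.pi_pos
  have hn' : (0:ℝ) < n := by positivity
  set η := Real.pi / (2 * n) with hη
  have hη0 : 0 < η := by positivity
  have e : ∀ j : ℕ, thetaNode n j = (2 * j + 1) * η := fun j => by rw [hη, thetaNode]; field_simp
  rw [e, abs_lt] at h1 h2
  by_contra hne
  rcases lt_or_gt_of_ne hne with h | h
  · have : (j:ℝ) + 1 ≤ j' := by exact_mod_cast h
    nlinarith
  · have : (j':ℝ) + 1 ≤ j := by exact_mod_cast h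
    nlinarith

lemma cubeAvg_ball (T r : ℝ) (hT : 0 < T) (hr : 0 < r) (c : Fin d → ℝ) (h1 : ∀ k, -T ≤ c k - r) (h2 : ∀ k, c k + r ≤ T) :
    (cubeAvg (Fin d) (-T) T).real (Metric.ball c r) = (r / T)^d := by
  have hb : Metric.ball c r = Set.univ.pi fun k => Metric.ball (c k) r := ball_pi c hr
  have hu : ∀ k, unif (-T) T (Metric.ball (c k) r) = ENNReal.ofReal (r / T) := by
    intro k
    rw [unif, Measure.smul_apply, Measure.restrict_apply measurableSet_ball, Set.inter_eq_left.2, Real.volume_ball,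
      smul_eq_mul, ← ENNReal.ofReal_mul (by simp; linarith)]
    · congr 1; field_simp; ring
    · rw [Real.ball_eq_Ioo]
      intro x hx
      exact ⟨lt_of_le_of_lt (h1 k) hx.1, hx.2.le.trans (h2 k)⟩
  rw [measureReal_def, hb, cubeAvg, Measure.pi_pi]
  simp only [hu, Finset.prod_const, Finset.card_univ, Fintype.card_fin]
  rw [ENNReal.toReal_pow, ENNReal.toReal_ofReal (by positivity)]

def C3 (d : ℕ) : ℕ := 8 * d * (40 * d^2)^d

def kap (d : ℕ) : ℝ := 1 / (1600 * d^4 * C3 d * Kcst d)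

lemma card_slab (n t : ℕ) (k : Fin d) :
    (Finset.univ.filter fun J : Fin d → Fin n => (J k : ℕ) < t ∨ n < (J k : ℕ) + t + 1).card ≤ 2 * t * n^(d-1) := by
  classical
  set S : Finset (Fin n) := Finset.univ.filter fun j => (j : ℕ) < t ∨ n < (j : ℕ) + t + 1 with hS
  have hSc : S.card ≤ 2 * t := by
    have : S.image (fun j : Fin n => (j:ℕ)) ⊆ Finset.range t ∪ Finset.Ico (n - t) n := by
      intro x hx
      obtain ⟨j, hj, rfl⟩ := Finset.mem_image.1 hx
      have := (Finset.mem_filter.1 hj).2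
      have := j.2
      simp only [Finset.mem_union, Finset.mem_range, Finset.mem_Ico]
      omega
    have h2 := (Finset.card_le_card this).trans (Finset.card_union_le _ _)
    rw [Finset.card_image_of_injective _ Fin.val_injective, Finset.card_range, Nat.card_Ico] at h2
    omega
  have e : (Finset.univ.filter fun J : Fin d → Fin n => (J k : ℕ) < t ∨ n < (J k : ℕ) + t + 1) =
      Fintype.piFinset (fun k' => if k' = k then S else Finset.univ) := by
    ext J
    simp only [Finset.mem_filter, Finset.mem_univ, true_and, Fintype.mem_piFinset]
    constructor
    · intro h k'
      split_ifs with hk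
      · subst hk; exact Finset.mem_filter.2 ⟨Finset.mem_univ _, h⟩
      · simp
    · intro h
      have := h k
      rw [if_pos rfl] at this
      exact (Finset.mem_filter.1 this).2
  rw [e, Fintype.card_piFinset, ← Finset.mul_prod_erase _ _ (Finset.mem_univ k)]
  simp only [if_true]
  refine Nat.mul_le_mul hSc ?_
  rw [Finset.prod_congr rfl (g := fun _ => n)]
  · simp
  · intro k' hk'
    rw [if_neg (Finset.ne_of_mem_erase hk')]; simp

lemma count_core (hd : 1 ≤ d) (N : ℕ) (hN : 0 < N) (D : ℝ) (hD : 0 < D) (L H : Set (Fin d → ℝ)) (t m n : ℕ) (ht : 1 ≤ t)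
    (hm : m = C3 d * t) (hn : n = 40 * d^2 * m) (T r : ℝ) (hT : T = m / (Kcst d * D)) (hr : r = kap d / D)
    (hH : ∀ ξ, ξ ∉ H → ∃ l ∈ L, ‖ξ - l‖ < r)
    (hmeas : (cubeAvg (Fin d) (-T) T).real H ≤ 2 / (N * r^d))
    (hDN : 8 * D^d ≤ N * (kap d)^d * (Kcst d * kap d)^d) :
    ∃ B : Finset (Fin d → Fin n), B.card ≤ m^d ∧ ∀ J, J ∉ B → ∃ z : Fin d → ℝ,
      (∀ k, |z k - thetaNode n (J k)| ≤ Real.pi / (2 * n)) ∧ T • cosv z ∈ L ∧ T • cosv z ≠ 0 := by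
  classical
  have hpi := Real.pi_pos
  have hC3 : 8 ≤ C3 d := by
    unfold C3
    have : 1 ≤ (40 * d^2)^d := Nat.one_le_pow _ _ (by positivity)
    nlinarith
  have hm8 : 8 ≤ m := by rw [hm]; nlinarith
  have hd2 : 1 ≤ d^2 := Nat.one_le_pow _ _ hd
  have hn0 : 0 < n := by rw [hn]; positivity
  have hdr : (0:ℝ) < d := by positivity
  have hK : 0 < Kcst d := by unfold Kcst bcst; positivity
  have hC3r : (0:ℝ) < C3 d := by positivity
  have hk : 0 < kap d := by unfold kap; positivity
  have hmr : (0:ℝ) < m := by positivity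
  have htr : (0:ℝ) < t := by positivity
  have hnr : (0:ℝ) < n := by positivity
  have hNr : (0:ℝ) < N := by positivity
  have hT0 : 0 < T := by rw [hT]; positivity
  have hr0 : 0 < r := by rw [hr]; positivity
  set ρ : ℝ := 2 * t / n^2 with hρ
  have hTρ : T * ρ = 2 * r := by
    rw [hT, hρ, hr, kap, hn, hm]
    push_cast
    field_simp
    norm_num
  set y : (Fin d → Fin n) → Fin d → ℝ := fun J => cosv fun k => thetaNode n (J k) with hy
  let inter : (Fin d → Fin n) → Prop := fun J => ∀ k, t ≤ (J k : ℕ) ∧ (J k : ℕ) + t + 1 ≤ n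
  let good : (Fin d → Fin n) → Prop := fun J => ∃ z : Fin d → ℝ,
      (∀ k, |z k - thetaNode n (J k)| ≤ Real.pi / (2 * n)) ∧ T • cosv z ∈ L ∧ T • cosv z ≠ 0
  -- near a point
  have near_inj : ∀ J J', inter J → inter J' → ∀ w : Fin d → ℝ, (∀ k, |w k - y J k| < ρ) → (∀ k, |w k - y J' k| < ρ) → J = J' := by
    intro J J' h h' w hw hw'
    ext k
    exact cell_inj t n _ _ hn0 (h k).1 (h k).2 (h' k).1 (h' k).2 (w k) (hw k) (hw' k)
  have near_cos : ∀ J, inter J → ∀ w : Fin d → ℝ, (∀ k, |w k - y J k| < ρ) →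
      ∃ z : Fin d → ℝ, (∀ k, |z k - thetaNode n (J k)| ≤ Real.pi / (2 * n)) ∧ cosv z = w := by
    intro J h w hw
    have h1 := fun k => cell_1d t n (J k) hn0 (h k).1 (h k).2 (w k) (hw k)
    refine ⟨fun k => Real.arccos (w k), fun k => (h1 k).2.le, ?_⟩
    ext k
    exact Real.cos_arccos (h1 k).1.1 (h1 k).1.2
  set B0 := Finset.univ.filter fun J : Fin d → Fin n => ¬ inter J with hB0
  set B1 := Finset.univ.filter fun J : Fin d → Fin n => inter J ∧ ∀ k, |y J k| < ρ with hB1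
  set B2 := Finset.univ.filter fun J : Fin d → Fin n => inter J ∧ ¬ good J ∧ ¬ ∀ k, |y J k| < ρ with hB2
  have hmd : (m:ℝ) ≤ (m:ℝ)^d := by
    exact_mod_cast Nat.le_self_pow (by omega) m
  -- counts
  have c0 : 4 * B0.card ≤ m^d := by
    have h1 : B0 ⊆ Finset.univ.biUnion fun k : Fin d => Finset.univ.filter fun J : Fin d → Fin n => (J k : ℕ) < t ∨ n < (J k : ℕ) + t + 1 := by
      intro J hJ
      have := (Finset.mem_filter.1 hJ).2
      simp only [inter, not_forall] at this
      obtain ⟨k, hk⟩ := this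
      simp only [Finset.mem_biUnion, Finset.mem_univ, true_and, Finset.mem_filter]
      exact ⟨k, by omega⟩
    have h2 : B0.card ≤ d * (2 * t * n^(d-1)) := by
      refine (Finset.card_le_card h1).trans (Finset.card_biUnion_le.trans ?_)
      calc _ ≤ ∑ k : Fin d, 2 * t * n^(d-1) := Finset.sum_le_sum fun k _ => card_slab n t k
        _ = _ := by simp
    calc 4 * B0.card ≤ 4 * (d * (2 * t * n^(d-1))) := by gcongr
      _ = (8 * d * (40 * d^2)^(d-1)) * t * m^(d-1) := by rw [hn, mul_pow]; ring
      _ ≤ (8 * d * (40 * d^2)^d) * t * m^(d-1) := by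
          gcongr
          · nlinarith
          · omega
      _ = m * m^(d-1) := by rw [hm, C3]
      _ = m^d := by rw [← pow_succ']; congr 1; omega
  have c1 : B1.card ≤ 1 := by
    rw [Finset.card_le_one]
    intro J hJ J' hJ'
    have a := (Finset.mem_filter.1 hJ).2
    have b := (Finset.mem_filter.1 hJ').2
    refine near_inj J J' a.1 b.1 0 ?_ ?_
    · intro k; simpa using a.2 k
    · intro k; simpa using b.2 k
  have hball : ∀ J, inter J → ∀ ξ ∈ Metric.ball (T • y J) (2 * r), ∀ k, |(T⁻¹ • ξ) k - y J k| < ρ := by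
    intro J _ ξ hξ k
    rw [Metric.mem_ball, dist_eq_norm] at hξ
    have h1 : |(ξ - T • y J) k| < 2 * r := lt_of_le_of_lt (norm_le_pi_norm (ξ - T • y J) k) hξ
    rw [← hTρ] at h1
    have h2 : (T⁻¹ • ξ) k - y J k = T⁻¹ * (ξ - T • y J) k := by
      simp only [Pi.smul_apply, smul_eq_mul, Pi.sub_apply]; field_simp
    rw [h2, abs_mul, abs_of_pos (inv_pos.2 hT0), inv_mul_lt_iff₀ hT0]
    exact h1
  have c2 : (B2.card : ℝ) ≤ m^d / 4 := by
    have hsub : (⋃ J ∈ B2, Metric.ball (T • y J) r) ⊆ H := by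
      intro ξ hξ
      simp only [Set.mem_iUnion] at hξ
      obtain ⟨J, hJ, hξ⟩ := hξ
      obtain ⟨h1, h2, h3⟩ := (Finset.mem_filter.1 hJ).2
      by_contra hnot
      obtain ⟨l, hl, hlr⟩ := hH ξ hnot
      have hlb : l ∈ Metric.ball (T • y J) (2 * r) := by
        rw [Metric.mem_ball] at hξ ⊢
        rw [← dist_eq_norm, dist_comm] at hlr
        calc dist l (T • y J) ≤ dist l ξ + dist ξ (T • y J) := dist_triangle _ _ _
          _ < 2 * r := by linarith
      have hw := hball J h1 l hlb
      by_cases hl0 : l = 0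
      · apply h3
        intro k
        have := hw k
        simpa [hl0] using this
      · apply h2
        obtain ⟨z, hz, hzw⟩ := near_cos J h1 _ hw
        have e : T • cosv z = l := by rw [hzw, smul_smul, mul_inv_cancel₀ hT0.ne', one_smul]
        exact ⟨z, hz, by rw [e]; exact hl, by rw [e]; exact hl0⟩
    have hdisj : Set.PairwiseDisjoint (B2 : Set (Fin d → Fin n)) fun J => Metric.ball (T • y J) r := by
      intro J hJ J' hJ' hne
      have a := (Finset.mem_filter.1 hJ).2
      have b := (Finset.mem_filter.1 hJ').2
      rw [Function.onFun, Set.disjoint_left]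
      intro ξ h1 h2
      refine hne (near_inj J J' a.1 b.1 (T⁻¹ • ξ) (hball J a.1 ξ ?_) (hball J' b.1 ξ ?_))
      · exact Metric.ball_subset_ball (by linarith) h1
      · exact Metric.ball_subset_ball (by linarith) h2
    have hvol : ∀ J ∈ B2, (cubeAvg (Fin d) (-T) T).real (Metric.ball (T • y J) r) = (r/T)^d := by
      intro J hJ
      have a := (Finset.mem_filter.1 hJ).2.1
      have hrρ : r = T * (ρ/2) := by linarith
      have hρ0 : 0 < ρ := by positivity
      refine cubeAvg_ball T r hT0 hr0 _ (fun k => ?_) (fun k => ?_)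
      · have := (cell_1d t n (J k) hn0 (a k).1 (a k).2 (y J k - ρ/2) (by
          simp only [hy, cosv]
          rw [show ∀ u : ℝ, u - ρ/2 - u = -(ρ/2) by intro u; ring, abs_neg, abs_of_pos (by positivity)]; linarith)).1.1
        rw [hrρ, Pi.smul_apply, smul_eq_mul]; nlinarith
      · have := (cell_1d t n (J k) hn0 (a k).1 (a k).2 (y J k + ρ/2) (by
          simp only [hy, cosv]
          rw [show ∀ u : ℝ, u + ρ/2 - u = (ρ/2) by intro u; ring, abs_of_pos (by positivity)]; linarith)).1.2
        rw [hrρ, Pi.smul_apply, smul_eq_mul]; nlinarith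
    have h1 : (B2.card : ℝ) * (r/T)^d ≤ 2 / (N * r^d) := by
      refine le_trans ?_ hmeas
      refine le_trans (le_of_eq ?_) (measureReal_mono hsub)
      rw [measureReal_biUnion_finset hdisj (fun _ _ => measurableSet_ball), Finset.sum_congr rfl hvol]
      simp
    have e1 : r / T = (Kcst d * kap d) / m := by rw [hr, hT]; field_simp
    rw [e1, hr, div_pow, div_pow] at h1
    have hX : 0 < (Kcst d * kap d)^d := by positivity
    have hY : 0 < (kap d)^d := by positivity
    have hDd : 0 < D^d := by positivity
    have hMd : 0 < (m:ℝ)^d := by positivity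
    generalize (Kcst d * kap d)^d = X at *
    generalize (kap d)^d = Y at *
    generalize D^d = Z at *
    generalize (m:ℝ)^d = W at *
    have h2 : (B2.card : ℝ) ≤ 2 * Z * W / (N * Y * X) := by
      rw [le_div_iff₀ (by positivity)]
      have : (B2.card : ℝ) * (X / W) * (N * Y) ≤ 2 * Z := by
        calc _ ≤ 2 / (N * (Y / Z)) * (N * Y) := by gcongr
          _ = 2 * Z := by field_simp
      calc (B2.card : ℝ) * (N * Y * X) = ((B2.card : ℝ) * (X / W) * (N * Y)) * W := by field_simp
        _ ≤ 2 * Z * W := by gcongr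
    refine h2.trans ?_
    rw [div_le_iff₀ (by positivity)]
    nlinarith
  refine ⟨B0 ∪ (B1 ∪ B2), ?_, ?_⟩
  · have h1 : (B0 ∪ (B1 ∪ B2)).card ≤ B0.card + (B1.card + B2.card) :=
      (Finset.card_union_le _ _).trans (by gcongr; exact Finset.card_union_le _ _)
    have h2 : ((B0 ∪ (B1 ∪ B2)).card : ℝ) ≤ B0.card + (B1.card + B2.card) := by exact_mod_cast h1
    have h3 : 4 * (B0.card : ℝ) ≤ m^d := by exact_mod_cast c0
    have h4 : (B1.card : ℝ) ≤ 1 := by exact_mod_cast c1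
    have h5 : (8:ℝ) ≤ m := by exact_mod_cast hm8
    have h6 : ((B0 ∪ (B1 ∪ B2)).card : ℝ) ≤ (m:ℝ)^d := by linarith
    exact_mod_cast h6
  · intro J hJ
    by_contra hg
    apply hJ
    simp only [Finset.mem_union, hB0, hB1, hB2, Finset.mem_filter, Finset.mem_univ, true_and]
    by_cases h1 : inter J
    · by_cases h2 : ∀ k, |y J k| < ρ
      · exact Or.inr (Or.inl ⟨h1, h2⟩)
      · exact Or.inr (Or.inr ⟨h1, hg, h2⟩)
    · exact Or.inl h1
end

section
open Filter Topology
variable {d : ℕ}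

def intv (m : Fin d → ℤ) : Fin d → ℝ := fun i => (m i : ℝ)

lemma intv_inj : Function.Injective (intv (d := d)) := by
  intro a b h; ext i
  have := congrFun h i
  simpa [intv] using this

abbrev latSub (d : ℕ) : Submodule ℤ (Fin d → ℝ) := Submodule.span ℤ (Set.range (Pi.basisFun ℝ (Fin d)))

lemma mem_latSub (v : Fin d → ℝ) : v ∈ latSub d ↔ ∃ m : Fin d → ℤ, intv m = v := by
  unfold latSub
  rw [Module.Basis.mem_span_iff_repr_mem]
  constructor
  · intro h
    choose m hm using h
    exact ⟨m, funext fun i => by simpa [intv] using hm i⟩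
  · rintro ⟨m, rfl⟩ i
    exact ⟨m i, by simp [intv]⟩

def latEquiv (d : ℕ) : (Fin d → ℤ) ≃ latSub d :=
  Equiv.ofBijective (fun m => ⟨intv m, (mem_latSub _).2 ⟨m, rfl⟩⟩)
    ⟨fun a b h => intv_inj (Subtype.ext_iff.1 h), fun v => by
      obtain ⟨m, hm⟩ := (mem_latSub v.1).1 v.2
      exact ⟨m, Subtype.ext hm⟩⟩

lemma cubeAvg_unit : cubeAvg (Fin d) 0 1 = volume.restrict (ZSpan.fundamentalDomain (Pi.basisFun ℝ (Fin d))) := by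
  rw [ZSpan.fundamentalDomain_pi_basisFun, volume_pi, Measure.restrict_pi_pi, cubeAvg]
  congr 1; ext1 i
  rw [unif, restrict_Ico_eq_restrict_Ioc]
  simp

instance : Countable (latSub d) := (latEquiv d).symm.injective.countable

instance : VAddInvariantMeasure (latSub d) (Fin d → ℝ) volume :=
  ⟨fun c s _ => measure_preimage_add volume (c : Fin d → ℝ) s⟩

lemma lat_fund : IsAddFundamentalDomain (latSub d) (ZSpan.fundamentalDomain (Pi.basisFun ℝ (Fin d))) volume :=
  ZSpan.isAddFundamentalDomain _ _

lemma unfold_lint (g : (Fin d → ℝ) → ENNReal) :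
    ∫⁻ w, g w = ∑' m : Fin d → ℤ, ∫⁻ w, g (intv m + w) ∂(cubeAvg (Fin d) 0 1) := by
  rw [lat_fund.lintegral_eq_tsum'' g, cubeAvg_unit, ← (latEquiv d).tsum_eq]
  rfl

lemma unfold_int (g : (Fin d → ℝ) → ℂ) (hg : Integrable g) :
    ∫ w, g w = ∑' m : Fin d → ℤ, ∫ w, g (intv m + w) ∂(cubeAvg (Fin d) 0 1) := by
  rw [lat_fund.integral_eq_tsum'' g hg, cubeAvg_unit, ← (latEquiv d).tsum_eq]
  rfl

lemma cubeAvg_ac : cubeAvg (Fin d) 0 1 ≪ volume := by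
  rw [cubeAvg_unit]; exact Measure.absolutelyContinuous_restrict

lemma tile_int (g : (Fin d → ℝ) → ℝ) (hg : Integrable g) (c : ℝ) (hs : ∀ᵐ w, HasSum (fun m => g (w - intv m)) c)
    (ψ : (Fin d → ℝ) → ℂ) (hψ : Continuous ψ) (hb : ∀ w, ‖ψ w‖ ≤ 1) (hper : ∀ w m, ψ (intv m + w) = ψ w) :
    ∫ w, (g w : ℂ) * ψ w = c * ∫ w, ψ w ∂(cubeAvg (Fin d) 0 1) := by
  have hi : Integrable fun w => (g w : ℂ) * ψ w := by
    refine Integrable.mono' hg.norm (hg.ofReal.aestronglyMeasurable.mul hψ.aestronglyMeasurable) (Eventually.of_forall fun w => ?_)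
    rw [norm_mul, Complex.norm_real]
    exact mul_le_of_le_one_right (norm_nonneg _) (hb w)
  rw [unfold_int _ hi, ← integral_tsum]
  · rw [← integral_const_mul]
    refine integral_congr_ae ?_
    filter_upwards [cubeAvg_ac.ae_le hs] with w hw
    simp only [hper]
    rw [tsum_mul_right]
    congr 1
    have h2 : HasSum (fun m => g (intv m + w)) c := by
      rw [← (Equiv.neg (Fin d → ℤ)).hasSum_iff]
      convert hw using 2 with m
      simp only [Function.comp, Equiv.neg_apply]
      congr 1
      ext i; simp [intv]; ring
    have := (Complex.hasSum_ofReal.2 h2).tsum_eq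
    exact this
  · intro m
    have hq : Measure.QuasiMeasurePreserving (fun w : Fin d → ℝ => intv m + w) (cubeAvg (Fin d) 0 1) volume :=
      ((measurePreserving_add_left volume (intv m)).quasiMeasurePreserving).mono_left cubeAvg_ac
    exact hi.aestronglyMeasurable.comp_quasiMeasurePreserving hq
  · rw [← unfold_lint (fun w => ‖(g w : ℂ) * ψ w‖ₑ)]
    exact hi.2.ne

/-- coordinates adapted to the lattice -/
def coordA (A : Matrix (Fin d) (Fin d) ℝ) (w : Fin d → ℝ) : EuclideanSpace ℝ (Fin d) := WithLp.toLp 2 (A.mulVec w)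

lemma coordA_mp (A : Matrix (Fin d) (Fin d) ℝ) (hA : |A.det| = 1) : MeasurePreserving (coordA A) volume volume := by
  have hdet : A.det ≠ 0 := by intro h; rw [h] at hA; simp at hA
  have h1 : MeasurePreserving (Matrix.toLin' A) volume volume := by
    refine ⟨(LinearMap.continuous_of_finiteDimensional _).measurable, ?_⟩
    rw [Real.map_matrix_volume_pi_eq_smul_volume_pi hdet, abs_inv, hA]; simp
  exact (PiLp.volume_preserving_toLp (Fin d)).comp h1

lemma mulVec_inj (A : Matrix (Fin d) (Fin d) ℝ) (hA : |A.det| = 1) : Function.Injective A.mulVec := by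
  refine Matrix.mulVec_injective_of_isUnit ((Matrix.isUnit_iff_isUnit_det A).2 (isUnit_iff_ne_zero.2 ?_))
  intro h; rw [h] at hA; simp at hA

lemma coordA_emb (A : Matrix (Fin d) (Fin d) ℝ) (hA : |A.det| = 1) : MeasurableEmbedding (coordA A) := by
  refine Continuous.measurableEmbedding ?_ ?_
  · unfold coordA
    exact (PiLp.continuous_toLp 2 _).comp (by fun_prop)
  · intro a b h
    exact mulVec_inj A hA ((WithLp.toLp_injective 2) h)

def latEquivA (A : Matrix (Fin d) (Fin d) ℝ) (hA : |A.det| = 1) : (Fin d → ℤ) ≃ latticeOf A :=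
  Equiv.ofBijective (fun m => ⟨coordA A (intv m), ⟨m, rfl⟩⟩)
    ⟨fun a b h => intv_inj ((coordA_emb A hA).injective (Subtype.ext_iff.1 h)), fun v => by
      obtain ⟨m, hm⟩ := v.2
      exact ⟨m, Subtype.ext (WithLp.ofLp_injective 2 hm.symm)⟩⟩

lemma tiles_coord {f : EuclideanSpace ℝ (Fin d) → ℝ} {A : Matrix (Fin d) (Fin d) ℝ} (hA : |A.det| = 1) {c : ℝ}
    (h : TilesAt f (latticeOf A) c) : ∀ᵐ w, HasSum (fun m => f (coordA A (w - intv m))) c := by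
  have := (coordA_mp A hA).quasiMeasurePreserving.ae h
  filter_upwards [this] with w hw
  have h2 := hw.1.hasSum
  rw [hw.2, ← (latEquivA A hA).hasSum_iff] at h2
  convert h2 using 2 with m
  simp only [Function.comp]
  congr 1
  change WithLp.toLp 2 (A.mulVec (w - intv m)) = WithLp.toLp 2 (A.mulVec w) - WithLp.toLp 2 (A.mulVec (intv m))
  rw [Matrix.mulVec_sub, WithLp.toLp_sub]

lemma tiles_coord_int {f : EuclideanSpace ℝ (Fin d) → ℝ} (hf : Integrable f) {A : Matrix (Fin d) (Fin d) ℝ} (hA : |A.det| = 1) :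
    Integrable fun w => f (coordA A w) :=
  ((coordA_mp A hA).integrable_comp_emb (coordA_emb A hA)).2 hf

lemma dot_coord (A : Matrix (Fin d) (Fin d) ℝ) (w ξ : Fin d → ℝ) :
    ∑ k, (coordA A w) k * ξ k = ∑ k, w k * (A.transpose.mulVec ξ) k := by
  have := Matrix.dotProduct_mulVec ξ A w
  rw [Matrix.mulVec_transpose]
  simp only [dotProduct] at this
  calc ∑ k, (coordA A w) k * ξ k = ∑ k, ξ k * A.mulVec w k := Finset.sum_congr rfl fun k _ => mul_comm _ _
    _ = _ := this
    _ = _ := Finset.sum_congr rfl fun k _ => mul_comm _ _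

lemma tiles_level {f : EuclideanSpace ℝ (Fin d) → ℝ} (hf : Integrable f) {A : Matrix (Fin d) (Fin d) ℝ} (hA : |A.det| = 1) {c : ℝ}
    (h : TilesAt f (latticeOf A) c) : ∫ x, f x = c := by
  have := tile_int _ (tiles_coord_int hf hA) c (tiles_coord hA h) (fun _ => 1) continuous_const (by simp) (by simp)
  have p := cubeAvg_prob (Fin d) (a := 0) (b := 1) one_pos
  simp only [mul_one, integral_const, probReal_univ, one_smul] at this
  rw [integral_complex_ofReal, Complex.ofReal_inj, (coordA_mp A hA).integral_comp (coordA_emb A hA)] at this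
  exact this

lemma FT_zero {f : EuclideanSpace ℝ (Fin d) → ℝ} (hf : Integrable f) {A : Matrix (Fin d) (Fin d) ℝ} (hA : |A.det| = 1) {c : ℝ}
    (h : TilesAt f (latticeOf A) c) (a : EuclideanSpace ℝ (Fin d)) (ξ : Fin d → ℝ) (hξ : ξ ≠ 0) (k : Fin d → ℤ)
    (hk : A.transpose.mulVec ξ = intv k) : FT f a ξ = 0 := by
  have hk0 : k ≠ 0 := by
    rintro rfl
    apply hξ
    apply mulVec_inj A.transpose (by rwa [Matrix.det_transpose])
    rw [hk]; ext i; simp [intv]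
  set ψ : (Fin d → ℝ) → ℂ := fun w => UnitAddTorus.mFourier (-k) (tor w) with hψ
  have e0 : ∀ w, ψ w = Complex.exp (-(2 * Real.pi * Complex.I) * ((∑ j, w j * (k j : ℝ) : ℝ) : ℂ)) := by
    intro w
    have := mFourier_tor (1 : Matrix (Fin d) (Fin d) ℝ) (-k) w
    rw [Matrix.one_mulVec, Matrix.transpose_one, Matrix.one_mulVec, ← Complex.exp_sum] at this
    rw [hψ]; simp only; rw [this]
    congr 1
    push_cast
    rw [Finset.mul_sum]
    refine Finset.sum_congr rfl fun j _ => ?_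
    simp only [Pi.neg_apply]; push_cast; ring
  have h0 : ∫ w, ψ w ∂(cubeAvg (Fin d) 0 1) = 0 := torMean_mFourier (-k) (by simpa using hk0)
  have hper : ∀ w m, ψ (intv m + w) = ψ w := by
    intro w m
    have : tor (intv m + w) = tor w := by
      ext i
      simp only [tor, Pi.add_apply, intv]
      rw [AddCircle.coe_add]
      have : (((m i : ℤ) : ℝ) : UnitAddCircle) = 0 := by
        rw [AddCircle.coe_eq_zero_iff]; exact ⟨m i, by simp⟩
      rw [this, zero_add]
    rw [hψ]; simp only [this]
  have h1 := tile_int _ (tiles_coord_int hf hA) c (tiles_coord hA h) ψ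
    ((ContinuousMap.continuous _).comp continuous_tor) (fun w => by
      rw [e0, Complex.norm_exp]; simp) hper
  rw [h0, mul_zero] at h1
  have e1 : FT f a ξ = Complex.exp (2 * Real.pi * Complex.I * ((∑ k, a k * ξ k : ℝ) : ℂ)) *
      ∫ x, (f x : ℂ) * Complex.exp (-(2 * Real.pi * Complex.I) * ((∑ k, x k * ξ k : ℝ) : ℂ)) := by
    rw [← integral_const_mul, FT]
    congr 1; ext x
    rw [mul_left_comm, ← Complex.exp_add, phase]
    congr 2
    simp only [sub_mul, Finset.sum_sub_distrib]
    push_cast; ring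
  rw [e1, ← (coordA_mp A hA).integral_comp (coordA_emb A hA)]
  have e2 : ∀ w, Complex.exp (-(2 * Real.pi * Complex.I) * ((∑ j, (coordA A w) j * ξ j : ℝ) : ℂ)) = ψ w := by
    intro w
    rw [e0, dot_coord, hk]; rfl
  simp only [e2]
  rw [h1, mul_zero]

lemma min_dist {f : EuclideanSpace ℝ (Fin d) → ℝ} (hf : Integrable f) {A : Matrix (Fin d) (Fin d) ℝ} (hA : |A.det| = 1) {c : ℝ}
    (h : TilesAt f (latticeOf A) c) (hc : (∫ x, f x) ≠ 0) {a : EuclideanSpace ℝ (Fin d)} {D : ℝ}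
    (hD : ∀ᵐ x, f x ≠ 0 → ‖x - a‖ ≤ D) (r : ℝ) (hr0 : 0 ≤ r) (hr : d * (D * r) < 1/2)
    (v : Fin d → ℝ) (hv : ∀ k, |v k| ≤ r) (k : Fin d → ℤ) (hk : A.transpose.mulVec v = intv k) : v = 0 := by
  by_contra hv0
  have hk0 : intv k ≠ 0 := by
    intro h0
    apply hv0
    apply mulVec_inj A.transpose (by rwa [Matrix.det_transpose])
    rw [hk, h0]; simp
  rw [tiles_level hf hA h] at hc
  set κ := d * (D * r) with hκ
  set α := ∑ j, a j * v j with hα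
  have h1 : ∀ᵐ w, f (coordA A w) ≠ 0 → |∑ j, w j * (k j : ℝ) - α| ≤ κ := by
    filter_upwards [(coordA_mp A hA).quasiMeasurePreserving.ae hD] with w hw hne
    have h2 := sum_bound a (coordA A w) v r hv
    have h3 : ∑ j, ((coordA A w) j - a j) * v j = ∑ j, w j * (k j : ℝ) - α := by
      simp only [sub_mul, Finset.sum_sub_distrib]
      rw [dot_coord, hk]; rfl
    rw [h3] at h2
    refine h2.trans ?_
    have := hw hne
    rw [hκ]; gcongr
  have h2 : ∀ᵐ w, ∀ m : Fin d → ℤ, f (coordA A (w - intv m)) ≠ 0 → |∑ j, (w - intv m) j * (k j : ℝ) - α| ≤ κ := by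
    rw [ae_all_iff]
    intro m
    exact (measurePreserving_sub_right volume (intv m)).quasiMeasurePreserving.ae h1
  set U : Set (Fin d → ℝ) := {w | |∑ j, w j * (k j : ℝ) - α - 1/2| < 1/2 - κ} with hU
  have hUo : IsOpen U := isOpen_lt (by fun_prop) continuous_const
  have hq : 0 < ∑ j, (k j : ℝ)^2 := by
    obtain ⟨j, hj⟩ := Function.ne_iff.1 hk0
    refine Finset.sum_pos' (fun _ _ => sq_nonneg _) ⟨j, Finset.mem_univ _, ?_⟩
    have : (k j : ℝ) ≠ 0 := hj
    positivity
  have hUne : U.Nonempty := by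
    refine ⟨fun j => (α + 1/2) / (∑ j, (k j : ℝ)^2) * k j, ?_⟩
    have : ∑ j, (α + 1/2) / (∑ j, (k j : ℝ)^2) * (k j : ℝ) * (k j : ℝ) = α + 1/2 := by
      simp only [mul_assoc, ← sq]
      rw [← Finset.mul_sum]; field_simp
    simp only [hU]
    change |_ - α - 1/2| < 1/2 - κ
    rw [this]
    simp; linarith
  have hUpos : 0 < volume U := hUo.measure_pos volume hUne
  obtain ⟨w, hwU, hw1, hw2⟩ : ∃ w ∈ U, HasSum (fun m => f (coordA A (w - intv m))) c ∧
      ∀ m : Fin d → ℤ, f (coordA A (w - intv m)) ≠ 0 → |∑ j, (w - intv m) j * (k j : ℝ) - α| ≤ κ := by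
    by_contra! hcon
    have : ∀ᵐ w, w ∉ U := by
      filter_upwards [tiles_coord hA h, h2] with w g1 g2 hwU
      obtain ⟨m, g3, g4⟩ := hcon w hwU g1
      exact absurd (g2 m g3) (not_le.2 g4)
    have h3 : volume U = 0 := by
      rw [ae_iff] at this; simpa using this
    exact hUpos.ne' h3
  have hz : ∀ m : Fin d → ℤ, f (coordA A (w - intv m)) = 0 := by
    intro m
    by_contra hne
    have h3 := hw2 m hne
    have h4 : ∑ j, (w - intv m) j * (k j : ℝ) = ∑ j, w j * (k j : ℝ) - ((∑ j, m j * k j : ℤ) : ℝ) := by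
      simp only [Pi.sub_apply, intv, sub_mul, Finset.sum_sub_distrib]; push_cast; rfl
    rw [h4] at h3
    have h5 : |∑ j, w j * (k j : ℝ) - α - 1/2| < 1/2 - κ := hwU
    generalize (∑ j, m j * k j : ℤ) = i at h3
    rw [abs_le] at h3
    rw [abs_lt] at h5
    have a1 : (0:ℝ) < i := by linarith
    have a2 : (i:ℝ) < 1 := by linarith
    have b1 : 0 < i := by exact_mod_cast a1
    have b2 : i < 1 := by exact_mod_cast a2
    omega
  simp only [hz] at hw1
  exact hc (hw1.unique hasSum_zero)
end

section
open Filter Topology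
variable {d : ℕ}

lemma tor_int_add (m : Fin d → ℤ) (w : Fin d → ℝ) : tor (intv m + w) = tor w := by
  ext i
  simp only [tor, Pi.add_apply, intv]
  rw [AddCircle.coe_add]
  have : (((m i : ℤ) : ℝ) : UnitAddCircle) = 0 := by
    rw [AddCircle.coe_eq_zero_iff]; exact ⟨m i, by simp⟩
  rw [this, zero_add]

lemma tor_eq {v w : Fin d → ℝ} (h : tor v = tor w) : ∃ m : Fin d → ℤ, v = intv m + w := by
  have : ∀ i, ∃ m : ℤ, v i = m + w i := by
    intro i
    have h1 : ((v i : ℝ) : UnitAddCircle) = (w i : ℝ) := congrFun h i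
    rw [← sub_eq_zero, ← AddCircle.coe_sub, AddCircle.coe_eq_zero_iff] at h1
    obtain ⟨n, hn⟩ := h1
    refine ⟨n, ?_⟩
    simp at hn
    linarith
  choose m hm using this
  exact ⟨m, funext hm⟩

lemma isOpenMap_tor : IsOpenMap (tor : (Fin d → ℝ) → UnitAddTorus (Fin d)) := by
  have h : IsOpenMap (Pi.map (fun (_ : Fin d) (x : ℝ) => (x : UnitAddCircle))) :=
    IsOpenMap.piMap (fun _ => QuotientAddGroup.isOpenMap_coe) (by simp)
  exact h

lemma bump (A : Matrix (Fin d) (Fin d) ℝ) (hA : |A.det| = 1) (r : ℝ) (hr : 0 < r)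
    (hmd : ∀ (v : Fin d → ℝ), (∀ k, |v k| ≤ r) → ∀ k : Fin d → ℤ, A.transpose.mulVec v = intv k → v = 0) :
    ∃ h : C(UnitAddTorus (Fin d), ℝ), (∀ x, 0 ≤ h x ∧ h x ≤ 1) ∧
      (∀ ξ, h (tor (A.transpose.mulVec ξ)) ≠ 0 → ∃ l : Fin d → ℝ, (∃ k : Fin d → ℤ, A.transpose.mulVec l = intv k) ∧ ‖ξ - l‖ < r) ∧
      r ^ d ≤ torMeanR h := by
  set B := A.transpose with hB
  have hBd : |B.det| = 1 := by rw [hB, Matrix.det_transpose]; exact hA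
  have hdet : B.det ≠ 0 := by intro h; rw [h] at hBd; simp at hBd
  have hBc : Continuous (B.mulVec) := by fun_prop
  have hinj := mulVec_inj B hBd
  have hsurj : Function.Surjective (Matrix.toLin' B) :=
    LinearMap.surjective_of_injective (f := Matrix.toLin' B) hinj
  have hopen : IsOpenMap (Matrix.toLin' B) := LinearMap.isOpenMap_of_finiteDimensional _ hsurj
  set U : Set (UnitAddTorus (Fin d)) := tor '' (B.mulVec '' Metric.ball 0 r) with hU
  set K : Set (UnitAddTorus (Fin d)) := tor '' (B.mulVec '' Metric.closedBall 0 (r/2)) with hK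
  have hUo : IsOpen U := isOpenMap_tor _ (hopen _ Metric.isOpen_ball)
  have hKc : IsCompact K := ((isCompact_closedBall 0 (r/2)).image hBc).image continuous_tor
  have hdis : Disjoint Uᶜ K := by
    rw [Set.disjoint_compl_left_iff_subset]
    exact Set.image_mono (Set.image_mono (Metric.closedBall_subset_ball (by linarith)))
  obtain ⟨h, h0, h1, h01⟩ := exists_continuous_zero_one_of_isClosed hUo.isClosed_compl hKc.isClosed hdis
  refine ⟨h, h01, ?_, ?_⟩
  · intro ξ hξ
    have hx : tor (B.mulVec ξ) ∈ U := by
      by_contra hc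
      exact hξ (h0 hc)
    obtain ⟨_, ⟨b, hb, rfl⟩, hbe⟩ := hx
    obtain ⟨m, hm⟩ := tor_eq hbe.symm
    refine ⟨ξ - b, ⟨m, ?_⟩, ?_⟩
    · rw [Matrix.mulVec_sub, hm]; simp
    · simpa using hb
  · set S : Set (Fin d → ℝ) := B.mulVec '' Metric.ball 0 (r/2) with hS
    have hSo : IsOpen S := hopen _ Metric.isOpen_ball
    have hmp : MeasurePreserving (Matrix.toLin' B) volume volume := by
      refine ⟨(LinearMap.continuous_of_finiteDimensional _).measurable, ?_⟩
      rw [Real.map_matrix_volume_pi_eq_smul_volume_pi hdet, abs_inv, hBd]; simp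
    have hvol : volume S = ENNReal.ofReal (r ^ d) := by
      rw [← hmp.measure_preimage hSo.measurableSet.nullMeasurableSet]
      have : (Matrix.toLin' B) ⁻¹' S = Metric.ball 0 (r/2) := Set.preimage_image_eq _ hinj
      rw [this, Real.volume_pi_ball _ (by linarith), mul_div_cancel₀ r (two_ne_zero)]
      simp
    have key : ENNReal.ofReal (r ^ d) ≤ ∫⁻ w, ENNReal.ofReal (h (tor w)) ∂(cubeAvg (Fin d) 0 1) := by
      rw [← hvol, ← lintegral_indicator_one hSo.measurableSet, unfold_lint, ← lintegral_tsum]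
      · refine lintegral_mono fun w => ?_
        by_cases hex : ∃ m, intv m + w ∈ S
        · obtain ⟨m, hm⟩ := hex
          have huniq : ∀ m' ≠ m, S.indicator (1 : (Fin d → ℝ) → ENNReal) (intv m' + w) = 0 := by
            intro m' hne
            refine Set.indicator_of_notMem (fun hm' => hne ?_) _
            obtain ⟨b, hb, hbe⟩ := hm
            obtain ⟨b', hb', hbe'⟩ := hm'
            have hz : b' - b = 0 := by
              refine hmd _ ?_ (m' - m) ?_
              · intro k
                have h3 : ‖b' - b‖ ≤ r := by
                  rw [mem_ball_zero_iff] at hb hb'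
                  linarith [norm_sub_le b' b]
                exact (norm_le_pi_norm (b' - b) k).trans h3
              · rw [Matrix.mulVec_sub, hbe, hbe']
                ext i; simp [intv]
            rw [sub_eq_zero] at hz
            subst hz
            apply intv_inj
            exact add_right_cancel (hbe'.symm.trans hbe)
          simp only
          rw [tsum_eq_single m huniq, Set.indicator_of_mem hm]
          have : h (tor w) = 1 := by
            rw [← tor_int_add m w]
            exact h1 ⟨_, Set.image_mono Metric.ball_subset_closedBall hm, rfl⟩
          rw [this]; simp
        · push Not at hex
          simp only
          rw [ENNReal.tsum_eq_zero.2 fun m => Set.indicator_of_notMem (hex m) _]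
          exact zero_le
      · intro m
        exact ((measurable_one.indicator hSo.measurableSet).comp (measurable_const_add _)).aemeasurable
    have : torMeanR h = (∫⁻ w, ENNReal.ofReal (h (tor w)) ∂(cubeAvg (Fin d) 0 1)).toReal := by
      rw [torMeanR, integral_eq_lintegral_of_nonneg_ae]
      · exact Eventually.of_forall fun w => (h01 _).1
      · exact (h.continuous.comp continuous_tor).aestronglyMeasurable
    rw [this]
    have p := cubeAvg_prob (Fin d) (a := 0) (b := 1) one_pos
    rw [← ENNReal.ofReal_le_iff_le_toReal]
    · exact key
    · refine ne_of_lt (lt_of_le_of_lt (lintegral_mono (g := fun _ => 1) fun w => ?_) (by simp))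
      simpa using (h01 (tor w)).2
end

section
open Filter Topology
variable {d : ℕ}

lemma Kcst_ge (hd : 1 ≤ d) : 1 ≤ Kcst d := by
  have hd' : (1:ℝ) ≤ d := by exact_mod_cast hd
  have h4 : (1:ℝ) ≤ 4096 ^ d := one_le_pow₀ (by norm_num)
  have hp := Real.pi_gt_three
  have : Kcst d = 2 * Real.pi * d * (16 * 4096 ^ d) := by
    unfold Kcst bcst; field_simp
  rw [this]
  have : (1:ℝ) ≤ 2 * Real.pi * d := by nlinarith
  nlinarith

lemma C3_ge (hd : 1 ≤ d) : 1 ≤ C3 d := by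
  unfold C3
  have : 0 < 8 * d * (40 * d^2)^d := by positivity
  exact this

lemma kap_pos' (hd : 1 ≤ d) : 0 < kap d := by
  have h1 := Kcst_ge hd
  have h2 : (1:ℝ) ≤ C3 d := by exact_mod_cast C3_ge hd
  have hd' : (1:ℝ) ≤ d := by exact_mod_cast hd
  unfold kap; positivity

lemma d_kap (hd : 1 ≤ d) : d * kap d < 1/2 := by
  have h1 := Kcst_ge hd
  have h2 : (1:ℝ) ≤ C3 d := by exact_mod_cast C3_ge hd
  have hd' : (1:ℝ) ≤ d := by exact_mod_cast hd
  have h3 : (1:ℝ) ≤ (d:ℝ)^3 := one_le_pow₀ hd'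
  unfold kap
  rw [mul_one_div, div_lt_iff₀ (by positivity)]
  have h5 : (1:ℝ) ≤ C3 d * Kcst d := by nlinarith
  have h4 : (d:ℝ) ≤ d^4 := by nlinarith
  nlinarith [mul_le_mul h4 h5 (by norm_num) (by positivity)]

lemma essSupp_ae (f : EuclideanSpace ℝ (Fin d) → ℝ) : ∀ᵐ x, x ∉ essSupp f → f x = 0 := by
  set 𝒮 := {U : Set (EuclideanSpace ℝ (Fin d)) | IsOpen U ∧ ∀ᵐ x, x ∈ U → f x = 0} with hS
  obtain ⟨T, hTc, hTS, hTe⟩ := TopologicalSpace.isOpen_sUnion_countable 𝒮 (fun U hU => hU.1)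
  have h1 : ∀ᵐ x, ∀ U ∈ T, x ∈ U → f x = 0 := (ae_ball_iff hTc).2 fun U hU => (hTS hU).2
  filter_upwards [h1] with x hx hxs
  have : x ∈ ⋃₀ 𝒮 := by
    simp only [essSupp, Set.mem_sInter, not_forall] at hxs
    obtain ⟨S, ⟨hS1, hS2⟩, hxS⟩ := hxs
    exact ⟨Sᶜ, ⟨hS1.isOpen_compl, hS2⟩, hxS⟩
  rw [← hTe] at this
  obtain ⟨U, hU, hxU⟩ := this
  exact hx U hU hxU

lemma final_core (hd : 1 ≤ d) (N : ℕ) (hN : 0 < N) (A : Fin N → Matrix (Fin d) (Fin d) ℝ)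
    (f : EuclideanSpace ℝ (Fin d) → ℝ) (hA : ∀ i, |(A i).det| = 1)
    (hL : ∀ i j, i ≠ j → latticeOf (A i) ∩ latticeOf (A j) = {0})
    (hf : Integrable f) (hc : (∫ x, f x) ≠ 0) (ht : ∀ i, ∃ c : ℝ, TilesAt f (latticeOf (A i)) c)
    (a : EuclideanSpace ℝ (Fin d)) (D : ℝ) (hD0 : 0 < D) (hD : ∀ᵐ x, f x ≠ 0 → ‖x - a‖ ≤ D)
    (hDN : 8 * D ^ d ≤ N * (kap d) ^ d * (Kcst d * kap d) ^ d) : False := by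
  have hκ := kap_pos' hd
  have hK := Kcst_ge hd
  set r := kap d / D with hr
  have hr0 : 0 < r := by positivity
  have hdr : d * (D * r) < 1/2 := by
    rw [hr, mul_div_cancel₀ _ hD0.ne']; exact d_kap hd
  choose c hcT using ht
  have hb := fun i => bump (A i) (hA i) r hr0 (fun v hv k hk => min_dist hf (hA i) (hcT i) hc hD r hr0.le hdr v hv k hk)
  choose h h01 hsup hmean using hb
  have hsum : N * r ^ d ≤ ∑ i, torMeanR (h i) := by
    calc (N:ℝ) * r ^ d = ∑ i : Fin N, r ^ d := by simp
      _ ≤ _ := Finset.sum_le_sum fun i _ => hmean i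
  have hN' : (0:ℝ) < N := by exact_mod_cast hN
  have hNr : 0 < N * r ^ d := by positivity
  have h1 : ∀ i, ∀ m : Fin d → ℤ, (A i).mulVec (fun k => (m k : ℝ)) = 0 → m = 0 := by
    intro i m hm
    have : intv m = 0 := mulVec_inj (A i) (hA i) (by rw [Matrix.mulVec_zero]; exact hm)
    ext k
    have := congrFun this k
    simpa [intv] using this
  have h2 : ∀ i j, i ≠ j → ∀ m m' : Fin d → ℤ,
      (A i).mulVec (fun k => (m k : ℝ)) + (A j).mulVec (fun k => (m' k : ℝ)) = 0 → m = 0 ∧ m' = 0 := by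
    intro i j hij m m' hm
    have hmem : WithLp.toLp 2 ((A i).mulVec (fun k => (m k : ℝ))) ∈ latticeOf (A i) ∩ latticeOf (A j) := by
      refine ⟨⟨m, rfl⟩, ⟨-m', ?_⟩⟩
      have e : (fun k => (((-m') k : ℤ) : ℝ)) = -(fun k => (m' k : ℝ)) := by ext k; simp
      rw [e, Matrix.mulVec_neg]
      exact eq_neg_of_add_eq_zero_left hm
    rw [hL i j hij, Set.mem_singleton_iff] at hmem
    have hz : (A i).mulVec (fun k => (m k : ℝ)) = 0 := congrArg WithLp.ofLp hmem
    rw [hz, zero_add] at hm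
    exact ⟨h1 i m hz, h1 j m' hm⟩
  have hsm := second_moment A h1 h2 h h01 (hNr.trans_le hsum)
  rw [eventually_atTop] at hsm
  obtain ⟨T0, hT0⟩ := hsm
  obtain ⟨m0, hE⟩ := E_main hd hf hD hD0 hc
  obtain ⟨t, ht⟩ := exists_nat_ge (max 1 (max (m0:ℝ) (T0 * (Kcst d * D))))
  have ht1 : 1 ≤ t := by exact_mod_cast (le_max_left _ _).trans ht
  have htm : m0 ≤ t := by exact_mod_cast ((le_max_left _ _).trans (le_max_right _ _)).trans ht
  have htT : T0 * (Kcst d * D) ≤ t := ((le_max_right _ _).trans (le_max_right _ _)).trans ht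
  have hC := C3_ge hd
  set m := C3 d * t with hm
  have hmt : t ≤ m := Nat.le_mul_of_pos_left t hC
  set T : ℝ := m / (Kcst d * D) with hT
  have hTT : T0 ≤ T := by
    rw [hT, le_div_iff₀ (by positivity)]
    exact htT.trans (by exact_mod_cast hmt)
  have hmeas := (hT0 T hTT).trans (div_le_div_of_nonneg_left (by norm_num) hNr hsum)
  obtain ⟨B, hBc, hB⟩ := count_core hd N hN D hD0 {ξ | ∃ i, ∃ k : Fin d → ℤ, (A i).transpose.mulVec ξ = intv k}
    {ξ | ∀ i, h i (tor ((A i).transpose.mulVec ξ)) = 0} t m (40 * d^2 * m) ht1 hm rfl T r hT hr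
    (fun ξ hξ => by
      simp only [Set.mem_ofPred_eq, not_forall] at hξ
      obtain ⟨i, hi⟩ := hξ
      obtain ⟨l, ⟨k, hk⟩, hl⟩ := hsup i ξ hi
      exact ⟨l, ⟨i, k, hk⟩, hl⟩) hmeas hDN
  refine hE m (htm.trans hmt) (ht1.trans hmt) _ le_rfl B hBc fun J hJ => ?_
  obtain ⟨z, hz, ⟨i, k, hk⟩, hne⟩ := hB J hJ
  exact ⟨z, hz, FT_zero hf (hA i) (hcT i) a _ hne k hk⟩
end

/-- For every `d ≥ 1` there is `C_d > 0` such that if `Λ₁, …, Λ_N ⊆ ℝ^d`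
are lattices of volume 1 with `Λᵢ ∩ Λⱼ = {0}` for `i ≠ j`, and `f ∈ L¹(ℝ^d)` with
`∫ f ≠ 0` tiles with every `Λᵢ`, then `diam (supp f) ≥ C_d · N^{1/d}`. -/
theorem diam_lower_bound_generic_lattices (d : ℕ) (hd : 1 ≤ d) :
    ∃ C : ℝ, 0 < C ∧
      ∀ (N : ℕ) (A : Fin N → Matrix (Fin d) (Fin d) ℝ)
        (f : EuclideanSpace ℝ (Fin d) → ℝ),
        (∀ i, |(A i).det| = 1) →
        (∀ i j, i ≠ j → latticeOf (A i) ∩ latticeOf (A j) = {0}) →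
        Integrable f →
        (∫ x, f x) ≠ 0 →
        (∀ i, ∃ c : ℝ, TilesAt f (latticeOf (A i)) c) →
        ENNReal.ofReal (C * (N : ℝ) ^ ((1 : ℝ) / d)) ≤ EMetric.diam (essSupp f) := by
  have hκ := kap_pos' hd
  have hK := Kcst_ge hd
  have hd0 : (d:ℝ) ≠ 0 := by positivity
  have hdn : d ≠ 0 := by omega
  have hpos : 0 < kap d * (Kcst d * kap d) / 8 := by positivity
  refine ⟨kap d * (Kcst d * kap d) / 8, hpos, ?_⟩
  intro N A f hA hL hf hc ht
  rcases Nat.eq_zero_or_pos N with rfl | hN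
  · rw [Nat.cast_zero, Real.zero_rpow (by positivity)]
    simp
  by_contra hlt
  rw [not_le] at hlt
  have hN' : (0:ℝ) < N := by exact_mod_cast hN
  set D := kap d * (Kcst d * kap d) / 8 * (N : ℝ) ^ ((1 : ℝ) / d) with hDdef
  have hD0 : 0 < D := by positivity
  have hae := essSupp_ae f
  have hne : (essSupp f).Nonempty := by
    by_contra he
    rw [Set.not_nonempty_iff_eq_empty] at he
    apply hc
    apply integral_eq_zero_of_ae
    filter_upwards [hae] with x hx
    exact hx (by simp [he])
  obtain ⟨a, ha⟩ := hne
  refine final_core hd N hN A f hA hL hf hc ht a D hD0 ?_ ?_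
  · filter_upwards [hae] with x hx hfx
    have hxs : x ∈ essSupp f := by
      by_contra h'; exact hfx (hx h')
    have h3 : edist x a ≤ ENNReal.ofReal D := (Metric.edist_le_ediam_of_mem hxs ha).trans hlt.le
    rw [edist_dist, ENNReal.ofReal_le_ofReal_iff hD0.le, dist_eq_norm] at h3
    exact h3
  · rw [hDdef, mul_pow, ← Real.rpow_natCast ((N:ℝ) ^ ((1:ℝ)/d)), ← Real.rpow_mul hN'.le, one_div_mul_cancel hd0, Real.rpow_one,
      div_pow, mul_pow]
    have h8 : (8:ℝ) ≤ 8 ^ d := le_self_pow₀ (by norm_num) hdn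
    have hX : 0 ≤ kap d ^ d * (Kcst d * kap d) ^ d * N := by positivity
    calc 8 * (kap d ^ d * (Kcst d * kap d) ^ d / 8 ^ d * N) = (8 / 8 ^ d) * (kap d ^ d * (Kcst d * kap d) ^ d * N) := by ring
      _ ≤ 1 * (kap d ^ d * (Kcst d * kap d) ^ d * N) := by
        gcongr
        rw [div_le_one (by positivity)]; exact h8
      _ = _ := by ring

end
end

section
/- Let δ = 0.086071 (the Erdős–Tenenbaum–Ford constant). For every β with 0 < β < δ there exists N₀ such that for all N ≥ N₀ the following holds: there exist N lattices Λ₁, …, Λ_N ⊆ ℝ with 1/2 ≤ vol(Λ_j) ≤ 1 for all j (one may take Λ_j = (N/(N+j))·ℤ for j = 1, …, N) and a continuous function f : ℝ → ℂ with ∫ f ≠ 0 that tiles with every Λ_j and whose support is contained in an interval of length at most N/(log N)^β. -/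
open MeasureTheory
def TilesAt1 (f : ℝ → ℂ) (lam : ℝ) (c : ℂ) : Prop :=
  ∀ᵐ x : ℝ, (Summable fun n : ℤ => f (x - n * lam)) ∧ ∑' n : ℤ, f (x - n * lam) = c

/-! ### The tile -/

/-- The hat function. -/
noncomputable def hatF (x : ℝ) : ℝ := max 0 (1 - |x|)

lemma hatF_cont : Continuous hatF := by
  unfold hatF; fun_prop

lemma hatF_eq_zero {x : ℝ} (h : 1 ≤ |x|) : hatF x = 0 := by
  unfold hatF; exact max_eq_left (by linarith)

lemma hatF_compact : HasCompactSupport hatF := by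
  refine HasCompactSupport.intro (K := Set.Icc (-1) 1) isCompact_Icc ?_
  intro x hx
  apply hatF_eq_zero
  by_contra h
  push Not at h
  rw [abs_lt] at h
  exact hx ⟨h.1.le, h.2.le⟩

lemma hatF_integral_pos : 0 < ∫ x, hatF x := by
  refine hatF_cont.integral_pos_of_hasCompactSupport_nonneg_nonzero (x := 0) hatF_compact ?_ ?_
  · intro x; exact le_max_left _ _
  · simp [hatF]

lemma hatF_hasSum (u : ℝ) : HasSum (fun n : ℤ => hatF (u - n)) 1 := by
  have h : HasSum (fun n : ℤ => hatF (u - n)) (∑ n ∈ ({⌊u⌋, ⌊u⌋ + 1} : Finset ℤ), hatF (u - n)) := by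
    apply hasSum_sum_of_ne_finset_zero
    intro b hb
    simp only [Finset.mem_insert, Finset.mem_singleton, not_or] at hb
    apply hatF_eq_zero
    have h1 := Int.floor_le u
    have h2 := Int.lt_floor_add_one u
    rcases lt_or_gt_of_ne hb.1 with h | h
    · have : (b : ℝ) + 1 ≤ ⌊u⌋ := by exact_mod_cast h
      rw [le_abs]; left; linarith
    · have : ⌊u⌋ + 1 < b := lt_of_le_of_ne h (Ne.symm hb.2)
      have : (⌊u⌋ : ℝ) + 1 + 1 ≤ b := by exact_mod_cast this
      rw [le_abs]; right; linarith
  rw [Finset.sum_pair (by simp)] at h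
  convert h using 1
  have h1 := Int.floor_le u
  have h2 := Int.lt_floor_add_one u
  unfold hatF
  push_cast
  rw [abs_of_nonneg (by linarith), abs_of_nonpos (by linarith), max_eq_right (by linarith),
    max_eq_right (by linarith)]
  ring

lemma hatF_hasSum_block (M : ℕ) (hM : M ≠ 0) (u : ℝ) :
    HasSum (fun n : ℤ => ∑ i ∈ Finset.range M, hatF (u - n * M - i)) 1 := by
  have : NeZero M := ⟨hM⟩
  have h := hatF_hasSum u
  replace h := (Int.divModEquiv M).symm.hasSum_iff.mpr h
  refine h.prod_fiberwise fun k => ?_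
  rw [Finset.sum_range]
  convert hasSum_fintype _ using 2 with i
  simp only [Function.comp_def, Int.divModEquiv_symm_apply]
  push_cast
  ring_nf

/-- Piecewise linear interpolation of the coefficients of a polynomial. -/
noncomputable def polyTile (P : Polynomial ℂ) (u : ℝ) : ℂ :=
  P.sum fun k a => a * (hatF (u - k) : ℂ)

lemma polyTile_add (P Q : Polynomial ℂ) (u : ℝ) :
    polyTile (P + Q) u = polyTile P u + polyTile Q u := by
  unfold polyTile
  exact Polynomial.sum_add_index _ _ _ (by simp) (by intros; ring)

lemma polyTile_monomial (k : ℕ) (a : ℂ) (u : ℝ) :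
    polyTile (Polynomial.monomial k a) u = a * (hatF (u - k) : ℂ) := by
  unfold polyTile
  exact Polynomial.sum_monomial_index _ _ (by simp)

lemma polyTile_finset_sum {ι : Type*} (s : Finset ι) (P : ι → Polynomial ℂ) (u : ℝ) :
    polyTile (∑ i ∈ s, P i) u = ∑ i ∈ s, polyTile (P i) u := by
  classical
  induction s using Finset.induction with
  | empty => simp [polyTile]
  | insert a s ha ih => rw [Finset.sum_insert ha, Finset.sum_insert ha, polyTile_add, ih]

lemma polyTile_cont (P : Polynomial ℂ) : Continuous (polyTile P) := by
  unfold polyTile Polynomial.sum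
  have := hatF_cont
  fun_prop

lemma polyTile_integral (P : Polynomial ℂ) :
    ∫ u, polyTile P u = P.eval 1 * ((∫ u, hatF u : ℝ) : ℂ) := by
  unfold polyTile Polynomial.sum
  have hi : Integrable (fun u => (hatF u : ℂ)) :=
    (hatF_cont.integrable_of_hasCompactSupport hatF_compact).ofReal
  rw [integral_finsetSum]
  · rw [Polynomial.eval_eq_sum, Polynomial.sum, Finset.sum_mul]
    refine Finset.sum_congr rfl fun k _ => ?_
    rw [integral_const_mul, integral_sub_right_eq_self (fun u => (hatF u : ℂ)), integral_complex_ofReal]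
    simp
  · intro k _
    exact (hi.comp_sub_right (k : ℝ)).const_mul _

lemma polyTile_support (P : Polynomial ℂ) :
    Function.support (polyTile P) ⊆ Set.Icc (-1) (P.natDegree + 1) := by
  intro u hu
  unfold polyTile Polynomial.sum at hu
  obtain ⟨k, hk, hne⟩ := Finset.exists_ne_zero_of_sum_ne_zero hu
  have hk' : (k : ℝ) ≤ P.natDegree := by exact_mod_cast Polynomial.le_natDegree_of_mem_supp k hk
  have : |u - k| < 1 := by
    by_contra h
    push Not at h
    simp [hatF_eq_zero h] at hne
  rw [abs_lt] at this
  have hk0 : (0 : ℝ) ≤ k := Nat.cast_nonneg k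
  exact ⟨by linarith, by linarith⟩

lemma polyTile_tiles (R : Polynomial ℂ) (M : ℕ) (hM : M ≠ 0) :
    ∀ u : ℝ, HasSum (fun n : ℤ =>
      polyTile (R * ∑ i ∈ Finset.range M, Polynomial.X ^ i) (u - n * M)) (R.eval 1) := by
  induction R using Polynomial.induction_on' with
  | add p q hp hq =>
    intro u
    simp_rw [add_mul, polyTile_add, Polynomial.eval_add]
    exact (hp u).add (hq u)
  | monomial k a =>
    intro u
    have h := hatF_hasSum_block M hM (u - k)
    have h2 : HasSum (fun n : ℤ => ((∑ i ∈ Finset.range M, hatF (u - k - n * M - i) : ℝ) : ℂ))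
      ((1 : ℝ) : ℂ) := Complex.hasSum_ofReal.mpr h
    have h3 := h2.mul_left a
    have he : (fun n : ℤ => polyTile (Polynomial.monomial k a *
        ∑ i ∈ Finset.range M, Polynomial.X ^ i) (u - n * M)) =
        fun n : ℤ => a * ((∑ i ∈ Finset.range M, hatF (u - k - n * M - i) : ℝ) : ℂ) := by
      funext n
      rw [Finset.mul_sum, polyTile_finset_sum]
      push_cast
      rw [Finset.mul_sum]
      refine Finset.sum_congr rfl fun i _ => ?_
      rw [← Polynomial.monomial_one_right_eq_X_pow, Polynomial.monomial_mul_monomial,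
        polyTile_monomial]
      push_cast
      ring_nf
    have hv : (Polynomial.monomial k a).eval 1 = a * ((1 : ℝ) : ℂ) := by simp
    rw [he, hv]
    exact h3

open Classical in
/-- Integers in `(0, L]` with a divisor in `(N, 2 * N]`. -/
noncomputable def divSet (N L : ℕ) : Finset ℕ :=
  (Finset.Ioc 0 L).filter (fun n => ∃ d ∈ Finset.Ioc N (2 * N), d ∣ n)

lemma mem_divSet {N L n : ℕ} :
    n ∈ divSet N L ↔ (0 < n ∧ n ≤ L) ∧ ∃ d ∈ Finset.Ioc N (2 * N), d ∣ n := by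
  unfold divSet
  simp only [Finset.mem_filter, Finset.mem_Ioc]

lemma tile_exists (N L : ℕ) (hN : 0 < N) (hL : 0 < L) (hdiv : ∀ m ∈ Finset.Ioc N (2 * N), m ∣ L)
    (W : ℝ) (hW : (((divSet N L).card : ℝ) + 1) / L ≤ W) :
    ∃ f : ℝ → ℂ, Continuous f ∧ (∫ x, f x) ≠ 0 ∧
          (∀ j : ℕ, 1 ≤ j → j ≤ N → ∃ c : ℂ, TilesAt1 f ((N : ℝ) / (N + j)) c) ∧
          ∃ a : ℝ, Function.support f ⊆ Set.Icc a (a + N * W) := by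
  classical
  have hN' : (0 : ℝ) < N := by exact_mod_cast hN
  have hL' : (0 : ℝ) < L := by exact_mod_cast hL
  set B := divSet N L with hB
  set Z := (Polynomial.nthRootsFinset L (1 : ℂ)).filter
    (fun w => ∃ m ∈ Finset.Ioc N (2 * N), w ^ (L / m) = 1) with hZ
  have hζ := Complex.isPrimitiveRoot_exp L hL.ne'
  set ζ := Complex.exp (2 * Real.pi * Complex.I / L) with hζdef
  have hcard : Z.card ≤ B.card := by
    have : Z ⊆ B.image (fun b => ζ ^ b) := by
      intro w hw
      rw [hZ, Finset.mem_filter, Polynomial.mem_nthRootsFinset hL] at hw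
      obtain ⟨hw1, m, hm, hwm⟩ := hw
      have : NeZero L := ⟨hL.ne'⟩
      obtain ⟨b, hb, rfl⟩ := hζ.eq_pow_of_pow_eq_one hw1
      have hmb : m ∣ b := by
        rw [← pow_mul, hζ.pow_eq_one_iff_dvd] at hwm
        obtain ⟨t, ht⟩ := hdiv m hm
        have hm0 : 0 < m := by have := (Finset.mem_Ioc.mp hm).1; omega
        have ht0 : 0 < t := by
          rcases Nat.eq_zero_or_pos t with h | h
          · subst h; omega
          · exact h
        rw [ht, Nat.mul_div_cancel_left _ hm0] at hwm
        exact Nat.dvd_of_mul_dvd_mul_right ht0 hwm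
      rw [Finset.mem_image]
      rcases Nat.eq_zero_or_pos b with h0 | h0
      · refine ⟨L, ?_, ?_⟩
        · rw [hB, mem_divSet]
          exact ⟨⟨hL, le_rfl⟩, m, hm, hdiv m hm⟩
        · subst h0; simp [hζ.pow_eq_one]
      · refine ⟨b, ?_, rfl⟩
        rw [hB, mem_divSet]
        exact ⟨⟨h0, hb.le⟩, m, hm, hmb⟩
    exact (Finset.card_le_card this).trans Finset.card_image_le
  have h1Z : (1 : ℂ) ∈ Z := by
    rw [hZ, Finset.mem_filter, Polynomial.mem_nthRootsFinset hL]
    exact ⟨by simp, N + 1, by simp; omega, by simp⟩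
  set P : Polynomial ℂ := ∏ w ∈ Z.erase 1, (Polynomial.X - Polynomial.C w) with hP
  have hPZ : (Polynomial.X - 1) * P = ∏ w ∈ Z, (Polynomial.X - Polynomial.C w) := by
    rw [hP, ← Finset.mul_prod_erase Z _ h1Z]; simp
  have hPdeg : P.natDegree = Z.card - 1 := by
    rw [hP, Polynomial.natDegree_finsetProd_X_sub_C_eq_card, Finset.card_erase_of_mem h1Z]
  have hZpos : 0 < Z.card := Finset.card_pos.mpr ⟨1, h1Z⟩
  have hP1 : P.eval 1 ≠ 0 := by
    rw [hP, Polynomial.eval_prod, Finset.prod_ne_zero_iff]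
    intro w hw
    simp only [Polynomial.eval_sub, Polynomial.eval_X, Polynomial.eval_C]
    exact sub_ne_zero.mpr (Finset.ne_of_mem_erase hw).symm
  refine ⟨fun x => polyTile P (x / (N / L)), ?_, ?_, ?_, -(N / L), ?_⟩
  · exact (polyTile_cont P).comp (by fun_prop)
  · rw [Measure.integral_comp_div (polyTile P), polyTile_integral]
    have := hatF_integral_pos
    rw [abs_of_pos (by positivity), smul_ne_zero_iff]
    refine ⟨by positivity, mul_ne_zero hP1 ?_⟩
    exact_mod_cast this.ne'
  · intro j hj1 hjN
    set m := N + j with hm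
    have hmI : m ∈ Finset.Ioc N (2 * N) := by rw [Finset.mem_Ioc]; omega
    obtain ⟨M, hM⟩ := hdiv m hmI
    have hm0 : 0 < m := by omega
    have hM0 : M ≠ 0 := by rintro rfl; omega
    have hQ : (∑ i ∈ Finset.range M, (Polynomial.X : Polynomial ℂ) ^ i) ∣ P := by
      have h1 : (Polynomial.X ^ M - 1 : Polynomial ℂ) ∣ (Polynomial.X - 1) * P := by
        have : NeZero L := ⟨hL.ne'⟩
        have hprim : IsPrimitiveRoot (ζ ^ m) M := hζ.pow hL hM
        rw [Polynomial.X_pow_sub_one_eq_prod (Nat.pos_of_ne_zero hM0) hprim, hPZ]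
        apply Finset.prod_dvd_prod_of_subset
        intro w hw
        rw [Polynomial.mem_nthRootsFinset (Nat.pos_of_ne_zero hM0)] at hw
        rw [hZ, Finset.mem_filter, Polynomial.mem_nthRootsFinset hL]
        refine ⟨by rw [hM, mul_comm, pow_mul, hw, one_pow], m, hmI, ?_⟩
        rw [hM, Nat.mul_div_cancel_left _ hm0, hw]
      rw [← mul_geom_sum] at h1
      exact (mul_dvd_mul_iff_left (Polynomial.X_sub_C_ne_zero (1 : ℂ))).mp (by simpa using h1)
    obtain ⟨R, hR⟩ := hQ
    refine ⟨R.eval 1, Filter.Eventually.of_forall fun x => ?_⟩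
    have h := polyTile_tiles R M hM0 (x / (N / L))
    rw [mul_comm R, ← hR] at h
    have he : (fun n : ℤ => polyTile P ((x - n * ((N : ℝ) / (N + j))) / (N / L))) =
        fun n : ℤ => polyTile P (x / (N / L) - n * M) := by
      funext n
      congr 1
      have hLM : (L : ℝ) = (N + j) * M := by rw [hM, hm]; push_cast; ring
      have : (0 : ℝ) < N + j := by positivity
      have hM0' : (M : ℝ) ≠ 0 := by exact_mod_cast hM0
      rw [hLM]
      field_simp
    dsimp only
    rw [he]
    exact ⟨h.summable, h.tsum_eq⟩
  · intro x hx
    have hx' : x / (N / L) ∈ Function.support (polyTile P) := hx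
    have h := polyTile_support P hx'
    have hh : (0 : ℝ) < N / L := by positivity
    rw [Set.mem_Icc, le_div_iff₀ hh, div_le_iff₀ hh] at h
    refine ⟨by linarith [h.1], h.2.trans ?_⟩
    have hd : (P.natDegree : ℝ) + 1 ≤ B.card := by
      have : P.natDegree + 1 ≤ B.card := by omega
      exact_mod_cast this
    have h3 : ((P.natDegree : ℝ) + 1) * (N / L) ≤ B.card * (N / L) :=
      mul_le_mul_of_nonneg_right hd hh.le
    have h4 : (N : ℝ) * (((B.card : ℝ) + 1) / L) ≤ N * W := mul_le_mul_of_nonneg_left hW hN'.le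
    have h5 : (N : ℝ) * (((B.card : ℝ) + 1) / L) = B.card * (N / L) + N / L := by field_simp
    linarith
/-! ### Mertens-type bounds -/

/-- Sum of reciprocals of primes up to `x`. -/
noncomputable def primeRec (x : ℕ) : ℝ := ∑ p ∈ Nat.primesLE x, (1 : ℝ) / p

/-- Chebyshev constant. -/
noncomputable def chebC : ℝ := Real.log 4 + 4

lemma chebC_pos : 0 < chebC := by
  unfold chebC
  have := Real.log_pos (show (1 : ℝ) < 4 by norm_num)
  linarith

lemma psi_sum_le (x : ℝ) (n : ℕ) (hn : (n : ℝ) ≤ x) :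
    ∑ q ∈ Finset.Ioc 0 n, ArithmeticFunction.vonMangoldt q ≤ chebC * x := by
  have h := Chebyshev.psi_le_const_mul_self (x := (n : ℝ)) (by positivity)
  unfold Chebyshev.psi at h
  rw [Nat.floor_natCast] at h
  refine h.trans ?_
  exact mul_le_mul_of_nonneg_left hn chebC_pos.le

lemma sum_log_eq (n : ℕ) : ∑ m ∈ Finset.Ioc 0 n, Real.log m =
    ∑ q ∈ Finset.Ioc 0 n, ArithmeticFunction.vonMangoldt q * ((n / q : ℕ) : ℝ) := by
  rw [← ArithmeticFunction.sum_Ioc_mul_zeta_eq_sum, ArithmeticFunction.vonMangoldt_mul_zeta]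
  rfl

lemma sum_vonMangoldt_div_le (n : ℕ) (hn : 1 ≤ n) :
    ∑ q ∈ Finset.Ioc 0 n, ArithmeticFunction.vonMangoldt q / q ≤ Real.log n + chebC := by
  have hn' : (0 : ℝ) < n := by exact_mod_cast hn
  have h1 : (n : ℝ) * ∑ q ∈ Finset.Ioc 0 n, ArithmeticFunction.vonMangoldt q / q ≤
      n * (Real.log n + chebC) := by
    calc (n : ℝ) * ∑ q ∈ Finset.Ioc 0 n, ArithmeticFunction.vonMangoldt q / q
        = ∑ q ∈ Finset.Ioc 0 n, ArithmeticFunction.vonMangoldt q * ((n : ℝ) / q) := by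
          rw [Finset.mul_sum]; refine Finset.sum_congr rfl fun q _ => by ring
      _ ≤ ∑ q ∈ Finset.Ioc 0 n, ArithmeticFunction.vonMangoldt q * (((n / q : ℕ) : ℝ) + 1) := by
          refine Finset.sum_le_sum fun q hq => ?_
          refine mul_le_mul_of_nonneg_left ?_ ArithmeticFunction.vonMangoldt_nonneg
          rw [← Nat.floor_div_eq_div (K := ℝ)]
          exact (Nat.lt_floor_add_one _).le
      _ = (∑ m ∈ Finset.Ioc 0 n, Real.log m) +
            ∑ q ∈ Finset.Ioc 0 n, ArithmeticFunction.vonMangoldt q := by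
          rw [sum_log_eq, ← Finset.sum_add_distrib]
          refine Finset.sum_congr rfl fun q _ => by ring
      _ ≤ n * Real.log n + chebC * n := by
          refine add_le_add ?_ (psi_sum_le n n le_rfl)
          calc _ ≤ ∑ m ∈ Finset.Ioc 0 n, Real.log n := by
                refine Finset.sum_le_sum fun m hm => ?_
                rw [Finset.mem_Ioc] at hm
                exact Real.log_le_log (by exact_mod_cast hm.1) (by exact_mod_cast hm.2)
            _ = _ := by simp
      _ = _ := by ring
  exact le_of_mul_le_mul_left h1 hn'

lemma mertens_aux (n : ℕ) (hn : 2 ≤ n) :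
    ∑ q ∈ Finset.Ioc 0 n, ArithmeticFunction.vonMangoldt q / (q * Real.log q) ≤
      (∑ q ∈ Finset.Ioc 0 n, ArithmeticFunction.vonMangoldt q / q) / Real.log n
      + (Real.log (Real.log n) - Real.log (Real.log 2))
      + chebC * (1 / Real.log 2 - 1 / Real.log n) := by
  induction n, hn using Nat.le_induction with
  | base =>
    have : Finset.Ioc 0 2 = {1, 2} := by decide
    rw [this, Finset.sum_pair (by norm_num), Finset.sum_pair (by norm_num)]
    simp only [ArithmeticFunction.vonMangoldt_apply_one]
    simp [div_div]
  | succ n hn ih =>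
    have hA := sum_vonMangoldt_div_le n (by omega)
    rw [← Finset.insert_Ioc_right_eq_Ioc_add_one (by omega), Finset.sum_insert (by simp), Finset.sum_insert (by simp)]
    set A := ∑ q ∈ Finset.Ioc 0 n, ArithmeticFunction.vonMangoldt q / q with hAdef
    set F := ∑ q ∈ Finset.Ioc 0 n, ArithmeticFunction.vonMangoldt q / (q * Real.log q)
    have hn2 : (2 : ℝ) ≤ n := by exact_mod_cast hn
    have hl1 : 0 < Real.log n := Real.log_pos (by linarith)
    have hlt : Real.log n < Real.log ((n + 1 : ℕ) : ℝ) :=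
      Real.log_lt_log (by linarith) (by push_cast; linarith)
    have hl2 : 0 < Real.log ((n + 1 : ℕ) : ℝ) := hl1.trans hlt
    set a := Real.log n
    set b := Real.log ((n + 1 : ℕ) : ℝ)
    have hab : 0 ≤ 1 / a - 1 / b := sub_nonneg.mpr (one_div_le_one_div_of_le hl1 hlt.le)
    have h1 : A * (1 / a - 1 / b) ≤ (a + chebC) * (1 / a - 1 / b) :=
      mul_le_mul_of_nonneg_right hA hab
    have h2 : a * (1 / a - 1 / b) ≤ Real.log b - Real.log a := by
      have := Real.one_sub_inv_le_log_of_pos (x := b / a) (by positivity)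
      rw [Real.log_div hl2.ne' hl1.ne'] at this
      refine le_trans (le_of_eq ?_) this
      field_simp
    have h3 : ArithmeticFunction.vonMangoldt (n + 1) / (((n + 1 : ℕ) : ℝ) * b) =
      ArithmeticFunction.vonMangoldt (n + 1) / ((n + 1 : ℕ) : ℝ) / b := by rw [div_div]
    rw [h3, add_div]
    have e1 : A * (1 / a - 1 / b) = A / a - A / b := by ring
    have e2 : (a + chebC) * (1 / a - 1 / b) = a * (1 / a - 1 / b) + chebC * (1 / a - 1 / b) := by ring
    have e3 : chebC * (1 / a - 1 / b) = chebC * (1 / Real.log 2 - 1 / b) - chebC * (1 / Real.log 2 - 1 / a) := by ring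
    linarith

lemma mertens_upper : ∃ C : ℝ, 0 < C ∧ ∀ n : ℕ, 2 ≤ n → primeRec n ≤ Real.log (Real.log n) + C := by
  have hl2 : 0 < Real.log 2 := Real.log_pos (by norm_num)
  have hc := chebC_pos
  refine ⟨1 + 2 * (chebC / Real.log 2) + |Real.log (Real.log 2)|, by positivity, fun n hn => ?_⟩
  have h := mertens_aux n hn
  have hA := sum_vonMangoldt_div_le n (by omega)
  have hn2 : (2 : ℝ) ≤ n := by exact_mod_cast hn
  have hl : Real.log 2 ≤ Real.log n := Real.log_le_log (by norm_num) hn2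
  have hl1 : 0 < Real.log n := hl2.trans_le hl
  have h1 : (∑ q ∈ Finset.Ioc 0 n, ArithmeticFunction.vonMangoldt q / q) / Real.log n ≤
      1 + chebC / Real.log 2 := by
    calc _ ≤ (Real.log n + chebC) / Real.log n := by gcongr
      _ = 1 + chebC / Real.log n := by field_simp
      _ ≤ _ := by gcongr
  have h2 : primeRec n ≤
      ∑ q ∈ Finset.Ioc 0 n, ArithmeticFunction.vonMangoldt q / (q * Real.log q) := by
    unfold primeRec
    calc ∑ p ∈ Nat.primesLE n, (1 : ℝ) / p
        = ∑ p ∈ Nat.primesLE n, ArithmeticFunction.vonMangoldt p / (p * Real.log p) := by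
          refine Finset.sum_congr rfl fun p hp => ?_
          have hp' := Nat.prime_of_mem_primesLE hp
          rw [ArithmeticFunction.vonMangoldt_apply_prime hp']
          have : 0 < Real.log p := Real.log_pos (by exact_mod_cast hp'.one_lt)
          field_simp
      _ ≤ _ := by
          refine Finset.sum_le_sum_of_subset_of_nonneg ?_ ?_
          · intro p hp
            rw [Nat.mem_primesLE] at hp
            rw [Finset.mem_Ioc]
            exact ⟨hp.2.pos, hp.1⟩
          · intro q hq _
            have : 0 ≤ Real.log (q : ℝ) := Real.log_natCast_nonneg q
            exact div_nonneg ArithmeticFunction.vonMangoldt_nonneg (by positivity)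
  have h3 : chebC * (1 / Real.log 2 - 1 / Real.log n) ≤ chebC / Real.log 2 := by
    have : 0 < chebC / Real.log n := by positivity
    have e : chebC * (1 / Real.log 2 - 1 / Real.log n) = chebC / Real.log 2 - chebC / Real.log n := by ring
    linarith
  have h4 := neg_abs_le (Real.log (Real.log 2))
  linarith

lemma sum_tele (x : ℕ) (hx : 1 ≤ x) :
    ∑ n ∈ Finset.Ioc 1 x, (1 : ℝ) / (n * (n - 1)) = 1 - 1 / x := by
  induction x, hx using Nat.le_induction with
  | base => simp
  | succ n hn ih =>
    rw [← Finset.insert_Ioc_right_eq_Ioc_add_one (by omega), Finset.sum_insert (by simp), ih]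
    have : (1 : ℝ) ≤ n := by exact_mod_cast hn
    push_cast
    have h1 : (n : ℝ) + 1 - 1 ≠ 0 := by simp; positivity
    field_simp
    ring

lemma sum_primes_tele (x : ℕ) :
    ∑ p ∈ Nat.primesLE x, (1 : ℝ) / (p * (p - 1)) ≤ 1 := by
  rcases Nat.eq_zero_or_pos x with rfl | hx
  · simp
  · have h := sum_tele x hx
    have : ∑ p ∈ Nat.primesLE x, (1 : ℝ) / (p * (p - 1)) ≤
        ∑ n ∈ Finset.Ioc 1 x, (1 : ℝ) / (n * (n - 1)) := by
      refine Finset.sum_le_sum_of_subset_of_nonneg ?_ ?_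
      · intro p hp
        rw [Nat.mem_primesLE] at hp
        rw [Finset.mem_Ioc]
        exact ⟨hp.2.one_lt, hp.1⟩
      · intro n hn _
        rw [Finset.mem_Ioc] at hn
        have : (1 : ℝ) ≤ n := by exact_mod_cast hn.1.le
        have : (0 : ℝ) ≤ n - 1 := by linarith
        positivity
    have h0 : (0 : ℝ) ≤ 1 / x := by positivity
    linarith

lemma euler_factor_le (p t : ℝ) (hp : 2 ≤ p) (ht0 : 0 ≤ t) (ht1 : t ≤ 1) :
    (1 - t * p⁻¹)⁻¹ ≤ Real.exp (t / p + 1 / (p * (p - 1))) := by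
  have hp0 : 0 < p := by linarith
  have hpt : 0 < p - t := by linarith
  have hp1 : 0 < p - 1 := by linarith
  have h1 : (1 - t * p⁻¹)⁻¹ = t / (p - t) + 1 := by field_simp; ring
  rw [h1]
  refine (Real.add_one_le_exp _).trans (Real.exp_le_exp.mpr ?_)
  have h2 : t / (p - t) = t / p + t ^ 2 / (p * (p - t)) := by field_simp; ring
  rw [h2]
  have h3 : t ^ 2 / (p * (p - t)) ≤ 1 / (p * (p - 1)) := by
    apply div_le_div₀ (by norm_num) (by nlinarith) (by positivity)
    apply mul_le_mul_of_nonneg_left _ hp0.le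
    linarith
  linarith

lemma sum_mult_div_le (g : ℕ →*₀ ℝ) (hg0 : ∀ n, 0 ≤ g n) (hg1 : ∀ n, g n ≤ 1) (x : ℕ) :
    ∑ m ∈ Finset.Ioc 0 x, g m / m ≤
      Real.exp (∑ p ∈ Nat.primesLE x, g p / p + 1) := by
  let f : ℕ →* ℝ :=
    { toFun := fun n => g n * (n : ℝ)⁻¹
      map_one' := by simp
      map_mul' := by intro a b; simp only [map_mul, Nat.cast_mul, mul_inv]; ring }
  have hf : ∀ n, f n = g n * (n : ℝ)⁻¹ := fun n => rfl
  have hf0 : ∀ n, 0 ≤ f n := fun n => mul_nonneg (hg0 n) (by positivity)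
  have hlt : ∀ {p : ℕ}, p.Prime → ‖f p‖ < 1 := by
    intro p hp
    rw [Real.norm_of_nonneg (hf0 p), hf]
    have : (2 : ℝ) ≤ p := by exact_mod_cast hp.two_le
    calc g p * (p : ℝ)⁻¹ ≤ 1 * (2 : ℝ)⁻¹ := by
          apply mul_le_mul (hg1 p) _ (by positivity) (by norm_num)
          exact inv_anti₀ (by norm_num) this
      _ < 1 := by norm_num
  have h := (EulerProduct.summable_and_hasSum_smoothNumbers_prod_primesBelow_geometric hlt (x + 1)).2
  have h' := (hasSum_subtype_iff_indicator (f := fun n => f n) (s := (x + 1).smoothNumbers)).mp h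
  have h1 : ∑ m ∈ Finset.Ioc 0 x, g m / m ≤ ∏ p ∈ (x + 1).primesBelow, (1 - f p)⁻¹ := by
    have h2 := sum_le_hasSum (Finset.Ioc 0 x) (fun i _ => by
      by_cases hi : i ∈ (x + 1).smoothNumbers
      · rw [Set.indicator_of_mem hi]; exact hf0 i
      · rw [Set.indicator_of_notMem hi]) h'
    refine le_trans (le_of_eq ?_) h2
    refine Finset.sum_congr rfl fun m hm => ?_
    rw [Finset.mem_Ioc] at hm
    rw [Set.indicator_of_mem, hf, div_eq_mul_inv]
    exact Nat.mem_smoothNumbers_of_lt hm.1 (by omega)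
  refine h1.trans ?_
  change ∏ p ∈ Nat.primesLE x, (1 - f p)⁻¹ ≤ _
  have h3 := sum_primes_tele x
  calc ∏ p ∈ Nat.primesLE x, (1 - f p)⁻¹
      ≤ ∏ p ∈ Nat.primesLE x, Real.exp (g p / p + 1 / ((p : ℝ) * (p - 1))) := by
        refine Finset.prod_le_prod ?_ ?_
        · intro p hp
          have := hlt (Nat.prime_of_mem_primesLE hp)
          rw [Real.norm_of_nonneg (hf0 p)] at this
          exact inv_nonneg.mpr (by linarith)
        · intro p hp
          rw [hf]
          exact euler_factor_le p (g p) (by exact_mod_cast (Nat.prime_of_mem_primesLE hp).two_le)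
            (hg0 p) (hg1 p)
    _ = Real.exp (∑ p ∈ Nat.primesLE x, g p / p +
          ∑ p ∈ Nat.primesLE x, 1 / ((p : ℝ) * (p - 1))) := by
        rw [← Real.exp_sum, Finset.sum_add_distrib]
    _ ≤ _ := Real.exp_le_exp.mpr (by linarith)

lemma sum_log_ge (n : ℕ) : n * Real.log n - n ≤ ∑ m ∈ Finset.Ioc 0 n, Real.log m := by
  induction n with
  | zero => simp
  | succ n ih =>
    rw [← Finset.insert_Ioc_right_eq_Ioc_add_one (by omega), Finset.sum_insert (by simp)]
    rcases Nat.eq_zero_or_pos n with rfl | hn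
    · simp
    · have hn' : (0 : ℝ) < n := by exact_mod_cast hn
      have h := Real.log_le_sub_one_of_pos (x := ((n + 1 : ℕ) : ℝ) / n) (by positivity)
      rw [Real.log_div (by positivity) (by positivity)] at h
      have h2 : (n : ℝ) * (Real.log ((n + 1 : ℕ) : ℝ) - Real.log n) ≤ n * (((n + 1 : ℕ) : ℝ) / n - 1) :=
        mul_le_mul_of_nonneg_left h hn'.le
      have h3 : (n : ℝ) * (((n + 1 : ℕ) : ℝ) / n - 1) = 1 := by
        push_cast; field_simp; ring
      push_cast at h2 h3 ih ⊢
      nlinarith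

lemma sum_mult_log (g : ℕ →*₀ ℝ) (hg0 : ∀ n, 0 ≤ g n) (hg1 : ∀ n, g n ≤ 1) (x : ℕ) :
    ∑ m ∈ Finset.Ioc 0 x, g m * Real.log m ≤
      chebC * x * ∑ m ∈ Finset.Ioc 0 x, g m / m := by
  let G : ArithmeticFunction ℝ := ⟨fun n => g n, map_zero g⟩
  let H : ArithmeticFunction ℝ := ⟨fun n => g n * ArithmeticFunction.vonMangoldt n, by simp⟩
  have hG : ∀ n, G n = g n := fun n => rfl
  have hH : ∀ n, H n = g n * ArithmeticFunction.vonMangoldt n := fun n => rfl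
  have h1 : ∀ m, (G * H) m = g m * Real.log m := by
    intro m
    rw [ArithmeticFunction.mul_apply, ← ArithmeticFunction.vonMangoldt_sum,
      ← Nat.sum_divisorsAntidiagonal' (fun _ b => ArithmeticFunction.vonMangoldt b), Finset.mul_sum]
    refine Finset.sum_congr rfl fun ab hab => ?_
    rw [hG, hH, ← (Nat.mem_divisorsAntidiagonal.mp hab).1, map_mul]
    ring
  calc ∑ m ∈ Finset.Ioc 0 x, g m * Real.log m = ∑ m ∈ Finset.Ioc 0 x, (G * H) m :=
        Finset.sum_congr rfl fun m _ => (h1 m).symm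
    _ = ∑ k ∈ Finset.Ioc 0 x, G k * ∑ q ∈ Finset.Ioc 0 (x / k), H q :=
        ArithmeticFunction.sum_Ioc_mul_eq_sum_sum _ _ _
    _ ≤ ∑ k ∈ Finset.Ioc 0 x, g k * (chebC * ((x : ℝ) / k)) := by
        refine Finset.sum_le_sum fun k hk => ?_
        rw [hG]
        refine mul_le_mul_of_nonneg_left ?_ (hg0 k)
        refine le_trans ?_ (psi_sum_le ((x : ℝ) / k) (x / k) Nat.cast_div_le)
        refine Finset.sum_le_sum fun q hq => ?_
        rw [hH]
        exact mul_le_of_le_one_left ArithmeticFunction.vonMangoldt_nonneg (hg1 q)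
    _ = _ := by
        rw [Finset.mul_sum]
        refine Finset.sum_congr rfl fun k _ => by ring

lemma mean_value : ∃ C : ℝ, 0 < C ∧ ∀ g : ℕ →*₀ ℝ, (∀ n, 0 ≤ g n) → (∀ n, g n ≤ 1) →
    ∀ x : ℕ, 2 ≤ x → ∑ m ∈ Finset.Ioc 0 x, g m ≤
      C * x * Real.exp (-∑ p ∈ Nat.primesLE x, (1 - g p) / p) := by
  obtain ⟨C2, hC2, hM⟩ := mertens_upper
  have hc := chebC_pos
  refine ⟨chebC * Real.exp (C2 + 1) + Real.exp C2, by positivity, ?_⟩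
  intro g hg0 hg1 x hx
  have hx2 : (2 : ℝ) ≤ x := by exact_mod_cast hx
  have hl1 : 0 < Real.log x := Real.log_pos (by linarith)
  set T := ∑ p ∈ Nat.primesLE x, (1 - g p) / p with hT
  have hE := hM x hx
  have hsum : ∑ p ∈ Nat.primesLE x, g p / p = primeRec x - T := by
    unfold primeRec
    rw [hT, ← Finset.sum_sub_distrib]
    refine Finset.sum_congr rfl fun p _ => by ring
  have hTE : T ≤ primeRec x := by
    have : 0 ≤ ∑ p ∈ Nat.primesLE x, g p / p :=
      Finset.sum_nonneg fun p _ => div_nonneg (hg0 p) (by positivity)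
    linarith
  have hA : ∑ m ∈ Finset.Ioc 0 x, g m / m ≤ Real.log x * Real.exp (C2 + 1) * Real.exp (-T) := by
    refine (sum_mult_div_le g hg0 hg1 x).trans ?_
    rw [hsum]
    calc Real.exp (primeRec x - T + 1) ≤ Real.exp (Real.log (Real.log x) + (C2 + 1) + (-T)) :=
          Real.exp_le_exp.mpr (by linarith)
      _ = _ := by rw [Real.exp_add, Real.exp_add, Real.exp_log hl1]
  have hB : 1 ≤ Real.log x * Real.exp C2 * Real.exp (-T) := by
    calc (1 : ℝ) = Real.exp 0 := Real.exp_zero.symm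
      _ ≤ Real.exp (Real.log (Real.log x) + C2 + (-T)) := Real.exp_le_exp.mpr (by linarith)
      _ = _ := by rw [Real.exp_add, Real.exp_add, Real.exp_log hl1]
  have h1 : Real.log x * ∑ m ∈ Finset.Ioc 0 x, g m ≤
      chebC * x * ∑ m ∈ Finset.Ioc 0 x, g m / m + x := by
    have h2 := sum_mult_log g hg0 hg1 x
    have h3 : ∑ m ∈ Finset.Ioc 0 x, g m * (Real.log x - Real.log m) ≤
        ∑ m ∈ Finset.Ioc 0 x, (Real.log x - Real.log m) := by
      refine Finset.sum_le_sum fun m hm => ?_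
      rw [Finset.mem_Ioc] at hm
      refine mul_le_of_le_one_left (sub_nonneg.mpr ?_) (hg1 m)
      exact Real.log_le_log (by exact_mod_cast hm.1) (by exact_mod_cast hm.2)
    have h4 := sum_log_ge x
    have h5 : ∑ m ∈ Finset.Ioc 0 x, (Real.log x - Real.log m) =
        x * Real.log x - ∑ m ∈ Finset.Ioc 0 x, Real.log m := by
      rw [Finset.sum_sub_distrib]; simp
    have h6 : Real.log x * ∑ m ∈ Finset.Ioc 0 x, g m = ∑ m ∈ Finset.Ioc 0 x, g m * Real.log m +
        ∑ m ∈ Finset.Ioc 0 x, g m * (Real.log x - Real.log m) := by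
      rw [← Finset.sum_add_distrib, Finset.mul_sum]
      refine Finset.sum_congr rfl fun m _ => by ring
    linarith
  have h2 : chebC * x * ∑ m ∈ Finset.Ioc 0 x, g m / m ≤
      chebC * x * (Real.log x * Real.exp (C2 + 1) * Real.exp (-T)) :=
    mul_le_mul_of_nonneg_left hA (by positivity)
  have h3 : (x : ℝ) * 1 ≤ x * (Real.log x * Real.exp C2 * Real.exp (-T)) :=
    mul_le_mul_of_nonneg_left hB (by positivity)
  refine le_of_mul_le_mul_left ?_ hl1
  calc _ ≤ _ := h1
    _ ≤ chebC * x * (Real.log x * Real.exp (C2 + 1) * Real.exp (-T)) +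
        x * (Real.log x * Real.exp C2 * Real.exp (-T)) := by linarith
    _ = _ := by ring

/-- Number of prime factors in `S`, with multiplicity. -/
def omS (S : Finset ℕ) (n : ℕ) : ℕ := ∑ p ∈ S, n.factorization p

lemma omS_mul (S : Finset ℕ) {a b : ℕ} (ha : a ≠ 0) (hb : b ≠ 0) :
    omS S (a * b) = omS S a + omS S b := by
  unfold omS
  rw [Nat.factorization_mul ha hb, ← Finset.sum_add_distrib]
  rfl

lemma omS_prime (S : Finset ℕ) {p : ℕ} (hp : p.Prime) : omS S p = if p ∈ S then 1 else 0 := by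
  unfold omS
  rw [hp.factorization]
  simp [Finsupp.single_apply]

/-- The completely multiplicative function `v ^ Ω_S`. -/
def gS (v : ℝ) (S : Finset ℕ) : ℕ →*₀ ℝ where
  toFun n := if n = 0 then 0 else v ^ omS S n
  map_zero' := by simp
  map_one' := by simp [omS]
  map_mul' := by
    intro a b
    by_cases ha : a = 0
    · simp [ha]
    by_cases hb : b = 0
    · simp [hb]
    simp [ha, hb, omS_mul S ha hb, pow_add]

lemma gS_apply (v : ℝ) (S : Finset ℕ) {n : ℕ} (hn : n ≠ 0) : gS v S n = v ^ omS S n := by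
  change (if n = 0 then 0 else v ^ omS S n) = _
  simp [hn]

lemma gS_nonneg {v : ℝ} (hv : 0 ≤ v) (S : Finset ℕ) (n : ℕ) : 0 ≤ gS v S n := by
  by_cases hn : n = 0
  · simp [hn]
  · rw [gS_apply v S hn]; positivity

lemma gS_le_one {v : ℝ} (hv : 0 ≤ v) (hv1 : v ≤ 1) (S : Finset ℕ) (n : ℕ) : gS v S n ≤ 1 := by
  by_cases hn : n = 0
  · simp [hn]
  · rw [gS_apply v S hn]; exact pow_le_one₀ hv hv1

lemma gS_sum_primes (v : ℝ) {y x : ℕ} (hyx : y ≤ x) :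
    ∑ p ∈ Nat.primesLE x, (1 - gS v (Nat.primesLE y) p) / p = (1 - v) * primeRec y := by
  unfold primeRec
  rw [Finset.mul_sum, ← Finset.sum_subset (Nat.primesLE_mono hyx)]
  · refine Finset.sum_congr rfl fun p hp => ?_
    have hp' := Nat.prime_of_mem_primesLE hp
    rw [gS_apply _ _ hp'.ne_zero, omS_prime _ hp', if_pos hp]
    ring
  · intro p hp hp2
    have hp' := Nat.prime_of_mem_primesLE hp
    rw [gS_apply _ _ hp'.ne_zero, omS_prime _ hp', if_neg hp2]
    simp

lemma mertens_lower (n : ℕ) (hn : 2 ≤ n) : Real.log (Real.log n) ≤ primeRec n + 1 := by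
  have h := sum_mult_div_le (gS 1 ∅) (gS_nonneg zero_le_one _) (gS_le_one zero_le_one le_rfl _) n
  have h1 : ∑ m ∈ Finset.Ioc 0 n, gS 1 ∅ m / m = (harmonic n : ℝ) := by
    rw [harmonic_eq_sum_Icc]
    push_cast
    refine Finset.sum_congr (by rfl) fun m hm => ?_
    rw [Finset.mem_Icc] at hm
    rw [gS_apply _ _ (by omega)]
    simp
  have h2 : ∑ p ∈ Nat.primesLE n, gS 1 ∅ p / p = primeRec n := by
    unfold primeRec
    refine Finset.sum_congr rfl fun p hp => ?_
    rw [gS_apply _ _ (Nat.prime_of_mem_primesLE hp).ne_zero]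
    simp
  rw [h1, h2] at h
  have h3 := log_add_one_le_harmonic n
  have hn2 : (2 : ℝ) ≤ n := by exact_mod_cast hn
  have h4 : Real.log n ≤ Real.log ((n + 1 : ℕ) : ℝ) :=
    Real.log_le_log (by linarith) (by push_cast; linarith)
  have hl : 0 < Real.log n := Real.log_pos (by linarith)
  rw [Real.log_le_iff_le_exp hl]
  linarith

lemma omS_insert_mul {S : Finset ℕ} {p : ℕ} (hp : p.Prime) (hpS : p ∉ S)
    {m : ℕ} (hm : m ≠ 0) : omS S (p * m) = omS S m := by
  rw [omS_mul S hp.ne_zero hm, omS_prime S hp, if_neg hpS, zero_add]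

lemma omS_insert {S : Finset ℕ} {p : ℕ} (hpS : p ∉ S) (m : ℕ) :
    omS (insert p S) m = m.factorization p + omS S m := by
  unfold omS
  rw [Finset.sum_insert hpS]

/-- Splitting a sum into multiples and non-multiples of `p`. -/
lemma sum_split_dvd (p : ℕ) (hp : 0 < p) (X : ℕ) (F : ℕ → ℝ) :
    ∑ n ∈ Finset.Ioc 0 X, F n = ∑ n ∈ (Finset.Ioc 0 X).filter (fun n => ¬ p ∣ n), F n +
      ∑ m ∈ Finset.Ioc 0 (X / p), F (p * m) := by
  rw [← Finset.sum_filter_add_sum_filter_not (Finset.Ioc 0 X) (fun n => p ∣ n), add_comm]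
  congr 1
  symm
  refine Finset.sum_bij (fun m _ => p * m) ?_ ?_ ?_ ?_
  · intro m hm
    rw [Finset.mem_Ioc, Nat.le_div_iff_mul_le hp] at hm
    rw [Finset.mem_filter, Finset.mem_Ioc]
    exact ⟨⟨Nat.mul_pos hp hm.1, by rw [mul_comm]; exact hm.2⟩, dvd_mul_right _ _⟩
  · intro a _ b _ h
    exact Nat.eq_of_mul_eq_mul_left hp h
  · intro n hn
    rw [Finset.mem_filter, Finset.mem_Ioc] at hn
    obtain ⟨⟨h1, h2⟩, m, rfl⟩ := hn
    refine ⟨m, ?_, rfl⟩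
    rw [Finset.mem_Ioc, Nat.le_div_iff_mul_le hp]
    exact ⟨Nat.pos_of_mul_pos_left h1, by rw [mul_comm]; exact h2⟩
  · intros; rfl

lemma case_one_sum (z : ℝ) (hz1 : 1 ≤ z) (hz2 : z < 2) (S : Finset ℕ) (hS : ∀ q ∈ S, q.Prime) :
    ∀ X : ℕ, ∑ n ∈ Finset.Ioc 0 X, z ^ omS S n ≤
      X * ∏ p ∈ S, (((p : ℝ) - 1) / (p - z)) := by
  induction S using Finset.induction with
  | empty => intro X; simp [omS]
  | insert p S hpS ih =>
    have hp : p.Prime := hS p (Finset.mem_insert_self _ _)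
    have hS' : ∀ q ∈ S, q.Prime := fun q hq => hS q (Finset.mem_insert_of_mem hq)
    specialize ih hS'
    have hp2 : (2 : ℝ) ≤ p := by exact_mod_cast hp.two_le
    have hpz : 0 < (p : ℝ) - z := by linarith
    have hp0 : (0 : ℝ) < p := by linarith
    set P := ∏ q ∈ S, (((q : ℝ) - 1) / (q - z)) with hP
    have hPnn : 0 ≤ P := by
      refine Finset.prod_nonneg fun q hq => ?_
      have : (2 : ℝ) ≤ q := by exact_mod_cast (hS' q hq).two_le
      exact div_nonneg (by linarith) (by linarith)
    have key : ∀ X : ℕ, ∑ n ∈ Finset.Ioc 0 X, z ^ omS (insert p S) n ≤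
        ∑ n ∈ Finset.Ioc 0 X, z ^ omS S n + (z - 1) * P * X / (p - z) := by
      intro X
      induction X using Nat.strong_induction_on with
      | _ X ihX =>
      rcases Nat.eq_zero_or_pos X with rfl | hX
      · simp
      have hlt : X / p < X := Nat.div_lt_self hX hp.one_lt
      have h1 := ihX _ hlt
      rw [sum_split_dvd p hp.pos X, sum_split_dvd p hp.pos X (fun n => z ^ omS S n)]
      have e1 : ∑ n ∈ (Finset.Ioc 0 X).filter (fun n => ¬ p ∣ n), z ^ omS (insert p S) n =
          ∑ n ∈ (Finset.Ioc 0 X).filter (fun n => ¬ p ∣ n), z ^ omS S n := by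
        refine Finset.sum_congr rfl fun n hn => ?_
        rw [omS_insert hpS, Nat.factorization_eq_zero_of_not_dvd (Finset.mem_filter.mp hn).2,
          zero_add]
      have e2 : ∑ m ∈ Finset.Ioc 0 (X / p), z ^ omS (insert p S) (p * m) =
          z * ∑ m ∈ Finset.Ioc 0 (X / p), z ^ omS (insert p S) m := by
        rw [Finset.mul_sum]
        refine Finset.sum_congr rfl fun m hm => ?_
        rw [omS_mul _ hp.ne_zero (by rw [Finset.mem_Ioc] at hm; omega), omS_prime _ hp,
          if_pos (Finset.mem_insert_self _ _), pow_add, pow_one]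
      have e3 : ∑ m ∈ Finset.Ioc 0 (X / p), z ^ omS S (p * m) =
          ∑ m ∈ Finset.Ioc 0 (X / p), z ^ omS S m := by
        refine Finset.sum_congr rfl fun m hm => ?_
        rw [omS_insert_mul hp hpS (by rw [Finset.mem_Ioc] at hm; omega)]
      rw [e1, e2, e3]
      have h2 := ih (X / p)
      have h3 : ((X / p : ℕ) : ℝ) ≤ (X : ℝ) / p := Nat.cast_div_le
      set U := ∑ m ∈ Finset.Ioc 0 (X / p), z ^ omS S m
      set V := ∑ m ∈ Finset.Ioc 0 (X / p), z ^ omS (insert p S) m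
      set Y := ((X / p : ℕ) : ℝ)
      have h4 : (z - 1) * U ≤ (z - 1) * (Y * P) := mul_le_mul_of_nonneg_left h2 (by linarith)
      have h5 : z * V ≤ z * (U + (z - 1) * P * Y / (p - z)) :=
        mul_le_mul_of_nonneg_left h1 (by linarith)
      have h6 : (z - 1) * (Y * P) + z * ((z - 1) * P * Y / (p - z)) =
          (z - 1) * P * p / (p - z) * Y := by field_simp; ring
      have h7 : (z - 1) * P * p / (p - z) * Y ≤ (z - 1) * P * p / (p - z) * (X / p) := by
        refine mul_le_mul_of_nonneg_left h3 (div_nonneg (mul_nonneg (mul_nonneg ?_ hPnn) hp0.le) hpz.le)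
        linarith
      have h8 : (z - 1) * P * p / (p - z) * (X / p) = (z - 1) * P * X / (p - z) := by field_simp
      linarith
    intro X
    rw [Finset.prod_insert hpS, ← hP]
    refine (key X).trans ?_
    have h := ih X
    have e : (X : ℝ) * (((p : ℝ) - 1) / (p - z) * P) = X * P + (z - 1) * P * X / (p - z) := by
      field_simp; ring
    linarith

lemma case_one_prod (z : ℝ) (hz1 : 1 ≤ z) (hz2 : z ≤ 3 / 2) (y : ℕ) :
    ∏ p ∈ Nat.primesLE y, (((p : ℝ) - 1) / (p - z)) ≤ Real.exp ((z - 1) * (primeRec y + 3)) := by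
  have h3 := sum_primes_tele y
  calc ∏ p ∈ Nat.primesLE y, (((p : ℝ) - 1) / (p - z))
      ≤ ∏ p ∈ Nat.primesLE y, Real.exp ((z - 1) * (1 / p + 3 * (1 / ((p : ℝ) * (p - 1))))) := by
        refine Finset.prod_le_prod ?_ ?_
        · intro p hp
          have : (2 : ℝ) ≤ p := by exact_mod_cast (Nat.prime_of_mem_primesLE hp).two_le
          exact div_nonneg (by linarith) (by linarith)
        · intro p hp
          have hp2 : (2 : ℝ) ≤ p := by exact_mod_cast (Nat.prime_of_mem_primesLE hp).two_le
          have hpz : 0 < (p : ℝ) - z := by linarith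
          have hp1 : 0 < (p : ℝ) - 1 := by linarith
          have hp0 : 0 < (p : ℝ) := by linarith
          have e : ((p : ℝ) - 1) / (p - z) = (z - 1) * (1 / (p - z)) + 1 := by field_simp; ring
          rw [e]
          refine (Real.add_one_le_exp _).trans (Real.exp_le_exp.mpr ?_)
          refine mul_le_mul_of_nonneg_left ?_ (by linarith)
          have e2 : 1 / ((p : ℝ) - z) = 1 / p + z / (p * (p - z)) := by field_simp; ring
          rw [e2]
          have : z / ((p : ℝ) * (p - z)) ≤ 3 * (1 / ((p : ℝ) * (p - 1))) := by
            rw [mul_one_div, div_le_div_iff₀ (by positivity) (by positivity)]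
            have : z * ((p : ℝ) - 1) ≤ 3 * (p - z) := by nlinarith
            nlinarith
          linarith
    _ = Real.exp ((z - 1) * (primeRec y + 3 * ∑ p ∈ Nat.primesLE y, 1 / ((p : ℝ) * (p - 1)))) := by
        rw [← Real.exp_sum, ← Finset.mul_sum, Finset.sum_add_distrib, ← Finset.mul_sum]
        rfl
    _ ≤ _ := by
        refine Real.exp_le_exp.mpr (mul_le_mul_of_nonneg_left ?_ (by linarith))
        linarith

lemma case_one_count (z : ℝ) (hz1 : 1 ≤ z) (hz2 : z ≤ 3 / 2) (y L : ℕ) (K : ℝ) :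
    (((Finset.Ioc 0 L).filter (fun n => K ≤ (omS (Nat.primesLE y) n : ℝ))).card : ℝ) ≤
      Real.exp (-K * Real.log z) * (L * Real.exp ((z - 1) * (primeRec y + 3))) := by
  have hlz : 0 ≤ Real.log z := Real.log_nonneg hz1
  have hz0 : 0 < z := by linarith
  set S := Nat.primesLE y with hS
  calc (((Finset.Ioc 0 L).filter (fun n => K ≤ (omS S n : ℝ))).card : ℝ)
      = ∑ n ∈ (Finset.Ioc 0 L).filter (fun n => K ≤ (omS S n : ℝ)), (1 : ℝ) := by simp
    _ ≤ ∑ n ∈ (Finset.Ioc 0 L).filter (fun n => K ≤ (omS S n : ℝ)),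
          Real.exp (-K * Real.log z) * z ^ omS S n := by
        refine Finset.sum_le_sum fun n hn => ?_
        have hK := (Finset.mem_filter.mp hn).2
        have : z ^ omS S n = Real.exp (omS S n * Real.log z) := by
          rw [Real.exp_nat_mul, Real.exp_log hz0]
        rw [this, ← Real.exp_add]
        rw [Real.one_le_exp_iff]
        nlinarith
    _ ≤ ∑ n ∈ Finset.Ioc 0 L, Real.exp (-K * Real.log z) * z ^ omS S n := by
        refine Finset.sum_le_sum_of_subset_of_nonneg (Finset.filter_subset _ _) ?_
        intros; positivity
    _ = Real.exp (-K * Real.log z) * ∑ n ∈ Finset.Ioc 0 L, z ^ omS S n := by rw [Finset.mul_sum]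
    _ ≤ _ := by
        refine mul_le_mul_of_nonneg_left ?_ (Real.exp_pos _).le
        refine (case_one_sum z hz1 (by linarith) S
          (fun q hq => Nat.prime_of_mem_primesLE hq) L).trans ?_
        exact mul_le_mul_of_nonneg_left (case_one_prod z hz1 hz2 y) (by positivity)

open Classical in
lemma case_two_count : ∃ C : ℝ, 0 < C ∧ ∀ v : ℝ, 0 < v → v ≤ 1 → ∀ N L : ℕ, 1 ≤ N →
    (2 * N) ^ 2 ≤ L → ∀ K : ℝ,
    (((divSet N L).filter (fun n => (omS (Nat.primesLE (2 * N)) n : ℝ) ≤ K)).card : ℝ) ≤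
      Real.exp (-K * Real.log v) * (C * L * Real.exp (-2 * (1 - v) * primeRec (2 * N))) := by
  obtain ⟨C, hC, hM⟩ := mean_value
  refine ⟨2 * C ^ 2, by positivity, ?_⟩
  intro v hv0 hv1 N L hN hL K
  set S := Nat.primesLE (2 * N) with hS
  have hlv : Real.log v ≤ 0 := Real.log_nonpos hv0.le hv1
  have hN' : (0 : ℝ) < N := by exact_mod_cast hN
  set g := gS v S with hg
  have hg0 : ∀ n, 0 ≤ g n := gS_nonneg hv0.le S
  have hg1 : ∀ n, g n ≤ 1 := gS_le_one hv0.le hv1 S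
  set e := Real.exp (-((1 - v) * primeRec (2 * N))) with he
  have hmean : ∀ x : ℕ, 2 * N ≤ x → ∑ m ∈ Finset.Ioc 0 x, g m ≤ C * x * e := by
    intro x hx
    have h := hM g hg0 hg1 x (by omega)
    rwa [hg, gS_sum_primes v hx] at h
  set w := Real.exp (-K * Real.log v) with hw
  have hw0 : 0 < w := Real.exp_pos _
  have hmain : ∑ n ∈ Finset.Ioc 0 L, ∑ d ∈ Finset.Ioc N (2 * N), (if d ∣ n then g n else 0) ≤
      2 * C ^ 2 * L * (e * e) := by
    rw [Finset.sum_comm]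
    calc ∑ d ∈ Finset.Ioc N (2 * N), ∑ n ∈ Finset.Ioc 0 L, (if d ∣ n then g n else 0)
        ≤ ∑ d ∈ Finset.Ioc N (2 * N), g d * (C * L * e / N) := by
          refine Finset.sum_le_sum fun d hd => ?_
          rw [Finset.mem_Ioc] at hd
          have hd0 : 0 < d := by omega
          rw [sum_split_dvd d hd0 L]
          have z1 : ∑ n ∈ (Finset.Ioc 0 L).filter (fun n => ¬ d ∣ n),
              (if d ∣ n then g n else 0) = 0 := by
            refine Finset.sum_eq_zero fun n hn => ?_
            rw [if_neg (Finset.mem_filter.mp hn).2]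
          rw [z1, zero_add]
          have z2 : ∑ m ∈ Finset.Ioc 0 (L / d), (if d ∣ d * m then g (d * m) else 0) =
              g d * ∑ m ∈ Finset.Ioc 0 (L / d), g m := by
            rw [Finset.mul_sum]
            refine Finset.sum_congr rfl fun m _ => ?_
            rw [if_pos (dvd_mul_right _ _), map_mul]
          rw [z2]
          refine mul_le_mul_of_nonneg_left ?_ (hg0 d)
          have hx : 2 * N ≤ L / d := by
            rw [Nat.le_div_iff_mul_le hd0]
            calc 2 * N * d ≤ 2 * N * (2 * N) := Nat.mul_le_mul_left _ hd.2
              _ = (2 * N) ^ 2 := by ring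
              _ ≤ L := hL
          refine (hmean _ hx).trans ?_
          have h1 : ((L / d : ℕ) : ℝ) ≤ (L : ℝ) / N := by
            refine Nat.cast_div_le.trans ?_
            have : (N : ℝ) ≤ d := by exact_mod_cast hd.1.le
            gcongr
          calc C * ((L / d : ℕ) : ℝ) * e ≤ C * ((L : ℝ) / N) * e := by gcongr
            _ = _ := by ring
      _ = (∑ d ∈ Finset.Ioc N (2 * N), g d) * (C * L * e / N) := by rw [Finset.sum_mul]
      _ ≤ (C * ((2 * N : ℕ) : ℝ) * e) * (C * L * e / N) := by
          refine mul_le_mul_of_nonneg_right ?_ (by positivity)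
          refine le_trans ?_ (hmean (2 * N) le_rfl)
          refine Finset.sum_le_sum_of_subset_of_nonneg ?_ (fun i _ _ => hg0 i)
          intro d hd
          rw [Finset.mem_Ioc] at hd ⊢
          omega
      _ = _ := by push_cast; field_simp
  calc (((divSet N L).filter (fun n => (omS S n : ℝ) ≤ K)).card : ℝ)
      = ∑ n ∈ (divSet N L).filter (fun n => (omS S n : ℝ) ≤ K), (1 : ℝ) := by simp
    _ ≤ ∑ n ∈ (divSet N L).filter (fun n => (omS S n : ℝ) ≤ K),
          w * ∑ d ∈ Finset.Ioc N (2 * N), (if d ∣ n then g n else 0) := by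
        refine Finset.sum_le_sum fun n hn => ?_
        rw [Finset.mem_filter, mem_divSet] at hn
        obtain ⟨⟨⟨hn0, _⟩, d, hd, hdn⟩, hK⟩ := hn
        have h1 : g n ≤ ∑ d ∈ Finset.Ioc N (2 * N), (if d ∣ n then g n else 0) := by
          have := Finset.single_le_sum (f := fun d => if d ∣ n then g n else 0)
            (fun i _ => by split_ifs; exacts [hg0 n, le_rfl]) hd
          simpa [hdn] using this
        have h2 : 1 ≤ w * g n := by
          rw [hg, gS_apply v S (by omega)]
          have : v ^ omS S n = Real.exp (omS S n * Real.log v) := by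
            rw [Real.exp_nat_mul, Real.exp_log hv0]
          rw [this, hw, ← Real.exp_add, Real.one_le_exp_iff]
          nlinarith
        exact h2.trans (mul_le_mul_of_nonneg_left h1 hw0.le)
    _ ≤ ∑ n ∈ Finset.Ioc 0 L, w * ∑ d ∈ Finset.Ioc N (2 * N), (if d ∣ n then g n else 0) := by
        refine Finset.sum_le_sum_of_subset_of_nonneg ?_ ?_
        · intro n hn
          rw [Finset.mem_filter, mem_divSet] at hn
          rw [Finset.mem_Ioc]
          exact hn.1.1
        · intro n _ _
          refine mul_nonneg hw0.le (Finset.sum_nonneg fun d _ => ?_)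
          split_ifs
          exacts [hg0 n, le_rfl]
    _ = w * ∑ n ∈ Finset.Ioc 0 L, ∑ d ∈ Finset.Ioc N (2 * N), (if d ∣ n then g n else 0) := by
        rw [Finset.mul_sum]
    _ ≤ w * (2 * C ^ 2 * L * (e * e)) := mul_le_mul_of_nonneg_left hmain hw0.le
    _ = _ := by
        have : e * e = Real.exp (-2 * (1 - v) * primeRec (2 * N)) := by
          rw [he, ← Real.exp_add]; ring_nf
        rw [this]

/-- The Erdős–Tenenbaum–Ford constant. -/
noncomputable def etf : ℝ := 1 - (1 + Real.log (Real.log 2)) / Real.log 2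

lemma etf_ge : 0.086071 ≤ etf := by
  have h1 := Real.log_two_gt_d9
  have h2 := Real.log_two_lt_d9
  unfold etf
  set s := Real.log 2 with hs
  have hs0 : 0 < s := by linarith
  have h3 : Real.log (2 * s ^ 2) = s + 2 * Real.log s := by
    rw [Real.log_mul (by norm_num) (by positivity), Real.log_pow]; push_cast; ring
  have hx : 2 * s ^ 2 ≤ 1 - 0.0390939 := by nlinarith
  have h4 : Real.log (2 * s ^ 2) ≤ Real.log (1 - 0.0390939) := Real.log_le_log (by positivity) hx
  have h5 := Real.abs_log_sub_add_sum_range_le (x := 0.0390939) (by norm_num [abs_lt]) 5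
  have h6 := (abs_le.mp h5).2
  rw [abs_of_pos (by norm_num)] at h6
  norm_num [Finset.sum_range_succ] at h6
  have h7 : Real.log s ≤ 0.913929 * s - 1 := by
    norm_num at h4 ⊢
    linarith
  have h8 : (1 + Real.log s) / s ≤ 0.913929 := by
    rw [div_le_iff₀ hs0]; linarith
  linarith

lemma density_bound : ∃ C : ℝ, 0 < C ∧ ∀ N L : ℕ, 2 ≤ N → (2 * N) ^ 2 ≤ L →
    ((divSet N L).card : ℝ) ≤ C * L * Real.exp (-etf * Real.log (Real.log N)) := by
  classical
  obtain ⟨C2, hC2, hU⟩ := mertens_upper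
  obtain ⟨C, hC, hcase2⟩ := case_two_count
  have hs1 := Real.log_two_gt_d9
  have hs2 := Real.log_two_lt_d9
  set s := Real.log 2 with hs
  have hs0 : 0 < s := by linarith
  set z : ℝ := 1 / s with hz
  set v : ℝ := 1 / (2 * s) with hv
  have hz1 : 1 ≤ z := by rw [hz, le_div_iff₀ hs0]; linarith
  have hz2 : z ≤ 3 / 2 := by rw [hz, div_le_iff₀ hs0]; linarith
  have hv0 : 0 < v := by positivity
  have hv1 : v ≤ 1 := by rw [hv, div_le_iff₀ (by positivity)]; linarith
  have hlz : Real.log z = -Real.log s := by rw [hz, one_div, Real.log_inv]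
  have hlv : Real.log v = -(s + Real.log s) := by
    rw [hv, one_div, Real.log_inv, Real.log_mul (by norm_num) hs0.ne']
  refine ⟨Real.exp ((z - 1) * (s + C2 + 3)) + C * Real.exp (2 * (1 - v)), by positivity, ?_⟩
  intro N L hN hL
  have hN2 : (2 : ℝ) ≤ N := by exact_mod_cast hN
  have hl : 0 < Real.log N := Real.log_pos (by linarith)
  have hsl : s ≤ Real.log N := Real.log_le_log (by norm_num) hN2
  have hl2 : Real.log ((2 * N : ℕ) : ℝ) = s + Real.log N := by
    push_cast
    rw [Real.log_mul (by norm_num) (by positivity)]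
  set lam := Real.log (Real.log N) with hlam
  have hup : primeRec (2 * N) ≤ lam + (s + C2) := by
    have h := hU (2 * N) (by omega)
    have h2 : Real.log (Real.log ((2 * N : ℕ) : ℝ)) ≤ s + lam := by
      rw [hl2, hs, hlam, ← Real.log_mul (by norm_num) hl.ne']
      exact Real.log_le_log (by linarith) (by linarith)
    linarith
  have hlow : lam - 1 ≤ primeRec (2 * N) := by
    have h := mertens_lower (2 * N) (by omega)
    have h2 : lam ≤ Real.log (Real.log ((2 * N : ℕ) : ℝ)) := by
      rw [hl2]
      exact Real.log_le_log hl (by linarith)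
    linarith
  set K := lam / s with hK
  set S := Nat.primesLE (2 * N) with hS
  have c1 := case_one_count z hz1 hz2 (2 * N) L K
  have c2 := hcase2 v hv0 hv1 N L (by omega) hL K
  have hcard : ((divSet N L).card : ℝ) ≤
      (((Finset.Ioc 0 L).filter (fun n => K ≤ (omS S n : ℝ))).card : ℝ) +
      (((divSet N L).filter (fun n => (omS S n : ℝ) ≤ K)).card : ℝ) := by
    have hsub : divSet N L ⊆ (Finset.Ioc 0 L).filter (fun n => K ≤ (omS S n : ℝ)) ∪
        (divSet N L).filter (fun n => (omS S n : ℝ) ≤ K) := by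
      intro n hn
      rw [Finset.mem_union, Finset.mem_filter, Finset.mem_filter, Finset.mem_Ioc]
      rcases le_total K (omS S n : ℝ) with h | h
      · exact Or.inl ⟨(mem_divSet.mp hn).1, h⟩
      · exact Or.inr ⟨hn, h⟩
    have := (Finset.card_le_card hsub).trans (Finset.card_union_le _ _)
    exact_mod_cast this
  have b1 : Real.exp (-K * Real.log z) * (L * Real.exp ((z - 1) * (primeRec (2 * N) + 3))) ≤
      L * (Real.exp ((z - 1) * (s + C2 + 3)) * Real.exp (-etf * lam)) := by
    have : Real.exp (-K * Real.log z) * (L * Real.exp ((z - 1) * (primeRec (2 * N) + 3))) =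
        L * (Real.exp (-K * Real.log z + (z - 1) * (primeRec (2 * N) + 3))) := by
      rw [Real.exp_add]; ring
    rw [this, ← Real.exp_add]
    refine mul_le_mul_of_nonneg_left (Real.exp_le_exp.mpr ?_) (by positivity)
    have h1 : (z - 1) * (primeRec (2 * N) + 3) ≤ (z - 1) * (lam + (s + C2) + 3) :=
      mul_le_mul_of_nonneg_left (by linarith) (by linarith)
    have h2 : -K * Real.log z + (z - 1) * lam = -etf * lam := by
      rw [hlz, hK, hz]; unfold etf; rw [← hs]; field_simp; ring
    linarith
  have b2 : Real.exp (-K * Real.log v) * (C * L * Real.exp (-2 * (1 - v) * primeRec (2 * N))) ≤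
      L * (C * Real.exp (2 * (1 - v)) * Real.exp (-etf * lam)) := by
    have : Real.exp (-K * Real.log v) * (C * L * Real.exp (-2 * (1 - v) * primeRec (2 * N))) =
        (C * L) * (Real.exp (-K * Real.log v + -2 * (1 - v) * primeRec (2 * N))) := by
      rw [Real.exp_add]; ring
    have h3 : L * (C * Real.exp (2 * (1 - v)) * Real.exp (-etf * lam)) =
        (C * L) * Real.exp (2 * (1 - v) + -etf * lam) := by rw [Real.exp_add]; ring
    rw [this, h3]
    refine mul_le_mul_of_nonneg_left (Real.exp_le_exp.mpr ?_) (by positivity)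
    have h1 : 2 * (1 - v) * (lam - 1) ≤ 2 * (1 - v) * primeRec (2 * N) :=
      mul_le_mul_of_nonneg_left hlow (by linarith)
    have h2 : -K * Real.log v - 2 * (1 - v) * lam = -etf * lam := by
      rw [hlv, hK, hv]; unfold etf; rw [← hs]; field_simp; ring
    linarith
  calc _ ≤ _ := hcard
    _ ≤ _ := add_le_add (c1.trans b1) (c2.trans b2)
    _ = _ := by ring

theorem short_common_tile_one_dim (β : ℝ) (hβ0 : 0 < β) (hβδ : β < 0.086071) :
    ∃ N₀ : ℕ, ∀ N : ℕ, N₀ ≤ N →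
      ((∀ j : ℕ, 1 ≤ j → j ≤ N →
          (1 : ℝ) / 2 ≤ (N : ℝ) / (N + j) ∧ (N : ℝ) / (N + j) ≤ 1) ∧
        ∃ f : ℝ → ℂ, Continuous f ∧ (∫ x, f x) ≠ 0 ∧
          (∀ j : ℕ, 1 ≤ j → j ≤ N → ∃ c : ℂ, TilesAt1 f ((N : ℝ) / (N + j)) c) ∧
          ∃ a : ℝ, Function.support f ⊆ Set.Icc a (a + N / Real.log N ^ β)) := by
  obtain ⟨C, hC, hD⟩ := density_bound
  have htend : Filter.Tendsto (fun N : ℕ => Real.log (Real.log (N : ℝ))) Filter.atTop Filter.atTop :=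
    Real.tendsto_log_atTop.comp (Real.tendsto_log_atTop.comp tendsto_natCast_atTop_atTop)
  have hev := (htend.eventually_ge_atTop (max 0 (Real.log (C + 1) / (0.086071 - β)))).and
    (Filter.eventually_ge_atTop 2)
  obtain ⟨N₀, hN₀⟩ := Filter.eventually_atTop.mp hev
  refine ⟨N₀, fun N hN => ⟨?_, ?_⟩⟩
  · intro j hj1 hjN
    have hN2 := (hN₀ N hN).2
    have h1 : (0 : ℝ) < N := by exact_mod_cast (by omega : 0 < N)
    have h2 : (j : ℝ) ≤ N := by exact_mod_cast hjN
    have h3 : (0 : ℝ) ≤ j := by positivity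
    constructor
    · rw [div_le_div_iff₀ (by norm_num) (by linarith)]; linarith
    · rw [div_le_one (by linarith)]; linarith
  · obtain ⟨hlam, hN2⟩ := hN₀ N hN
    set lam := Real.log (Real.log (N : ℝ)) with hlamdef
    have hlam0 : 0 ≤ lam := (le_max_left _ _).trans hlam
    have hlam1 : Real.log (C + 1) / (0.086071 - β) ≤ lam := (le_max_right _ _).trans hlam
    have hNr : (2 : ℝ) ≤ N := by exact_mod_cast hN2
    have hl : 0 < Real.log (N : ℝ) := Real.log_pos (by linarith)
    set L := (2 * N).factorial * (2 * N) ^ 2 with hL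
    have hLN : (2 * N) ^ 2 ≤ L := Nat.le_mul_of_pos_left _ (Nat.factorial_pos _)
    have hLN' : N ≤ L := by nlinarith
    have hL0 : 0 < L := by omega
    have hLr : (0 : ℝ) < L := by exact_mod_cast hL0
    have hW : (((divSet N L).card : ℝ) + 1) / L ≤ 1 / Real.log N ^ β := by
      have h1 := hD N L hN2 hLN
      have h2 : Real.exp (-etf * lam) ≤ Real.exp (-0.086071 * lam) := by
        refine Real.exp_le_exp.mpr ?_
        have := etf_ge
        nlinarith
      have h3 : 1 ≤ L * Real.exp (-0.086071 * lam) := by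
        have h4 : Real.exp lam ≤ N := by
          rw [hlamdef, Real.exp_log hl]
          have := Real.log_le_sub_one_of_pos (x := (N : ℝ)) (by linarith)
          linarith
        have h5 : (N : ℝ) ≤ L := by exact_mod_cast hLN'
        calc (1 : ℝ) ≤ Real.exp (lam + -0.086071 * lam) := by
              rw [Real.one_le_exp_iff]; linarith
          _ = Real.exp lam * Real.exp (-0.086071 * lam) := Real.exp_add _ _
          _ ≤ _ := mul_le_mul_of_nonneg_right (h4.trans h5) (Real.exp_pos _).le
      have h6 : ((divSet N L).card : ℝ) + 1 ≤ L * ((C + 1) * Real.exp (-0.086071 * lam)) := by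
        have : C * L * Real.exp (-etf * lam) ≤ C * L * Real.exp (-0.086071 * lam) :=
          mul_le_mul_of_nonneg_left h2 (by positivity)
        linarith
      have h7 : (C + 1) * Real.exp (-0.086071 * lam) ≤ Real.exp (-β * lam) := by
        rw [div_le_iff₀ (by linarith)] at hlam1
        calc _ = Real.exp (Real.log (C + 1) + -0.086071 * lam) := by
              rw [Real.exp_add, Real.exp_log (by linarith)]
          _ ≤ _ := Real.exp_le_exp.mpr (by linarith)
      have h8 : 1 / Real.log N ^ β = Real.exp (-β * lam) := by
        rw [Real.rpow_def_of_pos hl, one_div, ← Real.exp_neg]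
        congr 1; ring
      rw [h8, div_le_iff₀ hLr, mul_comm]
      exact h6.trans (mul_le_mul_of_nonneg_left h7 hLr.le)
    have hdiv : ∀ m ∈ Finset.Ioc N (2 * N), m ∣ L := by
      intro m hm
      rw [Finset.mem_Ioc] at hm
      exact (Nat.dvd_factorial (by omega) hm.2).mul_right _
    obtain ⟨f, hf1, hf2, hf3, a, hf4⟩ := tile_exists N L (by omega) hL0 hdiv _ hW
    refine ⟨f, hf1, hf2, hf3, a, ?_⟩
    rwa [mul_one_div] at hf4
end
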